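/- arXiv:2204.08690 — 7 statements merged into one kernel-verified Lean document; each statement's English description precedes it below -/
import Mathlib

section
/- There exist an absolute constant C > 0 and, for every n ≥ 1, 0 ≤ d ≤ n, ε ∈ (0,1], an m-sample tester T with m = ⌈C·d²·2^{d/2}·n·log(n)/ε²⌉ such that for every degree-d Bayes net P over {0,1}^n: (i) if P is a product distribution, then T accepts with probability at least 2/3 under P^{⊗m}; (ii) if P is at total variation distance at least ε from every product distribution on {0,1}^n, then T rejects with probability at least 2/3 under P^{⊗m}. -/
open Finset

/-- `P` is a probability distribution on `{0,1}^n`. -/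
def IsDist {n : ℕ} (P : (Fin n → Bool) → ℝ) : Prop :=
  (∀ x, 0 ≤ P x) ∧ ∑ x : Fin n → Bool, P x = 1

/-- The marginal of `P` on coordinate `i`. -/
noncomputable def marginal {n : ℕ} (P : (Fin n → Bool) → ℝ) (i : Fin n) (b : Bool) : ℝ :=
  ∑ x : Fin n → Bool, if x i = b then P x else 0

/-- `P` is a product distribution: it equals the product of its marginals. -/
def IsProduct {n : ℕ} (P : (Fin n → Bool) → ℝ) : Prop :=
  ∀ x, P x = ∏ i, marginal P i (x i)

/-- Total variation distance between `P` and `Q`. -/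
noncomputable def tvDist {n : ℕ} (P Q : (Fin n → Bool) → ℝ) : ℝ :=
  (1 / 2) * ∑ x : Fin n → Bool, |P x - Q x|

/-- Hellinger distance between `P` and `Q`. -/
noncomputable def hellinger {n : ℕ} (P Q : (Fin n → Bool) → ℝ) : ℝ :=
  (1 / Real.sqrt 2) *
    Real.sqrt (∑ x : Fin n → Bool, (Real.sqrt (P x) - Real.sqrt (Q x)) ^ 2)

/-- `P` is Markov with respect to some DAG on `[n]` of in-degree at most `d`:
there are parent sets `par i` of size at most `d`, acyclic (witnessed by a rank function),
and conditional probability kernels `f i` (depending only on the parents' values)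
such that `P` factorizes accordingly. -/
def IsBayesNet {n : ℕ} (d : ℕ) (P : (Fin n → Bool) → ℝ) : Prop :=
  ∃ (par : Fin n → Finset (Fin n)) (rank : Fin n → ℕ)
    (f : Fin n → Bool → (Fin n → Bool) → ℝ),
    (∀ i, (par i).card ≤ d) ∧
    (∀ i, ∀ j ∈ par i, rank j < rank i) ∧
    (∀ i b x, 0 ≤ f i b x) ∧
    (∀ i x, f i false x + f i true x = 1) ∧
    (∀ i b x y, (∀ j ∈ par i, x j = y j) → f i b x = f i b y) ∧
    (∀ x, P x = ∏ i, f i (x i) x)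

/-- Probability that the `m`-sample tester `T` accepts (outputs `true`),
when its input consists of `m` i.i.d. samples from `P`. -/
noncomputable def acceptProb {n m : ℕ} (P : (Fin n → Bool) → ℝ)
    (T : (Fin m → Fin n → Bool) → Bool) : ℝ :=
  ∑ s : Fin m → Fin n → Bool, if T s then ∏ k, P (s k) else 0

namespace IndepTest

section Finite

variable {α β ι κ : Type*} [Fintype α] [Fintype β] [Fintype ι] [Fintype κ]
  [DecidableEq ι] [DecidableEq κ]

/-- `μ` is a probability mass function on a finite type. -/
def IsPM (μ : α → ℝ) : Prop := (∀ a, 0 ≤ μ a) ∧ ∑ a, μ a = 1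

/-- Expectation of `F` under the weights `μ`. -/
def ev (μ F : α → ℝ) : ℝ := ∑ a, μ a * F a

/-- The product weights `μ^{⊗ι}`. -/
def iid (μ : α → ℝ) (ι : Type*) [Fintype ι] : (ι → α) → ℝ := fun s => ∏ k, μ (s k)

open Classical in
/-- Probability of the event `A` under the weights `μ`. -/
noncomputable def prob (μ : α → ℝ) (A : α → Prop) : ℝ := ev μ fun a => if A a then 1 else 0

lemma ev_mono {μ F G : α → ℝ} (hμ : IsPM μ) (h : ∀ a, F a ≤ G a) : ev μ F ≤ ev μ G :=
  sum_le_sum fun a _ => mul_le_mul_of_nonneg_left (h a) (hμ.1 a)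

lemma ev_const {μ : α → ℝ} (hμ : IsPM μ) (c : ℝ) : ev μ (fun _ => c) = c := by
  simp [ev, ← sum_mul, hμ.2]

lemma ev_add (μ F G : α → ℝ) : ev μ (fun a => F a + G a) = ev μ F + ev μ G := by
  simp [ev, mul_add, sum_add_distrib]

lemma ev_sub (μ F G : α → ℝ) : ev μ (fun a => F a - G a) = ev μ F - ev μ G := by
  simp [ev, mul_sub, sum_sub_distrib]

lemma ev_mul_left (μ F : α → ℝ) (c : ℝ) : ev μ (fun a => c * F a) = c * ev μ F := by
  simp only [ev, mul_sum]; exact sum_congr rfl fun a _ => by ring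

lemma ev_sum {γ : Type*} (μ : α → ℝ) (t : Finset γ) (F : γ → α → ℝ) :
    ev μ (fun a => ∑ i ∈ t, F i a) = ∑ i ∈ t, ev μ (F i) := by
  simp only [ev, mul_sum]; exact sum_comm

lemma ev_nonneg {μ F : α → ℝ} (hμ : IsPM μ) (h : ∀ a, 0 ≤ F a) : 0 ≤ ev μ F :=
  sum_nonneg fun a _ => mul_nonneg (hμ.1 a) (h a)

lemma prob_le_ev {μ : α → ℝ} (hμ : IsPM μ) {A : α → Prop} {F : α → ℝ} (h0 : ∀ a, 0 ≤ F a)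
    (h1 : ∀ a, A a → 1 ≤ F a) : prob μ A ≤ ev μ F :=
  ev_mono hμ fun a => by split_ifs with h; exacts [h1 a h, h0 a]

lemma prob_mono {μ : α → ℝ} (hμ : IsPM μ) {A B : α → Prop} (h : ∀ a, A a → B a) :
    prob μ A ≤ prob μ B :=
  ev_mono hμ fun a => by by_cases hA : A a <;> by_cases hB : B a <;> simp_all

lemma prob_nonneg {μ : α → ℝ} (hμ : IsPM μ) (A : α → Prop) : 0 ≤ prob μ A :=
  ev_nonneg hμ fun a => by split_ifs <;> norm_num

lemma prob_not {μ : α → ℝ} (hμ : IsPM μ) (A : α → Prop) :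
    prob μ (fun a => ¬ A a) = 1 - prob μ A := by
  rw [eq_sub_iff_add_eq, prob, prob, ← ev_add]
  refine Eq.trans ?_ (ev_const hμ 1)
  congr 1; ext a; by_cases h : A a <;> simp [h]

lemma prob_exists_le {γ : Type*} [Fintype γ] {μ : α → ℝ} (hμ : IsPM μ) (A : γ → α → Prop) :
    prob μ (fun a => ∃ i, A i a) ≤ ∑ i, prob μ (A i) := by
  classical
  unfold prob
  rw [← ev_sum]
  refine ev_mono hμ fun a => ?_
  have h0 : ∀ i ∈ (univ : Finset γ), (0 : ℝ) ≤ if A i a then 1 else 0 := fun i _ => by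
    split_ifs <;> norm_num
  split_ifs with h
  · obtain ⟨i, hi⟩ := h
    simpa [hi] using single_le_sum h0 (mem_univ i)
  · exact sum_nonneg h0

lemma markov {μ F : α → ℝ} (hμ : IsPM μ) (h0 : ∀ a, 0 ≤ F a) {c : ℝ} (hc : 0 < c) :
    prob μ (fun a => c ≤ F a) ≤ ev μ F / c := by
  rw [div_eq_inv_mul, ← ev_mul_left]
  refine prob_le_ev hμ (fun a => mul_nonneg (inv_nonneg.2 hc.le) (h0 a)) fun a h => ?_
  rw [← div_eq_inv_mul, one_le_div hc]; exact h

lemma ev_iid_prod (μ : α → ℝ) (F : ι → α → ℝ) :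
    ev (iid μ ι) (fun s => ∏ k, F k (s k)) = ∏ k, ev μ (F k) := by
  simp only [ev, iid, ← prod_mul_distrib, prod_univ_sum, Fintype.piFinset_univ]

lemma isPM_iid {μ : α → ℝ} (hμ : IsPM μ) : IsPM (iid μ ι) := by
  classical
  refine ⟨fun s => prod_nonneg fun k _ => hμ.1 _, ?_⟩
  have := ev_iid_prod (ι := ι) μ fun _ _ => 1
  simpa [ev, hμ.2] using this

lemma ev_iid_sum (μ : α → ℝ) (F : (ι → α) → (κ → α) → ℝ) :
    ev (iid μ (ι ⊕ κ)) (fun s => F (s ∘ Sum.inl) (s ∘ Sum.inr)) =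
      ev (iid μ ι) fun u => ev (iid μ κ) fun v => F u v := by
  simp only [ev, iid, Fintype.prod_sum_type, mul_sum]
  rw [← Fintype.sum_prod_type', ← (Equiv.sumArrowEquivProdArrow ι κ α).sum_comp]
  exact sum_congr rfl fun s _ => by
    simp [Equiv.sumArrowEquivProdArrow, Function.comp_def, mul_assoc]

lemma ev_iid_equiv (μ : α → ℝ) (e : ι ≃ κ) (F : (ι → α) → ℝ) :
    ev (iid μ κ) (fun s => F (s ∘ e)) = ev (iid μ ι) F := by
  simp only [ev, iid]
  rw [← (e.arrowCongr (Equiv.refl α)).symm.sum_comp]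
  refine sum_congr rfl fun s _ => ?_
  rw [← e.prod_comp]
  rfl

lemma ev_iid_embedding {μ : α → ℝ} (hμ : IsPM μ) (e : ι ↪ κ) (F : (ι → α) → ℝ) :
    ev (iid μ κ) (fun s => F (s ∘ e)) = ev (iid μ ι) F := by
  classical
  let E : ι ⊕ ((Set.range e)ᶜ : Set κ) ≃ κ :=
    ((Equiv.ofInjective e e.injective).sumCongr (Equiv.refl _)).trans
      (Equiv.Set.sumCompl (Set.range e))
  have h1 := ev_iid_equiv μ E (fun s => F (s ∘ Sum.inl))
  have h2 := ev_iid_sum (ι := ι) (κ := ((Set.range e)ᶜ : Set κ)) μ fun u _ => F u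
  simp only [ev_const (isPM_iid hμ)] at h2
  rw [← h2, ← h1]
  rfl

lemma ev_iid_curry (μ : α → ℝ) (F : (ι → κ → α) → ℝ) :
    ev (iid μ (ι × κ)) (fun s => F fun i k => s (i, k)) = ev (iid (iid μ κ) ι) F := by
  simp only [ev, iid, Fintype.prod_prod_type]
  exact (Equiv.curry ι κ α).sum_comp fun s => (∏ i, ∏ k, μ (s i k)) * F s

lemma ev_iid_apply {μ : α → ℝ} (hμ : IsPM μ) (k : ι) (F : α → ℝ) :
    ev (iid μ ι) (fun s => F (s k)) = ev μ F := by
  classical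
  have h := ev_iid_prod μ fun j => if j = k then F else 1
  have h1 : ∀ s : ι → α, ∏ j, (if j = k then F else 1 : α → ℝ) (s j) = F (s k) := fun s => by
    rw [prod_eq_single k] <;> simp +contextual
  have h2 : ∏ j, ev μ (if j = k then F else 1) = ev μ F := by
    rw [prod_eq_single k]
    · simp
    · intro j _ hj; rw [if_neg hj]; exact ev_const hμ 1
    · simp
  simpa only [h1, h2] using h

lemma ev_iid_apply_mul {μ : α → ℝ} (hμ : IsPM μ) {k l : ι} (hkl : k ≠ l) (F G : α → ℝ) :
    ev (iid μ ι) (fun s => F (s k) * G (s l)) = ev μ F * ev μ G := by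
  classical
  have h := ev_iid_prod μ fun j => if j = k then F else if j = l then G else 1
  have h1 : ∀ s : ι → α, ∏ j, (if j = k then F else if j = l then G else 1 : α → ℝ) (s j)
      = F (s k) * G (s l) := fun s => by
    rw [prod_eq_mul k l hkl] <;> simp +contextual [hkl.symm]
  have h2 : ∏ j, ev μ (if j = k then F else if j = l then G else 1) = ev μ F * ev μ G := by
    rw [prod_eq_mul k l hkl]
    · simp [hkl.symm]
    · intro j _ hj; rw [if_neg hj.1, if_neg hj.2]; exact ev_const hμ 1
    · simp
    · simp
  simpa only [h1, h2] using h

lemma ev_iid_sum_mul_sum {μ : α → ℝ} (hμ : IsPM μ) (F G : α → ℝ) :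
    ev (iid μ ι) (fun s => (∑ k, F (s k)) * ∑ l, G (s l)) =
      (Fintype.card ι : ℝ) ^ 2 * (ev μ F * ev μ G) +
        Fintype.card ι * (ev μ (fun a => F a * G a) - ev μ F * ev μ G) := by
  classical
  simp only [sum_mul_sum, ev_sum]
  have h : ∀ k l : ι, ev (iid μ ι) (fun s => F (s k) * G (s l)) =
      ev μ F * ev μ G + if k = l then ev μ (fun a => F a * G a) - ev μ F * ev μ G else 0 := by
    intro k l
    split_ifs with hkl
    · subst hkl; rw [ev_iid_apply hμ k fun a => F a * G a]; ring
    · rw [ev_iid_apply_mul hμ hkl]; ring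
  simp only [h, sum_add_distrib, sum_const, card_univ, nsmul_eq_mul, sum_ite_eq, mem_univ, if_true]
  ring

/-- If an event has probability at most `1/16`, then it occurs in at least half of `ι`
independent rounds with probability at most `2^{-|ι|}`. -/
lemma prob_majority_le {μ : α → ℝ} (hμ : IsPM μ) (A : α → Prop) [DecidablePred A]
    (hA : prob μ A ≤ 1 / 16) :
    prob (iid μ ι) (fun s => Fintype.card ι ≤ 2 * #{r | A (s r)}) ≤ (1 / 2) ^ Fintype.card ι := by
  classical
  let g : α → ℝ := fun a => if A a then 4 else 1 / 4
  have hg : ev μ g ≤ 1 / 2 := by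
    have : g = fun a => 1 / 4 + 15 / 4 * (if A a then 1 else 0) := by
      ext a; by_cases h : A a <;> norm_num [g, h]
    rw [this, ev_add, ev_const hμ, ev_mul_left]
    have : ev μ (fun a => if A a then 1 else 0) = prob μ A := by
      unfold prob; congr! 3
    rw [this]; linarith
  have hg0 : ∀ a, 0 ≤ g a := fun a => by simp only [g]; split_ifs <;> norm_num
  calc _ ≤ ev (iid μ ι) (fun s => ∏ r, g (s r)) := by
        refine prob_le_ev (isPM_iid hμ) (fun s => prod_nonneg fun r _ => hg0 _) fun s hs => ?_
        have h1 : ∏ r, g (s r) = 4 ^ #{r | A (s r)} * (1 / 4) ^ #{r | ¬ A (s r)} := by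
          simp only [g, prod_ite, prod_const]
        have h2 := card_filter_add_card_filter_not (s := (univ : Finset ι)) fun r => A (s r)
        rw [card_univ] at h2
        rw [h1, one_div, inv_pow, ← div_eq_mul_inv, one_le_div (by positivity)]
        exact pow_le_pow_right₀ (by norm_num) (by omega)
    _ = ∏ _r : ι, ev μ g := ev_iid_prod μ fun _ => g
    _ ≤ _ := by
        rw [prod_const, card_univ]
        exact pow_le_pow_left₀ (ev_nonneg hμ hg0) hg _

/-- A binomial count `N` of `m` trials with success probability `p` has
`p 𝔼[1 / (N + 1)] ≤ 1 / (m + 1)`. -/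
lemma prob_mul_ev_inv_count_le {μ : α → ℝ} (hμ : IsPM μ) (A : α → Prop) [DecidablePred A]
    (m : ℕ) :
    prob μ A * ev (iid μ (Fin m)) (fun s => 1 / ((#{k | A (s k)} : ℝ) + 1)) ≤ 1 / (m + 1) := by
  classical
  let c : α → ℝ := fun a => if A a then 1 else 0
  have hcount : ∀ (r : ℕ) (s : Fin r → α), (#{k | A (s k)} : ℝ) = ∑ k, c (s k) := by
    intro r s; simp [c]
  simp only [hcount]
  have hp : prob μ A = ev μ c := by unfold prob; congr! 3
  have hterm : ∀ k : Fin (m + 1),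
      ev (iid μ (Fin (m + 1))) (fun s => c (s k) / ∑ l, c (s l)) =
        prob μ A * ev (iid μ (Fin m)) (fun s => 1 / ((∑ l, c (s l)) + 1)) := by
    intro k
    rw [hp]
    simp only [ev, iid]
    rw [← (Fin.insertNthEquiv (fun _ => α) k).sum_comp, Fintype.sum_prod_type, sum_mul_sum]
    refine sum_congr rfl fun a _ => sum_congr rfl fun s _ => ?_
    simp only [Fin.insertNthEquiv_apply, Fin.prod_univ_succAbove _ k, Fin.sum_univ_succAbove _ k,
      Fin.insertNth_apply_same, Fin.insertNth_apply_succAbove]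
    by_cases h : A a
    · simp only [c, h, if_true]; rw [add_comm (1 : ℝ)]; ring
    · simp [c, h]
  have hsum : ∑ k : Fin (m + 1), ev (iid μ (Fin (m + 1))) (fun s => c (s k) / ∑ l, c (s l)) ≤ 1 := by
    rw [← ev_sum, ← ev_const (isPM_iid (ι := Fin (m + 1)) hμ) 1]
    refine ev_mono (isPM_iid hμ) fun s => ?_
    rw [← sum_div]
    exact div_self_le_one _
  simp only [hterm, sum_const, card_univ, Fintype.card_fin, nsmul_eq_mul] at hsum
  rw [le_div_iff₀ (by positivity), mul_comm]
  exact_mod_cast hsum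

end Finite

section Learning

variable {ι : Type*} [Fintype ι] [DecidableEq ι]

/-- The chi-square divergence `∑ (p - q)² / q`. -/
noncomputable def chiSq {β : Type*} [Fintype β] (p q : β → ℝ) : ℝ := ∑ y, (p y - q y) ^ 2 / q y

lemma chiSq_nonneg {β : Type*} [Fintype β] {p q : β → ℝ} (hq : ∀ y, 0 ≤ q y) : 0 ≤ chiSq p q :=
  sum_nonneg fun y _ => div_nonneg (sq_nonneg _) (hq y)

lemma one_add_chiSq {β : Type*} [Fintype β] {p q : β → ℝ} (hq : ∀ y, 0 < q y)
    (hp1 : ∑ y, p y = 1) (hq1 : ∑ y, q y = 1) : 1 + chiSq p q = ∑ y, p y ^ 2 / q y := by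
  have h : ∀ y, (p y - q y) ^ 2 / q y = p y ^ 2 / q y - 2 * p y + q y := fun y => by
    have := (hq y).ne'
    field_simp; ring
  simp only [chiSq, h, sum_add_distrib, sum_sub_distrib, ← mul_sum, hp1, hq1]
  ring

/-- The product weights on a coordinate `t` together with a family `U` of coordinates. -/
def localProd (q : ι → Bool → ℝ) (t : ι) (U : Finset ι) (y : Bool × (U → Bool)) : ℝ :=
  q t y.1 * ∏ j : U, q j (y.2 j)

omit [Fintype ι] in
lemma sum_localProd (q : ι → Bool → ℝ) (t : ι) (U : Finset ι) :
    ∑ y, localProd q t U y = (∑ b, q t b) * ∏ j : U, ∑ b, q j b := by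
  simp only [localProd, Fintype.sum_prod_type, ← mul_sum, ← sum_mul]
  rw [prod_univ_sum, Fintype.piFinset_univ]

omit [Fintype ι] in
/-- The joint chi-square divergence between product weights is controlled by the sum of the
coordinatewise divergences. -/
lemma chiSq_localProd_le {p q : ι → Bool → ℝ} (hq : ∀ j b, 0 < q j b)
    (hp1 : ∀ j, ∑ b, p j b = 1) (hq1 : ∀ j, ∑ b, q j b = 1) (t : ι) (U : Finset ι) {η : ℝ}
    (hη : η ≤ 1) (h : chiSq (p t) (q t) + ∑ j : U, chiSq (p j) (q j) ≤ η) :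
    chiSq (localProd p t U) (localProd q t U) ≤ 2 * η := by
  have hχ : ∀ j, 0 ≤ chiSq (p j) (q j) := fun j => chiSq_nonneg fun b => (hq j b).le
  have hη0 : 0 ≤ η := (add_nonneg (hχ t) (sum_nonneg fun (j : U) _ => hχ j)).trans h
  have h1 := one_add_chiSq (p := localProd p t U) (q := localProd q t U)
    (fun y => mul_pos (hq _ _) (prod_pos fun j _ => hq _ _))
    (by simp only [sum_localProd, hp1, prod_const_one, mul_one])
    (by simp only [sum_localProd, hq1, prod_const_one, mul_one])
  have h2 : ∑ y, localProd p t U y ^ 2 / localProd q t U y =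
      ∑ y, localProd (fun j b => p j b ^ 2 / q j b) t U y := by
    refine sum_congr rfl fun y _ => ?_
    simp only [localProd, mul_pow, prod_div_distrib, prod_pow]
    rw [mul_div_mul_comm]
  have h3 : ∀ j, ∑ b, p j b ^ 2 / q j b ≤ Real.exp (chiSq (p j) (q j)) := fun j => by
    rw [← one_add_chiSq (hq j) (hp1 j) (hq1 j), add_comm]
    exact Real.add_one_le_exp _
  have h4 : 1 + chiSq (localProd p t U) (localProd q t U) ≤ Real.exp η := by
    rw [h1, h2, sum_localProd]
    have h0 : ∀ j, 0 ≤ ∑ b, p j b ^ 2 / q j b := fun j =>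
      sum_nonneg fun b _ => div_nonneg (sq_nonneg _) (hq j b).le
    calc _ ≤ Real.exp (chiSq (p t) (q t)) * ∏ j : U, Real.exp (chiSq (p j) (q j)) :=
          mul_le_mul (h3 t) (prod_le_prod (fun j _ => h0 j) fun j _ => h3 j)
            (prod_nonneg fun j _ => h0 j) (Real.exp_pos _).le
      _ = Real.exp (chiSq (p t) (q t) + ∑ j : U, chiSq (p j) (q j)) := by
          rw [Real.exp_add, Real.exp_sum]
      _ ≤ _ := Real.exp_le_exp.2 h
  have h5 := (abs_le.1 (Real.abs_exp_sub_one_sub_id_le (abs_le.2 ⟨by linarith, hη⟩))).2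
  nlinarith

/-- The marginal weights of coordinate `j`. -/
noncomputable def marg (P : (ι → Bool) → ℝ) (j : ι) (b : Bool) : ℝ := prob P fun x => x j = b

lemma sum_marg {P : (ι → Bool) → ℝ} (hP : IsPM P) (j : ι) : ∑ b, marg P j b = 1 := by
  have h := prob_not hP fun x => x j = true
  simp only [Bool.not_eq_true] at h
  simp only [Fintype.sum_bool, marg, h]
  ring

lemma marg_nonneg {P : (ι → Bool) → ℝ} (hP : IsPM P) (j : ι) (b : Bool) : 0 ≤ marg P j b :=
  prob_nonneg hP _

/-- The add-one estimator of the marginal weights of coordinate `j`. -/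
noncomputable def laplace {m : ℕ} (u : Fin m → ι → Bool) (j : ι) (b : Bool) : ℝ :=
  ((#{k | u k j = b} : ℝ) + 1) / (m + 2)

omit [Fintype ι] [DecidableEq ι] in
lemma laplace_pos {m : ℕ} (u : Fin m → ι → Bool) (j : ι) (b : Bool) : 0 < laplace u j b := by
  unfold laplace; positivity

omit [Fintype ι] [DecidableEq ι] in
lemma sum_laplace {m : ℕ} (u : Fin m → ι → Bool) (j : ι) : ∑ b, laplace u j b = 1 := by
  have h := card_filter_add_card_filter_not (s := (univ : Finset (Fin m))) fun k => u k j = true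
  simp only [Bool.not_eq_true, card_univ, Fintype.card_fin] at h
  have h' : (#{k | u k j = true} : ℝ) + #{k | u k j = false} = m := by exact_mod_cast h
  simp only [Fintype.sum_bool, laplace]
  rw [← add_div, div_eq_one_iff_eq (by positivity)]
  linarith

lemma ev_chiSq_laplace_le {P : (ι → Bool) → ℝ} (hP : IsPM P) (m : ℕ) (j : ι) :
    ev (iid P (Fin m)) (fun u => chiSq (marg P j) (laplace u j)) ≤ 1 / (m + 1) := by
  have h : ∀ u : Fin m → ι → Bool, chiSq (marg P j) (laplace u j) =
      (∑ b, marg P j b * (m + 2) * (marg P j b * (1 / ((#{k | u k j = b} : ℝ) + 1)))) - 1 := by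
    intro u
    have := one_add_chiSq (laplace_pos u j) (sum_marg hP j) (sum_laplace u j)
    rw [eq_sub_iff_add_eq', this]
    refine sum_congr rfl fun b _ => ?_
    unfold laplace
    field_simp
  simp only [h, ev_sub, ev_sum, ev_mul_left, ev_const (isPM_iid hP)]
  have hb : ∀ b, marg P j b * (m + 2) *
      (marg P j b * ev (iid P (Fin m)) fun u => 1 / ((#{k | u k j = b} : ℝ) + 1)) ≤
      marg P j b * ((m + 2) / (m + 1)) := fun b => by
    have := prob_mul_ev_inv_count_le hP (fun x => x j = b) m
    calc _ ≤ marg P j b * (m + 2) * (1 / (m + 1)) :=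
          mul_le_mul_of_nonneg_left this (mul_nonneg (marg_nonneg hP j b) (by positivity))
      _ = _ := by ring
  have := sum_le_sum fun b (_ : b ∈ (univ : Finset Bool)) => hb b
  rw [← sum_mul, sum_marg hP, one_mul] at this
  have h2 : ((m : ℝ) + 2) / (m + 1) - 1 = 1 / (m + 1) := by field_simp; ring
  linarith

/-- With probability at least `31/32` all coordinates in a block are learnt to total
chi-square accuracy `η`. -/
lemma prob_learning_fails_le {P : (ι → Bool) → ℝ} (hP : IsPM P) {m d : ℕ} (t : ι) (U : Finset ι)
    (hU : #U ≤ d) {η : ℝ} (hη : 0 < η) (hm : 32 * (d + 1) ≤ (m : ℝ) * η) :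
    prob (iid P (Fin m)) (fun u => η ≤ chiSq (marg P t) (laplace u t) +
      ∑ j : U, chiSq (marg P j) (laplace u j)) ≤ 1 / 32 := by
  have h0 : ∀ (u : Fin m → ι → Bool) j, 0 ≤ chiSq (marg P j) (laplace u j) := fun u j =>
    chiSq_nonneg fun b => (laplace_pos u j b).le
  have hnn : ∀ u : Fin m → ι → Bool, 0 ≤ chiSq (marg P t) (laplace u t) +
      ∑ j : U, chiSq (marg P j) (laplace u j) := fun u =>
    add_nonneg (h0 u t) (sum_nonneg fun (j : U) _ => h0 u j)
  refine (markov (isPM_iid hP) hnn hη).trans ?_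
  rw [div_le_iff₀ hη, ev_add, ev_sum]
  have h1 := ev_chiSq_laplace_le hP m t
  have h2 : ∑ j : U, ev (iid P (Fin m)) (fun u => chiSq (marg P j) (laplace u j)) ≤
      d * (1 / (m + 1)) := by
    refine (sum_le_card_nsmul _ _ _ fun (j : U) _ => ev_chiSq_laplace_le hP m j).trans ?_
    rw [card_univ, Fintype.card_coe, nsmul_eq_mul]
    exact mul_le_mul_of_nonneg_right (by exact_mod_cast hU) (by positivity)
  have h3 : ((d : ℝ) + 1) * (1 / (m + 1)) ≤ 1 / 32 * η := by
    rw [mul_one_div, div_le_iff₀ (by positivity)]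
    nlinarith
  linarith

end Learning

section Statistic

variable {X V β : Type*} [Fintype X] [Fintype V] [Fintype β] [DecidableEq β]

omit [DecidableEq β] in
/-- Second moment of a bilinear statistic in two independent copies of a random vector. -/
lemma ev_ev_sq_bilinear {ν : V → ℝ} (hν : IsPM ν) (a : V → β → ℝ) (w μ : β → ℝ) (C : β → β → ℝ)
    (hμ : ∀ y, ev ν (fun v => a v y) = μ y) (hC : ∀ y z, ev ν (fun v => a v y * a v z) = C y z) :
    ev ν (fun v => ev ν fun v' => ((∑ y, a v y * a v' y / w y) - ∑ y, μ y ^ 2 / w y) ^ 2) =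
      (∑ y, ∑ z, C y z ^ 2 / (w y * w z)) - (∑ y, μ y ^ 2 / w y) ^ 2 := by
  set D := ∑ y, μ y ^ 2 / w y with hD
  have h1 : ev ν (fun v => ev ν fun v' => ∑ y, a v y * a v' y / w y) = D := by
    have : ∀ v v' y, a v y * a v' y / w y = (w y)⁻¹ * a v y * a v' y := fun v v' y => by ring
    simp only [this, ev_sum, ev_mul_left, hμ]
    have : ∀ v y, (w y)⁻¹ * a v y * μ y = (w y)⁻¹ * μ y * a v y := fun v y => by ring
    simp only [this, ev_mul_left, hμ]
    exact sum_congr rfl fun y _ => by ring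
  have h2 : ev ν (fun v => ev ν fun v' => (∑ y, a v y * a v' y / w y) ^ 2) =
      ∑ y, ∑ z, C y z ^ 2 / (w y * w z) := by
    have : ∀ v v' y z, a v y * a v' y / w y * (a v z * a v' z / w z) =
        (w y)⁻¹ * (w z)⁻¹ * (a v y * a v z) * (a v' y * a v' z) := fun v v' y z => by ring
    simp only [sq (∑ y, _ / w y), sum_mul_sum, this, ev_sum, ev_mul_left, hC]
    have : ∀ v y z, (w y)⁻¹ * (w z)⁻¹ * (a v y * a v z) * C y z =
        (w y)⁻¹ * (w z)⁻¹ * C y z * (a v y * a v z) := fun v y z => by ring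
    simp only [this, ev_mul_left, hC]
    exact sum_congr rfl fun y _ => sum_congr rfl fun z _ => by rw [div_eq_mul_inv, mul_inv]; ring
  have h3 : ∀ v v', ((∑ y, a v y * a v' y / w y) - D) ^ 2 =
      (∑ y, a v y * a v' y / w y) ^ 2 - 2 * D * (∑ y, a v y * a v' y / w y) + D ^ 2 :=
    fun v v' => by ring
  simp only [h3, ev_add, ev_sub, ev_mul_left, ev_const hν, h1, h2]
  ring

/-- Variance bound when the covariance matrix is `(diag p - p pᵀ) / m`. -/
lemma variance_le {p w μ : β → ℝ} (hp : IsPM p) {m : ℝ} (hm : 0 < m) :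
    (∑ y, ∑ z, (μ y * μ z + ((if y = z then p y else 0) - p y * p z) / m) ^ 2 / (w y * w z)) -
        (∑ y, μ y ^ 2 / w y) ^ 2 ≤
      2 / m * (∑ y, p y * (μ y ^ 2 / w y ^ 2)) + 1 / m ^ 2 * ∑ y, p y ^ 2 / w y ^ 2 := by
  set r : β → ℝ := fun y => (w y)⁻¹ with hr
  have e : ∀ y z, (μ y * μ z + ((if y = z then p y else 0) - p y * p z) / m) ^ 2 / (w y * w z) =
      (μ y ^ 2 * r y) * (μ z ^ 2 * r z) +
      (2 / m * (if y = z then p y * μ y ^ 2 * r y ^ 2 else 0) -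
        2 / m * ((p y * μ y * r y) * (p z * μ z * r z))) +
      (1 / m ^ 2 * (if y = z then p y ^ 2 * r y ^ 2 else 0) -
        2 / m ^ 2 * (if y = z then p y ^ 3 * r y ^ 2 else 0) +
        1 / m ^ 2 * ((p y ^ 2 * r y) * (p z ^ 2 * r z))) := by
    intro y z
    rw [div_eq_mul_inv _ (w y * w z), mul_inv]
    change _ * (r y * r z) = _
    split_ifs with h
    · subst h; field_simp; ring
    · field_simp; ring
  have cs : (∑ y, p y ^ 2 * r y) ^ 2 ≤ (∑ y, p y) * ∑ y, p y ^ 3 * r y ^ 2 :=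
    sum_sq_le_sum_mul_sum_of_sq_le_mul _ (fun y _ => hp.1 y)
      (fun y _ => mul_nonneg (pow_nonneg (hp.1 y) 3) (sq_nonneg _)) fun y _ => le_of_eq (by ring)
  have cs0 : 0 ≤ ∑ y, p y ^ 3 * r y ^ 2 :=
    sum_nonneg fun y _ => mul_nonneg (pow_nonneg (hp.1 y) 3) (sq_nonneg _)
  rw [hp.2, one_mul] at cs
  simp only [e, sum_add_distrib, sum_sub_distrib, ← mul_sum, ← sum_mul, sum_ite_eq, mem_univ,
    if_true]
  have e1 : ∑ y, μ y ^ 2 / w y = ∑ y, μ y ^ 2 * r y := rfl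
  have e2 : ∑ y, p y * (μ y ^ 2 / w y ^ 2) = ∑ y, p y * μ y ^ 2 * r y ^ 2 :=
    sum_congr rfl fun y _ => by rw [hr, inv_pow]; ring
  have e3 : ∑ y, p y ^ 2 / w y ^ 2 = ∑ y, p y ^ 2 * r y ^ 2 :=
    sum_congr rfl fun y _ => by rw [hr, inv_pow]; ring
  rw [e1, e2, e3]
  have f1 : 0 ≤ 2 / m * ((∑ y, p y * μ y * r y) * ∑ y, p y * μ y * r y) :=
    mul_nonneg (by positivity) (mul_self_nonneg _)
  have f2 : 1 / m ^ 2 * ((∑ y, p y ^ 2 * r y) * ∑ y, p y ^ 2 * r y) ≤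
      2 / m ^ 2 * ∑ y, p y ^ 3 * r y ^ 2 := by
    rw [← sq]
    calc _ ≤ 1 / m ^ 2 * ∑ y, p y ^ 3 * r y ^ 2 := by gcongr
      _ ≤ _ := by gcongr; norm_num
  linarith

omit [DecidableEq β] in
lemma sum_sq_div_sq_le {p q w : β → ℝ} {κ K Δ B m : ℝ} (hq : ∀ y, 0 ≤ q y) (hK : 0 < K)
    (hcard : (Fintype.card β : ℝ) ≤ K) (hΔ : 0 < Δ) (hκ : κ = Δ / (8 * K))
    (hw : ∀ y, w y = q y + κ) (hD : ∑ y, (p y - q y) ^ 2 / w y ≤ B) (hB : Δ / 8 ≤ B)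
    (hm : 2 ^ 30 * K ≤ (m * Δ) ^ 2) :
    ∑ y, p y ^ 2 / w y ^ 2 ≤ (m * (B / 2048)) ^ 2 := by
  have hκ0 : 0 < κ := hκ ▸ by positivity
  have hw0 : ∀ y, 0 < w y := fun y => hw y ▸ add_pos_of_nonneg_of_pos (hq y) hκ0
  have h1 : ∀ y, p y ^ 2 / w y ^ 2 ≤ 2 + 2 / κ * ((p y - q y) ^ 2 / w y) := fun y => by
    have hqw : q y ^ 2 ≤ w y ^ 2 := pow_le_pow_left₀ (hq y) (by linarith [hw y]) 2
    have h2 : (p y - q y) ^ 2 / w y ^ 2 ≤ 1 / κ * ((p y - q y) ^ 2 / w y) := by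
      rw [sq (w y), ← div_div, div_eq_inv_mul, one_div]
      exact mul_le_mul_of_nonneg_right (inv_anti₀ hκ0 (by linarith [hw y, hq y]))
        (div_nonneg (sq_nonneg _) (hw0 y).le)
    have h3 : p y ^ 2 / w y ^ 2 ≤ 2 + 2 * ((p y - q y) ^ 2 / w y ^ 2) := by
      rw [div_le_iff₀ (pow_pos (hw0 y) 2), add_mul, mul_assoc,
        div_mul_cancel₀ _ (pow_pos (hw0 y) 2).ne']
      nlinarith [sq_nonneg (p y - 2 * q y)]
    calc _ ≤ _ := h3
      _ ≤ 2 + 2 * (1 / κ * ((p y - q y) ^ 2 / w y)) := by linarith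
      _ = _ := by ring
  have h2 : ∑ y, p y ^ 2 / w y ^ 2 ≤ 2 * K + 2 / κ * B := by
    refine (sum_le_sum fun y _ => h1 y).trans ?_
    rw [sum_add_distrib, ← mul_sum, sum_const, card_univ, nsmul_eq_mul]
    have : 2 / κ * ∑ y, (p y - q y) ^ 2 / w y ≤ 2 / κ * B := by gcongr
    linarith
  have hB0 : 0 < B := lt_of_lt_of_le (by positivity) hB
  have h3 : 2 * K + 2 / κ * B ≤ 32 * K * B / Δ := by
    rw [hκ, le_div_iff₀ hΔ]
    field_simp
    nlinarith
  have h4 : 32 * K * B / Δ ≤ (m * (B / 2048)) ^ 2 := by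
    rw [div_le_iff₀ hΔ]
    have h5 : 32 * K * B * Δ ≤ 256 * K * B ^ 2 := by
      have : 0 ≤ K * B * (8 * B - Δ) := mul_nonneg (by positivity) (by linarith)
      nlinarith
    have h6 : 256 * K * B ^ 2 * 2 ^ 22 ≤ (m * Δ) ^ 2 * B ^ 2 := by
      have := mul_le_mul_of_nonneg_right hm (sq_nonneg B)
      nlinarith
    have h7 : 32 * K * B * Δ ^ 2 * 2 ^ 22 ≤ Δ * ((m * Δ) ^ 2 * B ^ 2) := by
      nlinarith [mul_le_mul_of_nonneg_left h5 hΔ.le, mul_le_mul_of_nonneg_left h6 hΔ.le]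
    have h8 : Δ ^ 2 * (32 * K * B * 2 ^ 22) ≤ Δ ^ 2 * (m ^ 2 * B ^ 2 * Δ) := by
      nlinarith
    have h9 := le_of_mul_le_mul_left h8 (by positivity)
    nlinarith
  exact h2.trans (h3.trans h4)

/-- The centred empirical frequency of the value `y` of `φ`. -/
noncomputable def emp {m : ℕ} (φ : X → β) (q : β → ℝ) (v : Fin m → X) (y : β) : ℝ :=
  (∑ k, ((if φ (v k) = y then 1 else 0) - q y)) / m

/-- The bilinear goodness-of-fit statistic for the weights `q` regularized by `κ`. -/
noncomputable def stat {m : ℕ} (φ : X → β) (q : β → ℝ) (κ : ℝ) (v v' : Fin m → X) : ℝ :=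
  ∑ y, emp φ q v y * emp φ q v' y / (q y + κ)

/-- The image of the weights `P` under `φ`. -/
noncomputable def push (φ : X → β) (P : X → ℝ) (y : β) : ℝ := prob P fun x => φ x = y

omit [Fintype β] in
lemma push_eq (φ : X → β) (P : X → ℝ) (y : β) :
    push φ P y = ev P fun x => if φ x = y then 1 else 0 := by
  unfold push prob; congr! 3

lemma isPM_push (φ : X → β) {P : X → ℝ} (hP : IsPM P) : IsPM (push φ P) := by
  refine ⟨fun y => prob_nonneg hP _, ?_⟩
  simp only [push_eq, ← ev_sum, sum_ite_eq, mem_univ, if_true]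
  exact ev_const hP 1

omit [Fintype β] in
lemma ev_emp {P : X → ℝ} (hP : IsPM P) {m : ℕ} (hm : 0 < m) (φ : X → β) (q : β → ℝ) (y : β) :
    ev (iid P (Fin m)) (fun v => emp φ q v y) = push φ P y - q y := by
  have : ∀ v : Fin m → X, emp φ q v y =
      (m : ℝ)⁻¹ * ∑ k, ((if φ (v k) = y then 1 else 0) - q y) := fun v => by
    rw [emp, div_eq_inv_mul]
  simp only [this, ev_mul_left, ev_sum]
  have h : ∀ k : Fin m, ev (iid P (Fin m)) (fun v => (if φ (v k) = y then 1 else 0) - q y) =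
      push φ P y - q y := fun k => by
    rw [ev_iid_apply hP k fun x => (if φ x = y then 1 else 0) - q y, ev_sub, ev_const hP, push_eq]
  simp only [h, sum_const, card_univ, Fintype.card_fin, nsmul_eq_mul]
  have : (m : ℝ) ≠ 0 := by positivity
  field_simp

omit [Fintype β] in
lemma ev_emp_mul_emp {P : X → ℝ} (hP : IsPM P) {m : ℕ} (hm : 0 < m) (φ : X → β) (q : β → ℝ)
    (y z : β) :
    ev (iid P (Fin m)) (fun v => emp φ q v y * emp φ q v z) =
      (push φ P y - q y) * (push φ P z - q z) +
        ((if y = z then push φ P y else 0) - push φ P y * push φ P z) / m := by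
  have : ∀ v : Fin m → X, emp φ q v y * emp φ q v z =
      ((m : ℝ) ^ 2)⁻¹ * ((∑ k, ((if φ (v k) = y then 1 else 0) - q y)) *
        ∑ k, ((if φ (v k) = z then 1 else 0) - q z)) := fun v => by
    rw [emp, emp, div_mul_div_comm, ← sq, div_eq_inv_mul]
  simp only [this, ev_mul_left]
  rw [ev_iid_sum_mul_sum hP (fun x => (if φ x = y then 1 else 0) - q y)
    (fun x => (if φ x = z then 1 else 0) - q z)]
  have e : ∀ x, ((if φ x = y then (1 : ℝ) else 0) - q y) * ((if φ x = z then 1 else 0) - q z) =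
      (if y = z then 1 else 0) * (if φ x = y then 1 else 0) - q z * (if φ x = y then 1 else 0) -
        q y * (if φ x = z then 1 else 0) + q y * q z := by
    intro x
    have : ((if φ x = y then (1 : ℝ) else 0)) * (if φ x = z then 1 else 0) =
        (if y = z then 1 else 0) * (if φ x = y then 1 else 0) := by
      by_cases h1 : φ x = y
      · subst h1; simp
      · simp [h1]
    linear_combination this
  simp only [e, ev_add, ev_sub, ev_mul_left, ev_const hP, ← push_eq, Fintype.card_fin]
  have : (m : ℝ) ≠ 0 := by positivity
  split_ifs
  all_goals field_simp; ring

/-- Concentration of the statistic around the regularized chi-square divergence. -/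
lemma prob_stat_far_le {P : X → ℝ} (hP : IsPM P) {m : ℕ} (hm0 : 0 < m) (φ : X → β) {q : β → ℝ}
    (hq : ∀ y, 0 ≤ q y) {κ K Δ B D : ℝ} (hK : 0 < K) (hcard : (Fintype.card β : ℝ) ≤ K)
    (hΔ : 0 < Δ) (hκ : κ = Δ / (8 * K)) (hD : D = ∑ y, (push φ P y - q y) ^ 2 / (q y + κ))
    (hDB : D ≤ B) (hB : Δ / 8 ≤ B) (hm : 2 ^ 30 * K ≤ (m * Δ) ^ 2) :
    ev (iid P (Fin m)) (fun v => prob (iid P (Fin m)) fun v' =>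
      B / 4 ≤ |stat φ q κ v v' - D|) ≤ 1 / 32 := by
  have hB0 : 0 < B := lt_of_lt_of_le (by positivity) hB
  have hκ0 : 0 < κ := hκ ▸ by positivity
  have hν : IsPM (iid P (Fin m)) := isPM_iid hP
  have hp := isPM_push φ hP
  have hmR : (0 : ℝ) < m := by exact_mod_cast hm0
  have hw0 : ∀ y, 0 < q y + κ := fun y => add_pos_of_nonneg_of_pos (hq y) hκ0
  set V2 := ∑ y, push φ P y ^ 2 / (q y + κ) ^ 2 with hV2
  have hV2le : V2 ≤ (m * (B / 2048)) ^ 2 :=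
    sum_sq_div_sq_le (w := fun y => q y + κ) hq hK hcard hΔ hκ (fun _ => rfl) (hD ▸ hDB) hB hm
  set Y := ∑ y, push φ P y * ((push φ P y - q y) ^ 2 / (q y + κ) ^ 2) with hY
  have hD0 : ∀ y ∈ (univ : Finset β), 0 ≤ (push φ P y - q y) ^ 2 / (q y + κ) := fun y _ =>
    div_nonneg (sq_nonneg _) (hw0 y).le
  have hYle : Y ≤ m * (B / 2048) * B := by
    have h1 : Y ^ 2 ≤ V2 * ∑ y, ((push φ P y - q y) ^ 2 / (q y + κ)) ^ 2 :=
      sum_sq_le_sum_mul_sum_of_sq_le_mul _ (fun y _ => by positivity) (fun y _ => by positivity)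
        fun y _ => le_of_eq (by have := (hw0 y).ne'; field_simp)
    have h2 : ∑ y, ((push φ P y - q y) ^ 2 / (q y + κ)) ^ 2 ≤ B ^ 2 :=
      (sum_sq_le_sq_sum_of_nonneg hD0).trans
        (pow_le_pow_left₀ (sum_nonneg hD0) (hD ▸ hDB) 2)
    have h3 : Y ^ 2 ≤ (m * (B / 2048) * B) ^ 2 := by
      rw [mul_pow _ B]
      exact h1.trans (mul_le_mul hV2le h2 (sum_nonneg fun y _ => sq_nonneg _) (sq_nonneg _))
    exact (abs_le_of_sq_le_sq' h3 (by positivity)).2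
  have hvar : ev (iid P (Fin m)) (fun v => ev (iid P (Fin m)) fun v' =>
      (stat φ q κ v v' - D) ^ 2) ≤ 2 / m * Y + 1 / m ^ 2 * V2 := by
    rw [hD]
    have := ev_ev_sq_bilinear hν (emp φ q) (fun y => q y + κ) (fun y => push φ P y - q y) _
      (ev_emp hP hm0 φ q) (ev_emp_mul_emp hP hm0 φ q)
    exact this.trans_le (variance_le hp hmR)
  have hnum : 2 / m * Y + 1 / m ^ 2 * V2 ≤ (B / 4) ^ 2 * (1 / 32) := by
    calc _ ≤ 2 / m * (m * (B / 2048) * B) + 1 / m ^ 2 * (m * (B / 2048)) ^ 2 := by gcongr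
      _ = B ^ 2 * (2 / 2048 + 1 / 2048 ^ 2) := by field_simp
      _ ≤ _ := by nlinarith [sq_nonneg B]
  have hmk : ∀ v, prob (iid P (Fin m)) (fun v' => B / 4 ≤ |stat φ q κ v v' - D|) ≤
      ((B / 4) ^ 2)⁻¹ * ev (iid P (Fin m)) fun v' => (stat φ q κ v v' - D) ^ 2 := fun v => by
    rw [← div_eq_inv_mul]
    refine le_trans (prob_mono hν fun v' h => ?_) (markov hν (fun v' => sq_nonneg _)
      (by positivity))
    rw [← sq_abs (_ - D)]
    exact pow_le_pow_left₀ (by positivity) h 2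
  refine (ev_mono hν hmk).trans ?_
  rw [ev_mul_left, inv_mul_le_iff₀ (by positivity)]
  exact hvar.trans hnum

omit [DecidableEq β] in
/-- Hellinger separation forces a large regularized chi-square divergence. -/
lemma sum_sqrt_sub_sq_le {p q : β → ℝ} (hp : ∀ y, 0 ≤ p y) (hq : ∀ y, 0 ≤ q y) {κ : ℝ}
    (hκ : 0 < κ) :
    ∑ y, (√(p y) - √(q y)) ^ 2 ≤
      2 * (∑ y, (p y - q y) ^ 2 / (q y + κ)) + Fintype.card β * κ := by
  rw [← nsmul_eq_mul, ← card_univ, ← sum_const, mul_sum, ← sum_add_distrib]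
  refine sum_le_sum fun y _ => ?_
  have hw : 0 < q y + κ := add_pos_of_nonneg_of_pos (hq y) hκ
  obtain ⟨a, b, ha, hb, hpa, hqb⟩ : ∃ a b : ℝ, 0 ≤ a ∧ 0 ≤ b ∧ p y = a ^ 2 ∧ q y = b ^ 2 :=
    ⟨√(p y), √(q y), Real.sqrt_nonneg _, Real.sqrt_nonneg _, (Real.sq_sqrt (hp y)).symm,
      (Real.sq_sqrt (hq y)).symm⟩
  rw [hpa, hqb, Real.sqrt_sq ha, Real.sqrt_sq hb]
  rw [hqb] at hw
  by_cases h : b ^ 2 + κ ≤ 2 * (a + b) ^ 2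
  · have : (a - b) ^ 2 ≤ 2 * ((a ^ 2 - b ^ 2) ^ 2 / (b ^ 2 + κ)) := by
      rw [← mul_div_assoc, le_div_iff₀ hw]
      nlinarith [mul_le_mul_of_nonneg_left h (sq_nonneg (a - b))]
    linarith
  · have : 0 ≤ 2 * ((a ^ 2 - b ^ 2) ^ 2 / (b ^ 2 + κ)) := by positivity
    nlinarith [mul_nonneg ha hb]

omit [DecidableEq β] in
lemma sum_sqrt_sub_sq_le_chiSq {p q : β → ℝ} (hp : ∀ y, 0 ≤ p y) (hq : ∀ y, 0 < q y) :
    ∑ y, (√(p y) - √(q y)) ^ 2 ≤ chiSq p q := by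
  refine sum_le_sum fun y _ => ?_
  rw [le_div_iff₀ (hq y)]
  obtain ⟨a, b, ha, hb, hpa, hqb⟩ : ∃ a b : ℝ, 0 ≤ a ∧ 0 ≤ b ∧ p y = a ^ 2 ∧ q y = b ^ 2 :=
    ⟨√(p y), √(q y), Real.sqrt_nonneg _, Real.sqrt_nonneg _, (Real.sq_sqrt (hp y)).symm,
      (Real.sq_sqrt (hq y).le).symm⟩
  rw [hpa, hqb, Real.sqrt_sq ha, Real.sqrt_sq hb]
  have : b ^ 2 ≤ (a + b) ^ 2 := pow_le_pow_left₀ hb (by linarith) 2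
  nlinarith [mul_le_mul_of_nonneg_left this (sq_nonneg (a - b))]

end Statistic

section BayesNet

variable {ι : Type*} [Fintype ι] [DecidableEq ι]

/-- The Bhattacharyya coefficient of two weight functions. -/
noncomputable def bc {β : Type*} [Fintype β] (p q : β → ℝ) : ℝ := ∑ y, √(p y * q y)

/-- Projection onto a coordinate `t` and a family `U` of coordinates. -/
def proj (t : ι) (U : Finset ι) (x : ι → Bool) : Bool × (U → Bool) := (x t, fun j => x j)

lemma sqrt_mul_le_half_add {a b : ℝ} (ha : 0 ≤ a) (hb : 0 ≤ b) : √(a * b) ≤ (a + b) / 2 := by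
  rw [← Real.sqrt_sq (by linarith : 0 ≤ (a + b) / 2)]
  exact Real.sqrt_le_sqrt (by nlinarith [sq_nonneg (a - b)])

lemma bc_le_one {β : Type*} [Fintype β] {p q : β → ℝ} (hp : IsPM p) (hq : IsPM q) :
    bc p q ≤ 1 := by
  calc bc p q ≤ ∑ y, (p y + q y) / 2 :=
        sum_le_sum fun y _ => sqrt_mul_le_half_add (hp.1 y) (hq.1 y)
    _ = 1 := by rw [← sum_div, sum_add_distrib, hp.2, hq.2]; norm_num

lemma isPM_prod {q : ι → Bool → ℝ} (hq0 : ∀ i b, 0 ≤ q i b) (hq1 : ∀ i, ∑ b, q i b = 1) :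
    IsPM fun x : ι → Bool => ∏ i, q i (x i) := by
  refine ⟨fun x => prod_nonneg fun i _ => hq0 _ _, ?_⟩
  rw [← Fintype.piFinset_univ, ← prod_univ_sum]
  exact prod_eq_one fun i _ => hq1 i

lemma push_prod {q : ι → Bool → ℝ} (hq1 : ∀ i, ∑ b, q i b = 1) {t : ι} {U : Finset ι}
    (ht : t ∉ U) : push (proj t U) (fun x => ∏ i, q i (x i)) = localProd q t U := by
  ext ⟨b, π⟩
  let h : ι → Bool → ℝ := fun i c =>
    q i c * if (i = t → c = b) ∧ ∀ hi : i ∈ U, c = π ⟨i, hi⟩ then 1 else 0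
  have h1 : ∀ x : ι → Bool, (∏ i, q i (x i)) * (if proj t U x = (b, π) then 1 else 0) =
      ∏ i, h i (x i) := by
    intro x
    simp only [h, prod_mul_distrib, prod_ite_zero, prod_const_one]
    congr 2
    simp only [proj, Prod.mk.injEq, funext_iff, Subtype.forall, mem_univ, true_implies,
      eq_iff_iff]
    constructor
    · rintro ⟨rfl, h2⟩ i
      exact ⟨fun e => e ▸ rfl, fun hi => h2 i hi⟩
    · intro h2
      exact ⟨(h2 t).1 rfl, fun i hi => (h2 i).2 hi⟩
  have h2 : ∀ i, ∑ c, h i c =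
      (if i = t then q t b else 1) * if hi : i ∈ U then q i (π ⟨i, hi⟩) else 1 := by
    intro i
    by_cases hit : i = t
    · subst hit; simp [h, ht]
    · by_cases hi : i ∈ U
      · simp only [h, hit, hi, if_false, dif_pos, false_implies, true_and,
          forall_true_left, Fintype.sum_bool, one_mul]
        cases π ⟨i, hi⟩ <;> simp
      · simp only [h, hit, hi, if_false, dif_neg, true_and, not_false_eq_true,
          IsEmpty.forall_iff, if_true, mul_one, hq1]
  rw [push_eq, ev]
  simp only [h1]
  rw [← Fintype.piFinset_univ, ← prod_univ_sum]
  simp only [h2, prod_mul_distrib, prod_ite_eq', mem_univ, if_true, localProd]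
  congr 1
  rw [← prod_subset (subset_univ U) (fun i _ hi => dif_neg hi), ← prod_coe_sort]
  exact prod_congr rfl fun j _ => dif_pos j.2

lemma marg_prod {q : ι → Bool → ℝ} (hq1 : ∀ i, ∑ b, q i b = 1) (t : ι) (b : Bool) :
    marg (fun x => ∏ i, q i (x i)) t b = q t b := by
  have h := congrFun (push_prod hq1 (notMem_empty t)) (b, fun _ => false)
  simp only [localProd, push, univ_eq_empty, prod_empty, mul_one] at h
  rw [← h, marg]
  congr! 2 with x
  simp [proj, eq_iff_true_of_subsingleton]

lemma sum_update (t : ι) (F : (ι → Bool) → ℝ) :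
    ∑ x, ∑ b, F (Function.update x t b) = 2 * ∑ x, F x := by
  have hinv : Function.Involutive fun x : ι → Bool => Function.update x t (!x t) := fun x => by
    simp
  have h1 : ∀ x : ι → Bool, ∑ b, F (Function.update x t b) =
      F x + F (Function.update x t (!x t)) := by
    intro x
    conv_rhs => rw [← Function.update_eq_self t x]
    cases x t <;> simp [add_comm]
  have h2 : ∑ x, F (Function.update x t (!x t)) = ∑ x, F x :=
    Equiv.sum_comp (hinv.toPerm _) F
  rw [sum_congr rfl fun x _ => h1 x, sum_add_distrib, h2, two_mul]

/-- Replacing the factor involving coordinate `t` by one with the same total mass. -/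
lemma sum_mul_congr_coord (t : ι) {G : (ι → Bool) → ℝ} {u v : Bool → (ι → Bool) → ℝ}
    (hG : ∀ x b, G (Function.update x t b) = G x)
    (hu : ∀ x b c, u c (Function.update x t b) = u c x)
    (hv : ∀ x b c, v c (Function.update x t b) = v c x)
    (huv : ∀ x, ∑ b, u b x = ∑ b, v b x) :
    ∑ x, G x * u (x t) x = ∑ x, G x * v (x t) x := by
  have h := sum_update t fun x => G x * u (x t) x
  have h' := sum_update t fun x => G x * v (x t) x
  simp only [hG, hu, hv, Function.update_self, ← mul_sum, huv] at h h'
  linarith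

/-- The data of a Bayes net with binary nodes. -/
structure Net (ι : Type*) where
  par : ι → Finset ι
  rank : ι → ℕ
  f : ι → Bool → (ι → Bool) → ℝ
  rank_lt : ∀ i, ∀ j ∈ par i, rank j < rank i
  nonneg : ∀ i b x, 0 ≤ f i b x
  sum_eq : ∀ i x, ∑ b, f i b x = 1
  congr : ∀ i b x y, (∀ j ∈ par i, x j = y j) → f i b x = f i b y

namespace Net

variable (N : Net ι)

omit [Fintype ι] [DecidableEq ι] in
lemma notMem_par (t : ι) : t ∉ N.par t := fun h => lt_irrefl _ (N.rank_lt t t h)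

/-- The distribution defined by a net. -/
def dist (x : ι → Bool) : ℝ := ∏ i, N.f i (x i) x

/-- The hybrid distribution that uses the net on `A` and the independent weights `q` elsewhere. -/
def hyb (q : ι → Bool → ℝ) (A : Finset ι) (x : ι → Bool) : ℝ :=
  ∏ i, if i ∈ A then N.f i (x i) x else q i (x i)

/-- The factors of the hybrid distribution other than the one at `t`. -/
def rest (q : ι → Bool → ℝ) (A : Finset ι) (t : ι) (x : ι → Bool) : ℝ :=
  ∏ i ∈ univ.erase t, if i ∈ A then N.f i (x i) x else q i (x i)

/-- `A` contains the parents of its elements. -/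
def Closed (A : Finset ι) : Prop := ∀ i ∈ A, N.par i ⊆ A

variable {N} {q : ι → Bool → ℝ} {A : Finset ι} {t : ι}

lemma hyb_eq (ht : t ∉ A) (x : ι → Bool) : N.hyb q A x = N.rest q A t x * q t (x t) := by
  rw [hyb, ← mul_prod_erase univ _ (mem_univ t), if_neg ht, mul_comm, rest]

lemma hyb_insert (x : ι → Bool) :
    N.hyb q (insert t A) x = N.rest q A t x * N.f t (x t) x := by
  rw [hyb, ← mul_prod_erase univ _ (mem_univ t), if_pos (mem_insert_self t A), mul_comm, rest]
  congr 1
  refine prod_congr rfl fun i hi => ?_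
  simp [(mem_erase.1 hi).1]

omit [Fintype ι] in
lemma f_update {i : ι} (hi : t ∉ N.par i) (b c : Bool) (x : ι → Bool) :
    N.f i c (Function.update x t b) = N.f i c x :=
  N.congr _ _ _ _ fun _ hj => Function.update_of_ne (ne_of_mem_of_not_mem hj hi) _ _

lemma rest_update (hA : N.Closed A) (ht : t ∉ A) (x : ι → Bool) (b : Bool) :
    N.rest q A t (Function.update x t b) = N.rest q A t x := by
  refine prod_congr rfl fun i hi => ?_
  rw [Function.update_of_ne (mem_erase.1 hi).1]
  split_ifs with hiA
  · exact f_update (fun h => ht (hA i hiA h)) _ _ _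
  · rfl

lemma rest_nonneg (hq0 : ∀ i b, 0 ≤ q i b) (x : ι → Bool) : 0 ≤ N.rest q A t x :=
  prod_nonneg fun i _ => by split_ifs; exacts [N.nonneg _ _ _, hq0 _ _]

lemma hyb_nonneg (hq0 : ∀ i b, 0 ≤ q i b) (x : ι → Bool) : 0 ≤ N.hyb q A x :=
  prod_nonneg fun i _ => by split_ifs; exacts [N.nonneg _ _ _, hq0 _ _]

lemma sum_hyb_insert_mul (hq1 : ∀ i, ∑ b, q i b = 1) (hA : N.Closed A) (ht : t ∉ A)
    {g : (ι → Bool) → ℝ} (hg : ∀ x b, g (Function.update x t b) = g x) :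
    ∑ x, N.hyb q (insert t A) x * g x = ∑ x, N.hyb q A x * g x := by
  have h := sum_mul_congr_coord t (G := fun x => N.rest q A t x * g x) (u := N.f t)
    (v := fun b _ => q t b) (fun x b => by rw [rest_update hA ht, hg])
    (fun x b c => f_update (N.notMem_par t) _ _ _) (fun _ _ _ => rfl)
    (fun x => by rw [N.sum_eq, hq1])
  simp only [hyb_insert, hyb_eq ht, mul_right_comm _ _ (g _), h]

lemma exists_par_subset (h : A ≠ univ) : ∃ t ∉ A, N.par t ⊆ A := by
  obtain ⟨t, ht, hmin⟩ := exists_min_image Aᶜ N.rank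
    (by rwa [nonempty_iff_ne_empty, ne_eq, compl_eq_empty_iff])
  refine ⟨t, by simpa using ht, fun j hj => ?_⟩
  by_contra hjA
  exact (N.rank_lt t j hj).not_ge (hmin j (by simpa using hjA))

omit [Fintype ι] in
lemma Closed.insert (hA : N.Closed A) (ht : N.par t ⊆ A) : N.Closed (insert t A) := by
  intro i hi
  rcases mem_insert.1 hi with rfl | hi
  · exact ht.trans (subset_insert _ _)
  · exact (hA i hi).trans (subset_insert _ _)

lemma sum_hyb_mul (hq1 : ∀ i, ∑ b, q i b = 1) (hA : N.Closed A) {g : (ι → Bool) → ℝ}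
    (hg : ∀ x y, (∀ i ∈ A, x i = y i) → g x = g y) :
    ∑ x, N.hyb q A x * g x = ∑ x, N.dist x * g x := by
  induction hc : #Aᶜ generalizing A with
  | zero =>
    obtain rfl : A = univ := by rwa [card_eq_zero, compl_eq_empty_iff] at hc
    simp [hyb, dist]
  | succ k ih =>
    obtain ⟨t, ht, hpt⟩ := exists_par_subset (N := N) (A := A) (by rintro rfl; simp at hc)
    rw [← sum_hyb_insert_mul hq1 hA ht fun x b => hg _ _ fun i hi =>
      Function.update_of_ne (ne_of_mem_of_not_mem hi ht) _ _]
    refine ih (hA.insert hpt) (fun x y h => hg x y fun i hi => h i (mem_insert_of_mem hi)) ?_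
    rw [compl_insert, card_erase_of_mem (by simpa using ht), hc]
    rfl

lemma push_proj_apply (hq1 : ∀ i, ∑ b, q i b = 1) (hA : N.Closed A) (ht : t ∉ A)
    (hpt : N.par t ⊆ A) (z : ι → Bool) (b : Bool) :
    push (proj t (N.par t)) N.dist (b, fun j : N.par t => z j) =
      (∑ x, N.hyb q A x * if ∀ j ∈ N.par t, x j = z j then 1 else 0) * N.f t b z := by
  have hproj : ∀ x, (proj t (N.par t) x = (b, fun j : N.par t => z j)) ↔
      x t = b ∧ ∀ j ∈ N.par t, x j = z j := fun x => by
    simp [proj, funext_iff]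
  have hz : ∀ x c, (∀ j ∈ N.par t, Function.update x t c j = z j) ↔ ∀ j ∈ N.par t, x j = z j :=
    fun x c => forall₂_congr fun j hj => by
      rw [Function.update_of_ne (ne_of_mem_of_not_mem hj (N.notMem_par t))]
  rw [push_eq, ev, ← sum_hyb_mul hq1 (hA.insert hpt)]
  · have h := sum_mul_congr_coord t
      (G := fun x => N.rest q A t x * if ∀ j ∈ N.par t, x j = z j then 1 else 0)
      (u := fun c x => N.f t c x * if c = b then 1 else 0) (v := fun c x => N.f t b x * q t c)
      (fun x c => by simp only [rest_update hA ht, hz])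
      (fun x c _ => by simp only [f_update (N.notMem_par t)])
      (fun x c _ => by simp only [f_update (N.notMem_par t)])
      (fun x => by rw [← mul_sum, hq1]; simp)
    rw [sum_mul]
    calc _ = _ := sum_congr rfl fun x _ => ?_
      _ = _ := h
      _ = _ := sum_congr rfl fun x _ => ?_
    · simp only [hyb_insert, hproj, ite_and]
      split_ifs <;> ring
    · rw [hyb_eq ht]
      split_ifs with hx
      · rw [N.congr t b x z hx]; ring
      · ring
  · intro x y hxy
    have h : (∀ j ∈ N.par t, x j = z j) ↔ ∀ j ∈ N.par t, y j = z j :=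
      forall₂_congr fun j hj => by rw [hxy j (mem_insert_of_mem (hpt hj))]
    simp only [hproj, hxy t (mem_insert_self _ _), h]

/-- Adding one node to the hybrid distribution decreases the Bhattacharyya coefficient with the
product distribution by at most the local Hellinger defect at that node. -/
lemma bc_hyb_sub_le (hq0 : ∀ i b, 0 ≤ q i b) (hq1 : ∀ i, ∑ b, q i b = 1) (hA : N.Closed A)
    (ht : t ∉ A) (hpt : N.par t ⊆ A) :
    bc (N.hyb q A) (fun x => ∏ i, q i (x i)) -
        bc (N.hyb q (insert t A)) (fun x => ∏ i, q i (x i)) ≤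
      1 - bc (push (proj t (N.par t)) N.dist) (localProd q t (N.par t)) := by
  set Q : (ι → Bool) → ℝ := fun x => ∏ i, q i (x i) with hQ
  let Q' : (ι → Bool) → ℝ := fun x => ∏ i ∈ univ.erase t, q i (x i)
  have hQQ' : ∀ x, Q x = Q' x * q t (x t) := fun x => by
    simp only [hQ, Q']; rw [← mul_prod_erase univ _ (mem_univ t), mul_comm]
  have hQ'0 : ∀ x, 0 ≤ Q' x := fun x => prod_nonneg fun i _ => hq0 _ _
  have hQ'u : ∀ x b, Q' (Function.update x t b) = Q' x := fun x b =>
    prod_congr rfl fun i hi => by rw [Function.update_of_ne (mem_erase.1 hi).1]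
  let r : (ι → Bool) → ℝ := fun x => ∑ b, √(N.f t b x * q t b)
  have hr1 : ∀ x, r x ≤ 1 := fun x =>
    bc_le_one (p := fun b => N.f t b x) ⟨fun b => N.nonneg _ _ _, N.sum_eq t x⟩
      ⟨hq0 t, hq1 t⟩
  have hdiff : bc (N.hyb q A) Q - bc (N.hyb q (insert t A)) Q =
      ∑ x, √(N.hyb q A x * Q x) * (1 - r x) := by
    have h := sum_mul_congr_coord t (G := fun x => √(N.rest q A t x * Q' x))
      (u := fun b x => √(N.f t b x * q t b)) (v := fun b x => r x * q t b)
      (fun x b => by simp only [rest_update hA ht, hQ'u])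
      (fun x b c => by simp only [f_update (N.notMem_par t)])
      (fun x b c => by simp only [r, f_update (N.notMem_par t)])
      (fun x => by rw [← mul_sum, hq1, mul_one])
    have e1 : ∀ x, √(N.hyb q A x * Q x) = √(N.rest q A t x * Q' x) * q t (x t) := fun x => by
      rw [hyb_eq ht, hQQ', mul_mul_mul_comm, Real.sqrt_mul (mul_nonneg (rest_nonneg hq0 x)
        (hQ'0 x)), Real.sqrt_mul_self (hq0 _ _)]
    have e2 : ∀ x, √(N.hyb q (insert t A) x * Q x) =
        √(N.rest q A t x * Q' x) * √(N.f t (x t) x * q t (x t)) := fun x => by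
      rw [hyb_insert, hQQ', mul_mul_mul_comm, Real.sqrt_mul (mul_nonneg (rest_nonneg hq0 x)
        (hQ'0 x))]
    simp only [bc, e1, e2, h, ← sum_sub_distrib]
    exact sum_congr rfl fun x _ => by ring
  rw [hdiff]
  let ext : (N.par t → Bool) → ι → Bool := fun π i => if h : i ∈ N.par t then π ⟨i, h⟩ else false
  have hext : ∀ π (j : N.par t), ext π j = π j := fun π j => by simp [ext]
  let I : (N.par t → Bool) → (ι → Bool) → ℝ := fun π x =>
    if ∀ j ∈ N.par t, x j = ext π j then 1 else 0
  have hI : ∀ x (F : (N.par t → Bool) → ℝ), ∑ π, I π x * F π = F fun j => x j := by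
    intro x F
    rw [sum_eq_single fun j : N.par t => x j]
    · have : ∀ j ∈ N.par t, x j = ext (fun j : N.par t => x j) j := fun j hj => by simp [ext, hj]
      simp only [I, if_pos this, one_mul]
    · intro π _ hπ
      have : ¬ ∀ j ∈ N.par t, x j = ext π j := fun h => hπ (funext fun j => by
        rw [h j j.2, hext])
      simp only [I, if_neg this, zero_mul]
    · simp
  let PP : (N.par t → Bool) → ℝ := fun π => ∑ x, N.hyb q A x * I π x
  let QQ : (N.par t → Bool) → ℝ := fun π => ∑ x, Q x * I π x
  have hI0 : ∀ π x, 0 ≤ I π x := fun π x => by simp only [I]; split_ifs <;> norm_num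
  have hQ0 : ∀ x, 0 ≤ Q x := fun x => prod_nonneg fun i _ => hq0 _ _
  have hPP0 : ∀ π, 0 ≤ PP π := fun π =>
    sum_nonneg fun x _ => mul_nonneg (hyb_nonneg hq0 x) (hI0 π x)
  have hPloc : ∀ b π, push (proj t (N.par t)) N.dist (b, π) = PP π * N.f t b (ext π) := by
    intro b π
    rw [← push_proj_apply hq1 hA ht hpt]
    simp only [hext]
  have hQloc : ∀ b π, localProd q t (N.par t) (b, π) = q t b * QQ π := by
    intro b π
    have h1 : ∀ b, localProd q t (N.par t) (b, π) = q t b * ∏ j : N.par t, q j (π j) :=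
      fun b => rfl
    have h2 : QQ π = ∑ b, localProd q t (N.par t) (b, π) := by
      rw [← push_prod hq1 (N.notMem_par t)]
      simp only [push_eq, QQ, ev]
      rw [sum_comm]
      refine sum_congr rfl fun x _ => ?_
      rw [← mul_sum]
      congr 1
      have : ∀ b, (proj t (N.par t) x = (b, π)) ↔ x t = b ∧ ∀ j ∈ N.par t, x j = ext π j :=
        fun b => by
          simp only [proj, Prod.mk.injEq, funext_iff, Subtype.forall]
          exact and_congr_right fun _ => forall₂_congr fun j hj => by rw [hext π ⟨j, hj⟩]
      simp only [this, ite_and, I]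
      simp
    rw [h1, h2]
    simp only [h1, ← sum_mul, hq1, one_mul]
  have hQQ0 : ∀ π, 0 ≤ QQ π := fun π => sum_nonneg fun x _ => mul_nonneg (hQ0 x) (hI0 π x)
  have hloc : bc (push (proj t (N.par t)) N.dist) (localProd q t (N.par t)) =
      ∑ π, √(PP π * QQ π) * r (ext π) := by
    simp only [bc, Fintype.sum_prod_type_right, r, mul_sum]
    refine sum_congr rfl fun π _ => sum_congr rfl fun b _ => ?_
    rw [hPloc, hQloc, ← Real.sqrt_mul (mul_nonneg (hPP0 π) (hQQ0 π))]
    congr 1; ring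
  have hPPsum : ∑ π, PP π = 1 := by
    have h1 : ∀ x, ∑ π, I π x = 1 := fun x => by simpa using hI x fun _ => 1
    simp only [PP]
    rw [sum_comm]
    simp only [← mul_sum, h1]
    rw [sum_hyb_mul hq1 hA fun _ _ _ => rfl, ← sum_hyb_mul (A := ∅) hq1 (by simp [Closed])
      fun _ _ _ => rfl]
    simpa [hyb] using (isPM_prod hq0 hq1).2
  have hQQsum : ∑ π, QQ π = 1 := by
    have h1 : ∀ x, ∑ π, I π x = 1 := fun x => by simpa using hI x fun _ => 1
    simp only [QQ]
    rw [sum_comm]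
    simp only [← mul_sum, h1, mul_one]
    exact (isPM_prod hq0 hq1).2
  have hfib : ∑ x, √(N.hyb q A x * Q x) * (1 - r x) ≤
      ∑ π, √(PP π * QQ π) * (1 - r (ext π)) := by
    have h1 : ∀ x, √(N.hyb q A x * Q x) * (1 - r x) =
        ∑ π, I π x * (√(N.hyb q A x * Q x) * (1 - r (ext π))) := fun x => by
      rw [hI x fun π => √(N.hyb q A x * Q x) * (1 - r (ext π))]
      congr 2
      exact sum_congr rfl fun b _ => by
        rw [N.congr t b x (ext fun j => x j) fun j hj => by simp [ext, hj]]
    simp only [h1]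
    rw [sum_comm]
    refine sum_le_sum fun π _ => ?_
    simp only [← mul_assoc]
    rw [← sum_mul]
    refine mul_le_mul_of_nonneg_right (Real.le_sqrt_of_sq_le ?_) (by linarith [hr1 (ext π)])
    refine sum_sq_le_sum_mul_sum_of_sq_le_mul _
      (fun x _ => mul_nonneg (hyb_nonneg hq0 x) (hI0 π x)) (fun x _ => mul_nonneg (hQ0 x) (hI0 π x))
      fun x _ => le_of_eq ?_
    rw [mul_pow, Real.sq_sqrt (mul_nonneg (hyb_nonneg hq0 x) (hQ0 x))]
    ring
  have hle1 : ∑ π, √(PP π * QQ π) ≤ 1 := bc_le_one ⟨hPP0, hPPsum⟩ ⟨hQQ0, hQQsum⟩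
  rw [hloc]
  refine hfib.trans ?_
  simp only [mul_sub, mul_one, sum_sub_distrib]
  linarith

/-- Subadditivity of the squared Hellinger distance between a Bayes net and a product
distribution. -/
lemma one_sub_bc_le (hq0 : ∀ i b, 0 ≤ q i b) (hq1 : ∀ i, ∑ b, q i b = 1) :
    1 - bc N.dist (fun x => ∏ i, q i (x i)) ≤
      ∑ t, (1 - bc (push (proj t (N.par t)) N.dist) (localProd q t (N.par t))) := by
  have key : ∀ k (A : Finset ι), #A = k → N.Closed A →
      1 - bc (N.hyb q A) (fun x => ∏ i, q i (x i)) ≤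
        ∑ t ∈ A, (1 - bc (push (proj t (N.par t)) N.dist) (localProd q t (N.par t))) := by
    intro k
    induction k with
    | zero =>
      intro A hA _
      obtain rfl := card_eq_zero.1 hA
      have h1 : ∀ x : ι → Bool, 0 ≤ ∏ i, q i (x i) := fun x => prod_nonneg fun i _ => hq0 _ _
      have h2 := (isPM_prod hq0 hq1).2
      simp only [bc, hyb, notMem_empty, if_false, sum_empty]
      simp only [Real.sqrt_mul_self (h1 _), h2, sub_self, le_refl]
    | succ k ih =>
      intro A hk hA
      obtain ⟨t, ht, hmax⟩ := exists_max_image A N.rank (card_pos.1 (by omega))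
      have hcl : N.Closed (A.erase t) := fun i hi j hj =>
        mem_erase.2 ⟨fun e => (N.rank_lt i j hj).not_ge (e ▸ hmax i (mem_erase.1 hi).2),
          hA i (mem_erase.1 hi).2 hj⟩
      have hpt : N.par t ⊆ A.erase t := fun j hj =>
        mem_erase.2 ⟨fun e => N.notMem_par t (e ▸ hj), hA t ht hj⟩
      have h1 := ih (A.erase t) (by rw [card_erase_of_mem ht, hk]; rfl) hcl
      have h2 := bc_hyb_sub_le hq0 hq1 hcl (notMem_erase t A) hpt
      rw [insert_erase ht] at h2
      rw [← add_sum_erase A _ ht]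
      linarith
  have h := key _ univ rfl fun i _ => subset_univ _
  have huniv : N.hyb q univ = N.dist := by ext x; simp [hyb, dist]
  rwa [huniv] at h

end Net

lemma sum_sqrt_sub_sq_eq {β : Type*} [Fintype β] {p q : β → ℝ} (hp : IsPM p) (hq : IsPM q) :
    ∑ y, (√(p y) - √(q y)) ^ 2 = 2 * (1 - bc p q) := by
  have h : ∀ y, (√(p y) - √(q y)) ^ 2 = p y + q y - 2 * √(p y * q y) := fun y => by
    rw [sub_sq, Real.sq_sqrt (hp.1 y), Real.sq_sqrt (hq.1 y), Real.sqrt_mul (hp.1 y)]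
    ring
  simp only [h, sum_sub_distrib, sum_add_distrib, hp.2, hq.2, ← mul_sum, bc]
  ring

lemma sum_abs_sub_sq_le {β : Type*} [Fintype β] {p q : β → ℝ} (hp : IsPM p) (hq : IsPM q) :
    (∑ y, |p y - q y|) ^ 2 ≤ 8 * (1 - bc p q) := by
  have h1 : (∑ y, |p y - q y|) ^ 2 ≤
      (∑ y, (√(p y) - √(q y)) ^ 2) * ∑ y, (√(p y) + √(q y)) ^ 2 :=
    sum_sq_le_sum_mul_sum_of_sq_le_mul _ (fun _ _ => sq_nonneg _) (fun _ _ => sq_nonneg _)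
      fun y _ => le_of_eq (by
        rw [sq_abs, ← mul_pow]
        congr 1
        linear_combination (Real.mul_self_sqrt (hq.1 y)) - (Real.mul_self_sqrt (hp.1 y)))
  have h2 : ∑ y, (√(p y) + √(q y)) ^ 2 ≤ 4 := by
    have : ∑ y, (√(p y) + √(q y)) ^ 2 ≤ ∑ y, 2 * (p y + q y) := sum_le_sum fun y _ => by
      nlinarith [sq_nonneg (√(p y) - √(q y)), Real.sq_sqrt (hp.1 y), Real.sq_sqrt (hq.1 y)]
    rw [← mul_sum, sum_add_distrib, hp.2, hq.2] at this
    linarith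
  rw [sum_sqrt_sub_sq_eq hp hq] at h1
  nlinarith [bc_le_one hp hq]

end BayesNet

section Tester

lemma prob_iid_sum_sum {X : Type*} [Fintype X] (P : X → ℝ) {l m : ℕ}
    (A : (Fin l → X) → (Fin m → X) → (Fin m → X) → Prop) :
    prob (iid P (Fin l ⊕ (Fin m ⊕ Fin m)))
        (fun s => A (s ∘ .inl) (s ∘ .inr ∘ .inl) (s ∘ .inr ∘ .inr)) =
      ev (iid P (Fin l)) fun u => ev (iid P (Fin m)) fun v => prob (iid P (Fin m)) (A u v) := by
  classical
  have h := ev_iid_sum (ι := Fin l) (κ := Fin m ⊕ Fin m) P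
    fun u w => if A u (w ∘ .inl) (w ∘ .inr) then 1 else 0
  have h' : ∀ u, ev (iid P (Fin m ⊕ Fin m))
      (fun w => if A u (w ∘ .inl) (w ∘ .inr) then (1 : ℝ) else 0) = _ := fun u =>
    ev_iid_sum (ι := Fin m) (κ := Fin m) P fun v v' => if A u v v' then 1 else 0
  simp only [h'] at h
  unfold prob
  exact h

lemma prob_iid_sum_sum_le {X : Type*} [Fintype X] {P : X → ℝ} (hP : IsPM P) {l m : ℕ}
    (A : (Fin l → X) → (Fin m → X) → (Fin m → X) → Prop) {G : (Fin l → X) → Prop}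
    (hG : prob (iid P (Fin l)) (fun u => ¬ G u) ≤ 1 / 32)
    (hA : ∀ u, G u →
      ev (iid P (Fin m)) (fun v => prob (iid P (Fin m)) (A u v)) ≤ 1 / 32) :
    prob (iid P (Fin l ⊕ (Fin m ⊕ Fin m)))
      (fun s => A (s ∘ .inl) (s ∘ .inr ∘ .inl) (s ∘ .inr ∘ .inr)) ≤ 1 / 16 := by
  classical
  have hm : IsPM (iid P (Fin m)) := isPM_iid hP
  have h1 : ∀ u v, prob (iid P (Fin m)) (A u v) ≤ 1 := fun u v => by
    linarith [prob_not hm (A u v), prob_nonneg hm fun v' => ¬ A u v v']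
  rw [prob_iid_sum_sum]
  calc _ ≤ ev (iid P (Fin l)) fun u => (if ¬ G u then 1 else 0) + 1 / 32 := by
        refine ev_mono (isPM_iid hP) fun u => ?_
        by_cases hu : G u
        · simpa [hu] using hA u hu
        · have := (ev_mono hm (h1 u)).trans_eq (ev_const hm 1)
          simp only [hu, not_false_eq_true, if_true]
          linarith
    _ = prob (iid P (Fin l)) (fun u => ¬ G u) + 1 / 32 := by
        rw [ev_add, ev_const (isPM_iid hP), prob]
        congr!
    _ ≤ 1 / 16 := by linarith

lemma prob_rounds_le {X J : Type*} [Fintype X] [Fintype J] [DecidableEq J] {P : X → ℝ}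
    (hP : IsPM P) {R m : ℕ} (e : Fin R × J ↪ Fin m) (A : (J → X) → Prop) [DecidablePred A]
    (hA : prob (iid P J) A ≤ 1 / 16) :
    prob (iid P (Fin m)) (fun s => R ≤ 2 * #{r | A fun j => s (e (r, j))}) ≤ (1 / 2) ^ R := by
  classical
  have h := prob_majority_le (ι := Fin R) (isPM_iid (ι := J) hP) A hA
  rw [Fintype.card_fin] at h
  refine le_of_eq_of_le ?_ h
  unfold prob
  rw [← ev_iid_curry]
  exact ev_iid_embedding hP e fun s =>
    @ite ℝ (R ≤ 2 * #{r | A fun j => s (r, j)}) (Classical.propDecidable _) 1 0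

variable {ι : Type*} [Fintype ι] [DecidableEq ι]

/-- One round of the local test at node `t` with candidate parents `U` rejects. -/
def Rejects {l m : ℕ} (κ Δ : ℝ) (t : ι) (U : Finset ι)
    (s : Fin l ⊕ (Fin m ⊕ Fin m) → ι → Bool) : Prop :=
  Δ / 16 ≤ stat (proj t U) (localProd (laplace (s ∘ .inl)) t U) κ (s ∘ .inr ∘ .inl)
    (s ∘ .inr ∘ .inr)

variable {P : (ι → Bool) → ℝ} {l m d : ℕ} {κ Δ : ℝ} {t : ι} {U : Finset ι}

lemma prob_chiSq_localProd_le (hP : IsPM P) (hU : #U ≤ d) (hΔ : 0 < Δ) (hΔ1 : Δ ≤ 1)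
    (hl : 32 * (d + 1) ≤ l * (Δ / 64)) :
    prob (iid P (Fin l)) (fun u =>
      ¬ chiSq (localProd (marg P) t U) (localProd (laplace u) t U) ≤ Δ / 32) ≤ 1 / 32 := by
  refine (prob_mono (isPM_iid hP) fun u hu => ?_).trans
    (prob_learning_fails_le hP t U hU (by positivity : 0 < Δ / 64) hl)
  by_contra! h
  refine hu ((chiSq_localProd_le (laplace_pos u) (sum_marg hP) (sum_laplace u) t U
    (by linarith) h.le).trans_eq (by ring))

omit [Fintype ι] [DecidableEq ι] in
lemma localProd_laplace_pos (u : Fin l → ι → Bool) (y : Bool × (U → Bool)) :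
    0 < localProd (laplace u) t U y :=
  mul_pos (laplace_pos _ _ _) (prod_pos fun _ _ => laplace_pos _ _ _)

omit [Fintype ι] in
lemma card_local_le (hU : #U ≤ d) :
    (Fintype.card (Bool × (U → Bool)) : ℝ) ≤ 2 ^ (d + 1) := by
  have : Fintype.card (Bool × (U → Bool)) = 2 ^ (#U + 1) := by simp [pow_succ']
  rw [this]
  push_cast
  exact pow_le_pow_right₀ (by norm_num) (by omega)

lemma prob_rejects_le (hP : IsPM P) (hU : #U ≤ d) (hΔ : 0 < Δ) (hΔ1 : Δ ≤ 1)
    (hκ : κ = Δ / (8 * 2 ^ (d + 1))) (hl : 32 * (d + 1) ≤ l * (Δ / 64)) (hm0 : 0 < m)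
    (hm : 2 ^ 30 * 2 ^ (d + 1) ≤ (m * Δ) ^ 2)
    (hnull : push (proj t U) P = localProd (marg P) t U) :
    prob (iid P (Fin l ⊕ (Fin m ⊕ Fin m))) (Rejects κ Δ t U) ≤ 1 / 16 := by
  refine prob_iid_sum_sum_le hP
    (fun u v v' => Δ / 16 ≤ stat (proj t U) (localProd (laplace u) t U) κ v v')
    (prob_chiSq_localProd_le (t := t) hP hU hΔ hΔ1 hl) fun u hu => ?_
  have hκ0 : 0 < κ := hκ ▸ by positivity
  have hq := localProd_laplace_pos (t := t) (U := U) u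
  have hD : ∑ y, (push (proj t U) P y - localProd (laplace u) t U y) ^ 2 /
      (localProd (laplace u) t U y + κ) ≤ Δ / 32 := by
    refine le_trans ?_ hu
    rw [hnull]
    refine sum_le_sum fun y _ => ?_
    have := hq y
    gcongr
    linarith
  refine le_trans ?_ (prob_stat_far_le hP hm0 (proj t U) (fun y => (hq y).le)
    (by positivity) (card_local_le hU) hΔ hκ rfl (by linarith : _ ≤ Δ / 8) le_rfl hm)
  refine ev_mono (isPM_iid hP) fun v => prob_mono (isPM_iid hP) fun v' h => ?_
  refine le_trans ?_ (le_abs_self _)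
  linarith

lemma prob_not_rejects_le (hP : IsPM P) (hU : #U ≤ d) (hΔ : 0 < Δ) (hΔ1 : Δ ≤ 1)
    (hκ : κ = Δ / (8 * 2 ^ (d + 1))) (hl : 32 * (d + 1) ≤ l * (Δ / 64)) (hm0 : 0 < m)
    (hm : 2 ^ 30 * 2 ^ (d + 1) ≤ (m * Δ) ^ 2)
    (hfar : Δ ≤ ∑ y, (√(push (proj t U) P y) - √(localProd (marg P) t U y)) ^ 2) :
    prob (iid P (Fin l ⊕ (Fin m ⊕ Fin m))) (fun s => ¬ Rejects κ Δ t U s) ≤ 1 / 16 := by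
  refine prob_iid_sum_sum_le hP
    (fun u v v' => ¬ Δ / 16 ≤ stat (proj t U) (localProd (laplace u) t U) κ v v')
    (prob_chiSq_localProd_le (t := t) hP hU hΔ hΔ1 hl) fun u hu => ?_
  have hκ0 : 0 < κ := hκ ▸ by positivity
  have hq := localProd_laplace_pos (t := t) (U := U) u
  set D := ∑ y, (push (proj t U) P y - localProd (laplace u) t U y) ^ 2 /
    (localProd (laplace u) t U y + κ) with hDdef
  have hD : Δ / 8 ≤ D := by
    have h1 := sum_sqrt_sub_sq_le (isPM_push (proj t U) hP).1 (fun y => (hq y).le) hκ0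
    have h2 := (sum_sqrt_sub_sq_le_chiSq (p := localProd (marg P) t U)
      (fun y => mul_nonneg (marg_nonneg hP _ _) (prod_nonneg fun _ _ => marg_nonneg hP _ _))
      hq).trans hu
    have h3 : Fintype.card (Bool × (U → Bool)) * κ ≤ Δ / 8 := by
      have := mul_le_mul_of_nonneg_right (card_local_le hU) hκ0.le
      refine this.trans_eq ?_
      rw [hκ]
      field_simp
    have h4 : ∑ y, (√(push (proj t U) P y) - √(localProd (marg P) t U y)) ^ 2 ≤
        2 * ∑ y, (√(push (proj t U) P y) - √(localProd (laplace u) t U y)) ^ 2 +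
          2 * ∑ y, (√(localProd (marg P) t U y) - √(localProd (laplace u) t U y)) ^ 2 := by
      rw [mul_sum, mul_sum, ← sum_add_distrib]
      refine sum_le_sum fun y _ => ?_
      nlinarith [sq_nonneg (√(push (proj t U) P y) + √(localProd (marg P) t U y) -
        2 * √(localProd (laplace u) t U y))]
    linarith
  refine le_trans ?_ (prob_stat_far_le hP hm0 (proj t U) (fun y => (hq y).le)
    (by positivity) (card_local_le hU) hΔ hκ hDdef le_rfl hD hm)
  refine ev_mono (isPM_iid hP) fun v => prob_mono (isPM_iid hP) fun v' h => ?_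
  refine le_trans ?_ (neg_le_abs _)
  linarith

/-- A net far from the product of its marginals has a node that is locally far from independent
of its parents. -/
lemma Net.exists_far_node [Nonempty ι] (N : Net ι) (hN : IsPM N.dist) {ε : ℝ} (hε : 0 < ε)
    (h : 2 * ε ≤ ∑ x, |N.dist x - ∏ i, marg N.dist i (x i)|) :
    ∃ t, ε ^ 2 / Fintype.card ι ≤ ∑ y, (√(push (proj t (N.par t)) N.dist y) -
      √(localProd (marg N.dist) t (N.par t) y)) ^ 2 := by
  have hq0 := marg_nonneg hN
  have hq1 := sum_marg hN
  have hQ := isPM_prod hq0 hq1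
  have h1 := (pow_le_pow_left₀ (by positivity) h 2).trans (sum_abs_sub_sq_le hN hQ)
  have h2 := N.one_sub_bc_le hq0 hq1
  obtain ⟨t, -, ht⟩ := exists_le_of_sum_le (s := univ) (univ_nonempty (α := ι))
    (f := fun _ => ε ^ 2 / 2 / Fintype.card ι)
    (g := fun t => 1 - bc (push (proj t (N.par t)) N.dist) (localProd (marg N.dist) t (N.par t)))
    (by
      rw [sum_const, card_univ, nsmul_eq_mul, mul_div_cancel₀ _ (by simp)]
      linarith)
  refine ⟨t, ?_⟩
  have hloc : IsPM (localProd (marg N.dist) t (N.par t)) := by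
    rw [← push_prod hq1 (N.notMem_par t)]
    exact isPM_push _ hQ
  rw [sum_sqrt_sub_sq_eq (isPM_push _ hN) hloc]
  calc _ = 2 * (ε ^ 2 / 2 / Fintype.card ι) := by ring
    _ ≤ _ := by linarith

end Tester

lemma exists_parameters {n d : ℕ} (hn : 2 ≤ n) (hd : 1 ≤ d) {ε : ℝ} (hε : 0 < ε) (hε1 : ε ≤ 1) :
    ∃ l m R : ℕ, 32 * (d + 1) ≤ l * (ε ^ 2 / n / 64) ∧ 0 < m ∧
      2 ^ 30 * 2 ^ (d + 1) ≤ (m * (ε ^ 2 / n)) ^ 2 ∧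
      (n : ℝ) ^ (d + 1) * (1 / 2) ^ R ≤ 1 / 3 ∧
      R * (l + (m + m)) ≤
        ⌈2000000 * (d : ℝ) ^ 2 * (2 : ℝ) ^ ((d : ℝ) / 2) * n * Real.log n / ε ^ 2⌉₊ := by
  have hnR : (2 : ℝ) ≤ n := by exact_mod_cast hn
  have hdR : (1 : ℝ) ≤ d := by exact_mod_cast hd
  set Δ := ε ^ 2 / n with hΔdef
  have hΔ : 0 < Δ := by positivity
  have hΔ1 : Δ ≤ 1 := by
    rw [hΔdef, div_le_one (by positivity)]
    nlinarith
  set S := (2 : ℝ) ^ ((d : ℝ) / 2) with hSdef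
  have hS1 : 1 ≤ S := Real.one_le_rpow (by norm_num) (by positivity)
  have hS2 : S ^ 2 = 2 ^ d := by
    rw [hSdef, ← Real.rpow_natCast, ← Real.rpow_mul (by norm_num), ← Real.rpow_natCast]
    congr 1; push_cast; ring
  set L := Real.log n with hLdef
  have hlog2 := Real.log_two_gt_d9
  have hL2 : Real.log 2 ≤ L := Real.log_le_log (by norm_num) hnR
  have hdL : L ≤ d * L := le_mul_of_one_le_left (by linarith) hdR
  have hdS : d ≤ d * S := le_mul_of_one_le_right (by linarith) hS1
  have hSd : S ≤ d * S := le_mul_of_one_le_left (by linarith) hdR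
  have hinv : 1 ≤ 1 / Δ := (one_le_div hΔ).2 hΔ1
  have hl : (⌈2048 * (d + 1) / Δ⌉₊ : ℝ) ≤ 4097 * (d * S) / Δ := by
    refine (Nat.ceil_lt_add_one (by positivity)).le.trans ?_
    rw [div_add' _ _ _ hΔ.ne', div_le_div_iff_of_pos_right hΔ]
    linarith
  have hm : (⌈2 ^ 16 * S / Δ⌉₊ : ℝ) ≤ 65537 * (d * S) / Δ := by
    refine (Nat.ceil_lt_add_one (by positivity)).le.trans ?_
    rw [div_add' _ _ _ hΔ.ne', div_le_div_iff_of_pos_right hΔ]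
    linarith
  have hR : (⌈10 * (d * L)⌉₊ : ℝ) ≤ 12 * (d * L) := by
    refine (Nat.ceil_lt_add_one (by positivity)).le.trans ?_
    linarith
  refine ⟨⌈2048 * (d + 1) / Δ⌉₊, ⌈2 ^ 16 * S / Δ⌉₊, ⌈10 * (d * L)⌉₊, ?_, ?_, ?_, ?_, ?_⟩
  · have := (div_le_iff₀ hΔ).1 (Nat.le_ceil (2048 * (d + 1) / Δ))
    linarith
  · exact Nat.ceil_pos.2 (by positivity)
  · have := (div_le_iff₀ hΔ).1 (Nat.le_ceil (2 ^ 16 * S / Δ))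
    have h2 := pow_le_pow_left₀ (by positivity) this 2
    rw [mul_pow, hS2] at h2
    refine le_trans ?_ h2
    rw [pow_succ (2 : ℝ) d]
    nlinarith [pow_pos (two_pos : (0 : ℝ) < 2) d]
  · have h1 : (n : ℝ) ^ (d + 1) * 3 ≤ 2 ^ ⌈10 * (d * L)⌉₊ := by
      rw [← Real.log_le_log_iff (by positivity) (by positivity),
        Real.log_mul (by positivity) (by norm_num), Real.log_pow, Real.log_pow]
      have h3 : Real.log 3 ≤ 2 * Real.log 2 := by
        rw [← Real.log_rpow (by norm_num)]
        exact Real.log_le_log (by norm_num) (by norm_num)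
      have h4 := mul_le_mul_of_nonneg_right (Nat.le_ceil (10 * (d * L))) (Real.log_pos one_lt_two).le
      have h5 : 4 * (d * L) ≤ 10 * (d * L) * Real.log 2 := by nlinarith
      push_cast
      linarith
    rw [one_div, inv_pow, ← div_eq_mul_inv, div_le_iff₀ (by positivity)]
    linarith
  · have h1 : ((⌈10 * (d * L)⌉₊ * (⌈2048 * (d + 1) / Δ⌉₊ + (⌈2 ^ 16 * S / Δ⌉₊ +
        ⌈2 ^ 16 * S / Δ⌉₊)) : ℕ) : ℝ) ≤
        2000000 * (d : ℝ) ^ 2 * S * n * L / ε ^ 2 := by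
      push_cast
      calc _ ≤ 12 * (d * L) * (4097 * (d * S) / Δ + (65537 * (d * S) / Δ +
            65537 * (d * S) / Δ)) := by gcongr
        _ = 1622052 * ((d : ℝ) ^ 2 * S * n * L / ε ^ 2) := by
            rw [hΔdef]; field_simp; ring
        _ ≤ 2000000 * ((d : ℝ) ^ 2 * S * n * L / ε ^ 2) := by gcongr; norm_num
        _ = _ := by ring
    exact_mod_cast h1.trans (Nat.le_ceil _)

section Main

variable {n m d : ℕ} {P : (Fin n → Bool) → ℝ}

lemma marginal_eq_marg (P : (Fin n → Bool) → ℝ) (i : Fin n) (b : Bool) :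
    marginal P i b = marg P i b := by
  simp [marginal, marg, prob, ev]

lemma acceptProb_eq_prob (P : (Fin n → Bool) → ℝ) (T : (Fin m → Fin n → Bool) → Bool) :
    acceptProb P T = prob (iid P (Fin m)) fun s => T s = true := by
  simp [acceptProb, prob, ev, iid]

lemma isProduct_prod {q : Fin n → Bool → ℝ} (hq1 : ∀ i, ∑ b, q i b = 1) :
    IsProduct fun x => ∏ i, q i (x i) := fun x => by
  simp only [marginal_eq_marg, marg_prod hq1]

lemma isBayesNet_iff :
    IsBayesNet d P ↔ ∃ N : Net (Fin n), (∀ i, #(N.par i) ≤ d) ∧ N.dist = P := by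
  constructor
  · rintro ⟨par, rank, f, hd, hr, h0, h1, hc, hP⟩
    exact ⟨⟨par, rank, f, hr, h0, fun i x => by rw [Fintype.sum_bool, add_comm, h1], hc⟩, hd,
      funext fun x => (hP x).symm⟩
  · rintro ⟨N, hd, rfl⟩
    exact ⟨N.par, N.rank, N.f, hd, N.rank_lt, N.nonneg, fun i x => by
      rw [← N.sum_eq i x, Fintype.sum_bool, add_comm], N.congr, fun x => rfl⟩

lemma Net.isProduct_dist (N : Net (Fin n)) (h : ∀ i, N.par i = ∅) : IsProduct N.dist := by
  have : N.dist = fun x => ∏ i, N.f i (x i) fun _ => false :=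
    funext fun x => prod_congr rfl fun i _ => N.congr _ _ _ _ (by simp [h])
  rw [this]
  exact isProduct_prod fun i => N.sum_eq i _

lemma Net.par_eq_empty_of_subsingleton {ι : Type*} [Subsingleton ι] (N : Net ι) (i : ι) :
    N.par i = ∅ :=
  eq_empty_of_forall_notMem fun j hj => N.notMem_par i (Subsingleton.elim j i ▸ hj)

lemma isProduct_of_degenerate (hP : IsBayesNet d P) (h : n ≤ 1 ∨ d = 0) : IsProduct P := by
  obtain ⟨N, hd, rfl⟩ := isBayesNet_iff.1 hP
  refine N.isProduct_dist fun i => ?_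
  rcases h with h | rfl
  · have : Subsingleton (Fin n) := Fin.subsingleton_iff_le_one.2 h
    exact N.par_eq_empty_of_subsingleton i
  · exact card_eq_zero.1 (Nat.le_zero.1 (hd i))

lemma exists_image_erase_eq {ι : Type*} [DecidableEq ι] {t : ι} {U : Finset ι} (ht : t ∉ U)
    (hU : #U ≤ d) : ∃ τ : Fin d → ι, (univ.image τ).erase t = U := by
  refine ⟨fun k => U.toList.getD k t, ext fun j => ?_⟩
  simp only [mem_erase, mem_image, mem_univ, true_and, ← mem_toList (s := U) (a := j)]
  constructor
  · rintro ⟨hj, k, rfl⟩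
    rcases lt_or_ge (k : ℕ) U.toList.length with hk | hk
    · rw [List.getD_eq_getElem _ _ hk]
      exact List.getElem_mem hk
    · exact absurd (List.getD_eq_default _ _ hk) hj
  · intro hj
    refine ⟨fun e => ht (e ▸ mem_toList.1 hj), ?_⟩
    obtain ⟨k, hk, rfl⟩ := List.getElem_of_mem hj
    exact ⟨⟨k, by rw [length_toList] at hk; omega⟩, List.getD_eq_getElem _ _ hk⟩

lemma card_image_erase_le {ι : Type*} [DecidableEq ι] (t : ι) (τ : Fin d → ι) :
    #((univ.image τ).erase t) ≤ d :=
  (card_le_card (erase_subset _ _)).trans (card_image_le.trans_eq (by simp))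

lemma exists_tester {ε : ℝ} (hn : 2 ≤ n) (hε : 0 < ε) (hε1 : ε ≤ 1) {l m₀ R : ℕ}
    (hl : 32 * (d + 1) ≤ l * (ε ^ 2 / n / 64)) (hm0 : 0 < m₀)
    (hm : 2 ^ 30 * 2 ^ (d + 1) ≤ (m₀ * (ε ^ 2 / n)) ^ 2)
    (hR : (n : ℝ) ^ (d + 1) * (1 / 2) ^ R ≤ 1 / 3) (hmR : R * (l + (m₀ + m₀)) ≤ m) :
    ∃ T : (Fin m → Fin n → Bool) → Bool,
      ∀ P : (Fin n → Bool) → ℝ, IsDist P → IsBayesNet d P →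
        (IsProduct P → 2 / 3 ≤ acceptProb P T) ∧
        ((∀ Q : (Fin n → Bool) → ℝ, IsDist Q → IsProduct Q → ε ≤ tvDist P Q) →
          2 / 3 ≤ acceptProb P (fun s => !T s)) := by
  classical
  obtain ⟨e⟩ : Nonempty (Fin R × (Fin l ⊕ (Fin m₀ ⊕ Fin m₀)) ↪ Fin m) :=
    Function.Embedding.nonempty_of_card_le (by simpa using hmR)
  have hnR : (2 : ℝ) ≤ n := by exact_mod_cast hn
  have : Nonempty (Fin n) := ⟨⟨0, by omega⟩⟩
  set Δ := ε ^ 2 / n with hΔdef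
  have hΔ : 0 < Δ := by positivity
  have hΔ1 : Δ ≤ 1 := by
    rw [hΔdef, div_le_one (by positivity)]
    nlinarith
  let nbhd : Fin n × (Fin d → Fin n) → Finset (Fin n) := fun c => (univ.image c.2).erase c.1
  let rej : Fin n × (Fin d → Fin n) → (Fin l ⊕ (Fin m₀ ⊕ Fin m₀) → Fin n → Bool) → Prop :=
    fun c => Rejects (Δ / (8 * 2 ^ (d + 1))) Δ c.1 (nbhd c)
  let T : (Fin m → Fin n → Bool) → Bool := fun s =>
    decide (¬ ∃ c, R ≤ 2 * #{r | rej c fun j => s (e (r, j))})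
  refine ⟨T, fun P hP hN => ?_⟩
  replace hP : IsPM P := hP
  have hPm : IsPM (iid P (Fin m)) := isPM_iid hP
  obtain ⟨N, hpar, rfl⟩ := isBayesNet_iff.1 hN
  have hq1 := sum_marg hP
  constructor
  · intro hprod
    have hprod' : N.dist = fun x => ∏ i, marg N.dist i (x i) := by
      ext x
      simp only [hprod x, marginal_eq_marg]
    have hrej : ∀ c, prob (iid N.dist (Fin l ⊕ (Fin m₀ ⊕ Fin m₀))) (rej c) ≤ 1 / 16 := fun c =>
      prob_rejects_le hP (card_image_erase_le c.1 c.2) hΔ hΔ1 rfl hl hm0 hm (by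
        conv_lhs => rw [hprod']
        exact push_prod hq1 (notMem_erase _ _))
    rw [acceptProb_eq_prob]
    simp only [T, decide_eq_true_eq]
    rw [prob_not hPm]
    have h1 := (prob_exists_le hPm fun c s => R ≤ 2 * #{r | rej c fun j => s (e (r, j))}).trans
      (sum_le_sum fun c _ => prob_rounds_le hP e (rej c) (hrej c))
    simp only [sum_const, card_univ, Fintype.card_prod, Fintype.card_fin, Fintype.card_fun,
      nsmul_eq_mul, Nat.cast_pow, ← pow_succ'] at h1
    linarith
  · intro hfar
    obtain ⟨t, ht⟩ := N.exists_far_node hP hε (by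
      have := hfar _ (isPM_prod (marg_nonneg hP) hq1) (isProduct_prod hq1)
      rw [tvDist] at this
      linarith)
    rw [Fintype.card_fin] at ht
    obtain ⟨τ, hτ⟩ := exists_image_erase_eq (N.notMem_par t) (hpar t)
    have hacc : prob (iid N.dist (Fin l ⊕ (Fin m₀ ⊕ Fin m₀))) (fun s => ¬ rej (t, τ) s) ≤
        1 / 16 :=
      prob_not_rejects_le hP (card_image_erase_le t τ) hΔ hΔ1 rfl hl hm0 hm (by
        rwa [show nbhd (t, τ) = N.par t from hτ])
    have h1 := prob_rounds_le hP e (fun s => ¬ rej (t, τ) s) hacc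
    have h2 : prob (iid N.dist (Fin m)) (fun s => T s = true) ≤ (1 / 2) ^ R := by
      refine (prob_mono hPm fun s hs => ?_).trans h1
      simp only [T, decide_eq_true_eq, not_exists, not_le] at hs
      have h3 := card_filter_add_card_filter_not (s := (univ : Finset (Fin R)))
        fun r => rej (t, τ) fun j => s (e (r, j))
      rw [card_univ, Fintype.card_fin] at h3
      have := hs (t, τ)
      omega
    have h3 : (1 / 2 : ℝ) ^ R ≤ 1 / 3 :=
      (le_mul_of_one_le_left (by positivity) (one_le_pow₀ (by linarith))).trans hR
    rw [acceptProb_eq_prob]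
    have h4 := prob_not hPm fun s => T s = true
    simp only [Bool.not_eq_true, Bool.not_eq_true'] at h4 ⊢
    linarith

lemma acceptProb_true (hP : IsDist P) : acceptProb P (fun _ : Fin m → Fin n → Bool => true) = 1 :=
  by simpa [acceptProb, iid] using (isPM_iid (ι := Fin m) hP).2

end Main

end IndepTest

/-- Upper bound for independence testing of degree-`d` Bayes nets:
an `O(d² · 2^{d/2} · n · log n / ε²)`-sample tester that accepts product
distributions and rejects distributions `ε`-far (in TV) from every product
distribution, each with probability at least `2/3`. -/
theorem independence_testing_upper_bound :
    ∃ C : ℝ, 0 < C ∧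
      ∀ n d : ℕ, 1 ≤ n → d ≤ n → ∀ ε : ℝ, 0 < ε → ε ≤ 1 →
        ∃ T : (Fin ⌈C * (d : ℝ) ^ 2 * (2 : ℝ) ^ ((d : ℝ) / 2) * n * Real.log n / ε ^ 2⌉₊ →
                Fin n → Bool) → Bool,
          ∀ P : (Fin n → Bool) → ℝ, IsDist P → IsBayesNet d P →
            (IsProduct P → 2 / 3 ≤ acceptProb P T) ∧
            ((∀ Q : (Fin n → Bool) → ℝ, IsDist Q → IsProduct Q → ε ≤ tvDist P Q) →
              2 / 3 ≤ acceptProb P (fun s => !T s)) := by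
  refine ⟨2000000, by norm_num, fun n d hn hdn ε hε hε1 => ?_⟩
  by_cases hdeg : n ≤ 1 ∨ d = 0
  · refine ⟨fun _ => true, fun P hP hN => ⟨fun _ => ?_, fun hfar => ?_⟩⟩
    · rw [IndepTest.acceptProb_true hP]; norm_num
    · have := hfar P hP (IndepTest.isProduct_of_degenerate hN hdeg)
      simp only [tvDist, sub_self, abs_zero, sum_const_zero, mul_zero] at this
      linarith
  · have hn2 : 2 ≤ n := by omega
    have hd : 1 ≤ d := by omega
    obtain ⟨l, m, R, hl, hm0, hm, hR, hmR⟩ := IndepTest.exists_parameters hn2 hd hε hε1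
    exact IndepTest.exists_tester hn2 hε hε1 hl hm0 hm hR hmR
end

section
/- There exists an absolute constant C > 0 such that for every n ≥ 1 and ε ∈ (0,1] there is an m-sample tester T with m = ⌈C·2^{n/2}/ε²⌉ such that for every distribution P over {0,1}^n: (i) if P is a product distribution, then T accepts with probability at least 2/3 under P^{⊗m}; (ii) if P is at Hellinger distance at least ε from every product distribution on {0,1}^n, then T rejects with probability at least 2/3 under P^{⊗m}. -/
open Finset

/-- Expectation of `F` over `m` i.i.d. samples with weights `p`. -/
noncomputable def iidExp {X : Type*} [Fintype X] (p : X → ℝ) (m : ℕ)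
    (F : (Fin m → X) → ℝ) : ℝ :=
  ∑ s : Fin m → X, (∏ k, p (s k)) * F s

section IidExp

variable {X : Type*} [Fintype X] {p : X → ℝ} {m : ℕ}

lemma iidExp_add (F G : (Fin m → X) → ℝ) :
    iidExp p m (fun s => F s + G s) = iidExp p m F + iidExp p m G := by
  simp only [iidExp, mul_add, Finset.sum_add_distrib]

lemma iidExp_const_mul (c : ℝ) (F : (Fin m → X) → ℝ) :
    iidExp p m (fun s => c * F s) = c * iidExp p m F := by
  simp only [iidExp, Finset.mul_sum]
  exact Finset.sum_congr rfl fun s _ => by ring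

lemma iidExp_sum {ι : Type*} (t : Finset ι) (F : ι → (Fin m → X) → ℝ) :
    iidExp p m (fun s => ∑ i ∈ t, F i s) = ∑ i ∈ t, iidExp p m (F i) := by
  simp only [iidExp, Finset.mul_sum]
  exact Finset.sum_comm

lemma iidExp_const (hp : ∑ x, p x = 1) (c : ℝ) : iidExp p m (fun _ => c) = c := by
  classical
  have h : ∑ s : Fin m → X, ∏ k, p (s k) = 1 := by
    rw [← Fintype.piFinset_univ, ← Finset.prod_univ_sum]
    simp [hp]
  simp only [iidExp, ← Finset.sum_mul, h, one_mul]

lemma iidExp_mono (hp : ∀ x, 0 ≤ p x) {F G : (Fin m → X) → ℝ} (h : ∀ s, F s ≤ G s) :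
    iidExp p m F ≤ iidExp p m G :=
  Finset.sum_le_sum fun s _ =>
    mul_le_mul_of_nonneg_left (h s) (Finset.prod_nonneg fun _ _ => hp _)

lemma iidExp_insertNth (i : Fin (m + 1)) (F : (Fin (m + 1) → X) → ℝ) :
    iidExp p (m + 1) F =
      ∑ x, p x * iidExp p m (fun s => F (Fin.insertNth (α := fun _ => X) i x s)) := by
  simp only [iidExp]
  rw [← (Fin.insertNthEquiv (fun _ => X) i).sum_comp, Fintype.sum_prod_type]
  refine Finset.sum_congr rfl fun x _ => ?_
  rw [Finset.mul_sum]
  refine Finset.sum_congr rfl fun s _ => ?_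
  rw [show Fin.insertNthEquiv (fun _ => X) i (x, s) = Fin.insertNth i x s from rfl]
  simp [Fin.prod_univ_succAbove _ i, mul_assoc]

lemma iidExp_append (k l : ℕ) (F : (Fin (k + l) → X) → ℝ) :
    iidExp p (k + l) F =
      iidExp p k (fun u => iidExp p l (fun v => F (Fin.append u v))) := by
  simp only [iidExp]
  rw [← (Fin.appendEquiv k l).sum_comp, Fintype.sum_prod_type]
  refine Finset.sum_congr rfl fun u _ => ?_
  rw [Finset.mul_sum]
  refine Finset.sum_congr rfl fun v _ => ?_
  rw [show Fin.appendEquiv k l (u, v) = Fin.append u v from rfl]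
  simp [Fin.prod_univ_add, mul_assoc]

lemma iidExp_empirical_sum (hp : ∑ x, p x = 1) (f : X → ℝ) :
    iidExp p m (fun s => ∑ t, f (s t)) = m * ∑ x, p x * f x := by
  induction m with
  | zero => simp [iidExp]
  | succ m ih =>
    rw [iidExp_insertNth 0]
    simp only [Fin.sum_univ_succAbove _ (0 : Fin (m + 1)), Fin.insertNth_apply_same,
      Fin.insertNth_apply_succAbove, iidExp_add,
      iidExp_const hp, ih, mul_add, Finset.sum_add_distrib, ← Finset.sum_mul, hp]
    push_cast
    ring

lemma iidExp_empirical_sum_sq (hp : ∑ x, p x = 1) (f : X → ℝ) :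
    iidExp p m (fun s => (∑ t, f (s t)) ^ 2) =
      m * ∑ x, p x * f x ^ 2 + m * (m - 1) * (∑ x, p x * f x) ^ 2 := by
  induction m with
  | zero => simp [iidExp]
  | succ m ih =>
    rw [iidExp_insertNth 0]
    have h : ∀ x, p x * iidExp p m (fun s => (f x + ∑ t, f (s t)) ^ 2) =
        p x * f x ^ 2 + (p x * f x) * (2 * (m * ∑ x, p x * f x)) + p x *
          (m * ∑ x, p x * f x ^ 2 + m * (m - 1) * (∑ x, p x * f x) ^ 2) := by
      intro x
      simp only [add_sq, iidExp_add, iidExp_const hp, ih, iidExp_const_mul,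
        iidExp_empirical_sum hp]
      ring
    simp only [Fin.sum_univ_succAbove _ (0 : Fin (m + 1)), Fin.insertNth_apply_same,
      Fin.insertNth_apply_succAbove, h,
      Finset.sum_add_distrib, ← Finset.sum_mul, hp]
    push_cast
    ring

/-- Second moment of a two-sample U-statistic whose kernel `g` has mean zero. -/
lemma iidExp_twoSample_sq (hp : ∑ x, p x = 1) (g : X → X → ℝ)
    (hg : ∑ x, p x * ∑ y, p y * g x y = 0) :
    iidExp p m (fun a => iidExp p m (fun b => (∑ t, ∑ s, g (a s) (b t)) ^ 2)) =
      m ^ 2 * ∑ y, p y * ∑ x, p x * g x y ^ 2 +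
      m ^ 2 * (m - 1) * ∑ y, p y * (∑ x, p x * g x y) ^ 2 +
      m ^ 2 * (m - 1) * ∑ x, p x * (∑ y, p y * g x y) ^ 2 := by
  have h1 : ∀ a : Fin m → X, iidExp p m (fun b => (∑ t, ∑ s, g (a s) (b t)) ^ 2) =
      m * ∑ y, p y * (∑ s, g (a s) y) ^ 2 +
        m * (m - 1) * (∑ s, ∑ y, p y * g (a s) y) ^ 2 := by
    intro a
    rw [iidExp_empirical_sum_sq hp (fun y => ∑ s, g (a s) y)]
    congr 3
    simp only [Finset.mul_sum]
    exact Finset.sum_comm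
  simp only [h1, iidExp_add, iidExp_const_mul, iidExp_sum]
  rw [iidExp_empirical_sum_sq hp (fun x => ∑ y, p y * g x y), hg]
  have h2 : ∀ y, iidExp p m (fun a => (∑ s, g (a s) y) ^ 2) =
      m * ∑ x, p x * g x y ^ 2 + m * (m - 1) * (∑ x, p x * g x y) ^ 2 :=
    fun y => iidExp_empirical_sum_sq hp (fun x => g x y)
  simp only [h2, mul_add, Finset.sum_add_distrib, mul_left_comm (p _) (m : ℝ),
    mul_assoc (m : ℝ), ← Finset.mul_sum, mul_left_comm (p _) ((m : ℝ) - 1)]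
  ring

end IidExp

/-- The `χ²`-divergence of `p` from `q`, for `q` of full support. -/
noncomputable def chiSq {X : Type*} [Fintype X] (p q : X → ℝ) : ℝ :=
  ∑ x, p x ^ 2 / q x - 1

/-- The kernel of the two-sample collision statistic; its mean is `chiSq p q`. -/
noncomputable def collisionKernel {X : Type*} [DecidableEq X] (q : X → ℝ) (x y : X) : ℝ :=
  (if x = y then 1 / q x else 0) - 1

/-- The two-sample collision statistic against the reference `q`. -/
noncomputable def collisionStat {X : Type*} [DecidableEq X] (q : X → ℝ) {m : ℕ}
    (a b : Fin m → X) : ℝ :=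
  ∑ t, ∑ s, collisionKernel q (a s) (b t)

section Identity

variable {X : Type*} [Fintype X] {p q : X → ℝ}

lemma chiSq_eq (hp : ∑ x, p x = 1) (hq0 : ∀ x, 0 < q x) (hq : ∑ x, q x = 1) :
    chiSq p q = ∑ x, (p x - q x) ^ 2 / q x := by
  have h : ∀ x, (p x - q x) ^ 2 / q x = p x ^ 2 / q x - 2 * p x + q x := by
    intro x
    have := (hq0 x).ne'
    field_simp
    ring
  simp only [h, Finset.sum_add_distrib, Finset.sum_sub_distrib, ← Finset.mul_sum, hp, hq, chiSq]
  ring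

lemma sum_mul_ratio_sq_le (hp : ∑ x, p x = 1) (hq0 : ∀ x, 0 < q x)
    (hq : ∑ x, q x = 1) {B : ℝ} (hB : ∀ x, p x / q x ≤ B) :
    ∑ x, p x * (p x / q x - 1) ^ 2 ≤ B * chiSq p q := by
  rw [chiSq_eq hp hq0 hq, Finset.mul_sum]
  refine Finset.sum_le_sum fun x _ => ?_
  have h : p x * (p x / q x - 1) ^ 2 = p x / q x * ((p x - q x) ^ 2 / q x) := by
    have := (hq0 x).ne'
    field_simp
  rw [h]
  exact mul_le_mul_of_nonneg_right (hB x) (div_nonneg (sq_nonneg _) (hq0 x).le)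

lemma sum_ratio_sq_le (hp : ∑ x, p x = 1) (hq0 : ∀ x, 0 < q x)
    (hq : ∑ x, q x = 1) {c : ℝ} (hc : ∀ x, 1 ≤ c * q x) :
    ∑ x, p x ^ 2 / q x ^ 2 ≤ 2 * Fintype.card X + 2 * c * chiSq p q := by
  have h : ∀ x, p x ^ 2 / q x ^ 2 ≤ 2 + 2 * c * ((p x - q x) ^ 2 / q x) := by
    intro x
    have hx := hq0 x
    have h1 : p x ^ 2 / q x ^ 2 ≤ 2 + 2 * ((p x - q x) ^ 2 / q x ^ 2) := by
      rw [div_le_iff₀ (by positivity), add_mul, mul_assoc, div_mul_cancel₀ _ (by positivity)]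
      nlinarith [sq_nonneg (p x - 2 * q x)]
    have h2 : (p x - q x) ^ 2 / q x ^ 2 ≤ c * ((p x - q x) ^ 2 / q x) := by
      rw [div_le_iff₀ (by positivity)]
      have : c * ((p x - q x) ^ 2 / q x) * q x ^ 2 = (p x - q x) ^ 2 * (c * q x) := by
        field_simp
      rw [this]
      nlinarith [hc x, sq_nonneg (p x - q x)]
    linarith
  refine (Finset.sum_le_sum fun x _ => h x).trans ?_
  rw [chiSq_eq hp hq0 hq, Finset.sum_add_distrib, Finset.mul_sum]
  simp [mul_comm]

lemma ratio_le (hp : ∑ x, p x = 1) (hq0 : ∀ x, 0 < q x) (hq : ∑ x, q x = 1)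
    {c B : ℝ} (hc : ∀ x, 1 ≤ c * q x) (hB0 : 0 ≤ B) (hB : c * chiSq p q ≤ B ^ 2) (x : X) :
    p x / q x ≤ 1 + B := by
  have hx := hq0 x
  have h1 : (p x - q x) ^ 2 / q x ≤ chiSq p q := by
    rw [chiSq_eq hp hq0 hq]
    exact Finset.single_le_sum (f := fun x => (p x - q x) ^ 2 / q x)
      (fun y _ => div_nonneg (sq_nonneg _) (hq0 y).le) (Finset.mem_univ x)
  have hc0 : 0 ≤ c := by
    by_contra h
    nlinarith [hc x]
  have h2 : (p x / q x - 1) ^ 2 ≤ B ^ 2 := by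
    refine le_trans ?_ ((mul_le_mul_of_nonneg_left h1 hc0).trans hB)
    have e : c * ((p x - q x) ^ 2 / q x) = (p x / q x - 1) ^ 2 * (c * q x) := by
      field_simp
    rw [e]
    nlinarith [hc x, sq_nonneg (p x / q x - 1)]
  linarith [abs_le_of_sq_le_sq' h2 hB0]

variable [DecidableEq X] {m : ℕ}

lemma iidExp_collisionStat_le (hp0 : ∀ x, 0 ≤ p x) (hp : ∑ x, p x = 1) :
    iidExp p m (fun a => iidExp p m (fun b => (collisionStat q a b - m ^ 2 * chiSq p q) ^ 2)) ≤
      m ^ 2 * ∑ x, p x ^ 2 / q x ^ 2 + 2 * m ^ 3 * ∑ x, p x * (p x / q x - 1) ^ 2 := by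
  set D := chiSq p q with hD
  have hD' : ∑ x, p x * (p x / q x - 1) = D := by
    simp only [hD, chiSq, mul_sub, mul_one, Finset.sum_sub_distrib, hp]
    congr 1
    exact Finset.sum_congr rfl fun x _ => by ring
  have hrow : ∀ x, ∑ y, p y * (collisionKernel q x y - D) = p x / q x - 1 - D := by
    intro x
    simp only [collisionKernel, mul_sub, Finset.sum_sub_distrib, mul_one, hp, ← Finset.sum_mul,
      mul_ite, mul_zero, Finset.sum_ite_eq, Finset.mem_univ, if_true]
    ring
  have hcol : ∀ y, ∑ x, p x * (collisionKernel q x y - D) = p y / q y - 1 - D := by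
    intro y
    rw [← hrow y]
    refine Finset.sum_congr rfl fun x _ => ?_
    simp only [collisionKernel]
    by_cases h : x = y
    · simp [h]
    · simp [h, Ne.symm h]
  have hmean : ∑ x, p x * (p x / q x - 1 - D) = 0 := by
    simp only [mul_sub (p _) _ D, Finset.sum_sub_distrib, hD', ← Finset.sum_mul, hp]
    ring
  have hvar : ∑ x, p x * (p x / q x - 1 - D) ^ 2 ≤ ∑ x, p x * (p x / q x - 1) ^ 2 := by
    have e : ∀ x, p x * (p x / q x - 1 - D) ^ 2 =
        p x * (p x / q x - 1) ^ 2 - p x * (p x / q x - 1) * (2 * D) + p x * D ^ 2 := by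
      intro x; ring
    simp only [e, Finset.sum_add_distrib, Finset.sum_sub_distrib, ← Finset.sum_mul, hD', hp]
    nlinarith [sq_nonneg D]
  have hker : ∑ y, p y * ∑ x, p x * (collisionKernel q x y - D) ^ 2 ≤ ∑ x, p x ^ 2 / q x ^ 2 := by
    have e : ∀ y, ∑ x, p x * (collisionKernel q x y - D) ^ 2 =
        p y / q y ^ 2 - 2 * (1 + D) * (p y / q y) + (1 + D) ^ 2 := by
      intro y
      have e' : ∀ x, p x * (collisionKernel q x y - D) ^ 2 =
          (if x = y then p x / q x ^ 2 - 2 * (1 + D) * (p x / q x) else 0) +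
            p x * (1 + D) ^ 2 := by
        intro x
        simp only [collisionKernel]
        split_ifs <;> ring
      simp only [e', Finset.sum_add_distrib, ← Finset.sum_mul, hp, Finset.sum_ite_eq',
        Finset.mem_univ, if_true]
      ring
    have e2 : ∀ y, p y * (p y / q y ^ 2 - 2 * (1 + D) * (p y / q y) + (1 + D) ^ 2) =
        p y ^ 2 / q y ^ 2 - p y * (p y / q y - 1) * (2 * (1 + D)) + p y * ((1 + D) ^ 2 -
          2 * (1 + D)) := by
      intro y; ring
    simp only [e, e2, Finset.sum_add_distrib, Finset.sum_sub_distrib, ← Finset.sum_mul, hD', hp]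
    nlinarith [sq_nonneg (1 + D)]
  have hstat : ∀ a b : Fin m → X, collisionStat q a b - m ^ 2 * D =
      ∑ t, ∑ s, (collisionKernel q (a s) (b t) - D) := by
    intro a b
    simp only [collisionStat, Finset.sum_sub_distrib, Finset.sum_const, Finset.card_univ,
      Fintype.card_fin, nsmul_eq_mul]
    ring
  simp only [hstat]
  rw [iidExp_twoSample_sq hp (fun x y => collisionKernel q x y - D)
    (by simp only [hrow, hmean])]
  simp only [hrow, hcol]
  have h1 := mul_le_mul_of_nonneg_left hker (sq_nonneg (m : ℝ))
  have h0 : 0 ≤ ∑ x, p x * (p x / q x - 1 - D) ^ 2 :=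
    Finset.sum_nonneg fun x _ => mul_nonneg (hp0 x) (sq_nonneg _)
  have h2 := mul_le_mul_of_nonneg_left hvar (by positivity : (0 : ℝ) ≤ 2 * m ^ 3)
  nlinarith [mul_nonneg (sq_nonneg (m : ℝ)) h0]

/-- With `m ≥ 1200 √|X| / ε²` samples in each half, the collision statistic concentrates
to within a quarter of `m² · max (χ²) ε²`. -/
lemma iidExp_collisionStat_sq_le (hp0 : ∀ x, 0 ≤ p x) (hp : ∑ x, p x = 1)
    (hq0 : ∀ x, 0 < q x) (hq : ∑ x, q x = 1) {ε r : ℝ} (hε : 0 < ε) (hr : 1 ≤ r)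
    (hrX : r ^ 2 = Fintype.card X) (hqε : ∀ x, ε ^ 2 ≤ 16 * r ^ 2 * q x)
    (hm : 1200 * r ≤ m * ε ^ 2) :
    iidExp p m (fun a => iidExp p m (fun b => (collisionStat q a b - m ^ 2 * chiSq p q) ^ 2)) ≤
      (m ^ 2 * max (chiSq p q) (ε ^ 2)) ^ 2 / 96 := by
  refine (iidExp_collisionStat_le hp0 hp).trans ?_
  set D := chiSq p q with hD
  set T := max D (ε ^ 2) with hT
  have hD0 : 0 ≤ D := by
    rw [hD, chiSq_eq hp hq0 hq]
    exact Finset.sum_nonneg fun y _ => div_nonneg (sq_nonneg _) (hq0 y).le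
  have hDT : D ≤ T := le_max_left _ _
  obtain ⟨u, hu⟩ : ∃ u, T = u * ε ^ 2 := ⟨T / ε ^ 2, by field_simp⟩
  have he : 0 < ε ^ 2 := by positivity
  have hu1 : 1 ≤ u := by
    have : ε ^ 2 ≤ T := le_max_right _ _
    rw [hu] at this
    nlinarith
  have hc : ∀ x, 1 ≤ 16 * r ^ 2 / ε ^ 2 * q x := by
    intro x
    rw [div_mul_eq_mul_div, le_div_iff₀ he]
    linarith [hqε x]
  have hcD : 16 * r ^ 2 / ε ^ 2 * D ≤ 16 * r ^ 2 * u := by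
    rw [div_mul_eq_mul_div, div_le_iff₀ he]
    have := mul_le_mul_of_nonneg_left (hDT.trans_eq hu) (by positivity : 0 ≤ 16 * r ^ 2)
    linarith
  have hr2 : 0 < r ^ 2 := by positivity
  have hB : ∀ x, p x / q x ≤ 5 * r * u := by
    intro x
    refine (ratio_le hp hq0 hq hc (B := 4 * r * u) (by positivity) (hcD.trans ?_) x).trans ?_
    · nlinarith [mul_nonneg hr2.le (mul_nonneg (by linarith : 0 ≤ u) (by linarith : 0 ≤ u - 1))]
    · nlinarith
  have h1 := sum_ratio_sq_le hp hq0 hq hc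
  rw [← hrX, ← hD] at h1
  have h1' : ∑ x, p x ^ 2 / q x ^ 2 ≤ 34 * (r ^ 2 * u ^ 2) := by
    nlinarith [mul_nonneg hr2.le (mul_nonneg (by linarith : 0 ≤ u) (by linarith : 0 ≤ u - 1)),
      mul_nonneg hr2.le (by linarith : 0 ≤ u - 1)]
  have h2' : ∑ x, p x * (p x / q x - 1) ^ 2 ≤ 5 * r * u * (u * ε ^ 2) := by
    refine (sum_mul_ratio_sq_le hp hq0 hq hB).trans ?_
    exact mul_le_mul_of_nonneg_left (hDT.trans_eq hu) (by positivity)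
  set M : ℝ := (m : ℝ) with hM
  have hM0 : 0 ≤ M := Nat.cast_nonneg m
  have h3 := mul_le_mul_of_nonneg_left h1' (sq_nonneg M)
  have h4 := mul_le_mul_of_nonneg_left h2' (by positivity : (0 : ℝ) ≤ 2 * M ^ 3)
  refine (add_le_add h3 h4).trans ?_
  rw [hu]
  obtain ⟨w, hw⟩ : ∃ w, w = M * ε ^ 2 := ⟨_, rfl⟩
  rw [← hw] at hm
  have e1 : M ^ 2 * (34 * (r ^ 2 * u ^ 2)) + 2 * M ^ 3 * (5 * r * u * (u * ε ^ 2)) =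
      M ^ 2 * u ^ 2 * (34 * r ^ 2 + 10 * r * w) := by rw [hw]; ring
  have e2 : (M ^ 2 * (u * ε ^ 2)) ^ 2 / 96 = M ^ 2 * u ^ 2 * (w ^ 2 / 96) := by rw [hw]; ring
  rw [e1, e2]
  refine mul_le_mul_of_nonneg_left ?_ (by positivity)
  nlinarith

/-- Chebyshev's inequality in the form used for both error types of the collision tester. -/
lemma iidExp_indicator_le (hp0 : ∀ x, 0 ≤ p x) (hp : ∑ x, p x = 1)
    (hq0 : ∀ x, 0 < q x) (hq : ∑ x, q x = 1) {ε r : ℝ} (hε : 0 < ε) (hr : 1 ≤ r)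
    (hrX : r ^ 2 = Fintype.card X) (hqε : ∀ x, ε ^ 2 ≤ 16 * r ^ 2 * q x)
    (hm : 1200 * r ≤ m * ε ^ 2) (A : (Fin m → X) → (Fin m → X) → Prop)
    [∀ a b, Decidable (A a b)]
    (hA : ∀ a b, A a b →
      m ^ 2 * max (chiSq p q) (ε ^ 2) / 4 ≤ |collisionStat q a b - m ^ 2 * chiSq p q|) :
    iidExp p m (fun a => iidExp p m (fun b => if A a b then 1 else 0)) ≤ 1 / 6 := by
  set V := (m : ℝ) ^ 2 * max (chiSq p q) (ε ^ 2) with hV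
  have hm0 : 0 < (m : ℝ) := by
    by_contra h
    nlinarith [sq_nonneg ε]
  have hV0 : 0 < V := by
    have : 0 < max (chiSq p q) (ε ^ 2) := lt_max_of_lt_right (by positivity)
    positivity
  have h : ∀ a b, (if A a b then (1 : ℝ) else 0) ≤
      16 / V ^ 2 * (collisionStat q a b - m ^ 2 * chiSq p q) ^ 2 := by
    intro a b
    split_ifs with hab
    · have h1 := pow_le_pow_left₀ (by positivity) (hA a b hab) 2
      rw [sq_abs] at h1
      rw [div_mul_eq_mul_div, le_div_iff₀ (by positivity)]
      linarith [h1]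
    · positivity
  refine (iidExp_mono hp0 fun a => iidExp_mono hp0 fun b => h a b).trans ?_
  simp only [iidExp_const_mul]
  refine (mul_le_mul_of_nonneg_left
    (iidExp_collisionStat_sq_le hp0 hp hq0 hq hε hr hrX hqε hm) (by positivity)).trans_eq ?_
  rw [← hV]
  field_simp
  norm_num

end Identity

section Product

variable {n : ℕ}

/-- The distribution with independent coordinates whose `i`-th coordinate has law `ρ i`. -/
noncomputable def prodDist (ρ : Fin n → Bool → ℝ) (x : Fin n → Bool) : ℝ :=
  ∏ i, ρ i (x i)

lemma sum_prod_apply (f : Fin n → Bool → ℝ) :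
    ∑ x : Fin n → Bool, ∏ i, f i (x i) = ∏ i, ∑ b, f i b := by
  rw [Finset.prod_univ_sum, Fintype.piFinset_univ]

lemma isDist_prodDist {ρ : Fin n → Bool → ℝ} (h0 : ∀ i b, 0 ≤ ρ i b) (h1 : ∀ i, ∑ b, ρ i b = 1) :
    IsDist (prodDist ρ) :=
  ⟨fun _ => Finset.prod_nonneg fun i _ => h0 i _, by
    simp only [prodDist, sum_prod_apply, h1, Finset.prod_const_one]⟩

lemma marginal_prodDist {ρ : Fin n → Bool → ℝ} (h1 : ∀ i, ∑ b, ρ i b = 1) (i : Fin n) (b : Bool) :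
    marginal (prodDist ρ) i b = ρ i b := by
  have h : ∀ x : Fin n → Bool, (if x i = b then prodDist ρ x else 0) =
      ∏ j, if j = i then (if x j = b then ρ j (x j) else 0) else ρ j (x j) := by
    intro x
    split_ifs with hx
    · refine Finset.prod_congr rfl fun j _ => ?_
      split_ifs with hj hj'
      · rfl
      · exact absurd (hj ▸ hx) hj'
      · rfl
    · exact (Finset.prod_eq_zero (Finset.mem_univ i) (by simp [hx])).symm
  simp only [marginal, h]
  rw [sum_prod_apply (fun j c => if j = i then (if c = b then ρ j c else 0) else ρ j c),
    Finset.prod_eq_single i]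
  · simp
  · intro j _ hj
    simp only [hj, if_false, h1]
  · simp

lemma isProduct_prodDist {ρ : Fin n → Bool → ℝ} (h1 : ∀ i, ∑ b, ρ i b = 1) :
    IsProduct (prodDist ρ) := by
  intro x
  simp only [marginal_prodDist h1, prodDist]

lemma marginal_nonneg {P : (Fin n → Bool) → ℝ} (hP : IsDist P) (i : Fin n) (b : Bool) :
    0 ≤ marginal P i b :=
  Finset.sum_nonneg fun x _ => by split_ifs <;> simp [hP.1 x]

lemma sum_marginal {P : (Fin n → Bool) → ℝ} (hP : IsDist P) (i : Fin n) :
    ∑ b, marginal P i b = 1 := by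
  simp only [marginal]
  rw [Finset.sum_comm]
  simp only [Finset.sum_ite_eq, Finset.mem_univ, if_true, hP.2]

/-- The add-one estimator of the law of a bit from `k` samples. -/
noncomputable def laplace {k : ℕ} (v : Fin k → Bool) (b : Bool) : ℝ :=
  ((∑ s, if v s = b then 1 else 0) + 1) / (k + 2)

lemma laplace_pos {k : ℕ} (v : Fin k → Bool) (b : Bool) : 0 < laplace v b := by
  have : (0 : ℝ) ≤ ∑ s, if v s = b then 1 else 0 :=
    Finset.sum_nonneg fun s _ => by split_ifs <;> norm_num
  unfold laplace
  positivity

lemma sum_laplace {k : ℕ} (v : Fin k → Bool) : ∑ b, laplace v b = 1 := by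
  simp only [laplace]
  rw [← Finset.sum_div, Finset.sum_add_distrib, Finset.sum_comm]
  simp only [Finset.sum_ite_eq, Finset.mem_univ, if_true]
  simp only [Finset.sum_const, Finset.card_univ, Fintype.card_fin, Fintype.card_bool,
    nsmul_eq_mul, mul_one]
  push_cast
  field_simp

lemma iidExp_inv_count_le {ρ : Bool → ℝ} (h0 : ∀ b, 0 ≤ ρ b) (h1 : ∑ b, ρ b = 1) (k : ℕ)
    (b : Bool) :
    (k + 1) * (ρ b * iidExp ρ k (fun v => 1 / ((∑ s, if v s = b then (1 : ℝ) else 0) + 1))) ≤ 1 := by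
  have hone : iidExp ρ (k + 1) (fun v => ∑ i, (if v i = b then (1 : ℝ) else 0) /
      (∑ s, if v s = b then (1 : ℝ) else 0)) ≤ 1 := by
    refine (iidExp_mono h0 fun v => ?_).trans_eq (iidExp_const h1 1)
    rw [← Finset.sum_div]
    exact div_self_le_one _
  rw [iidExp_sum] at hone
  have h : ∀ i : Fin (k + 1), iidExp ρ (k + 1) (fun v => (if v i = b then (1 : ℝ) else 0) /
      (∑ s, if v s = b then (1 : ℝ) else 0)) =
      ρ b * iidExp ρ k (fun v => 1 / ((∑ s, if v s = b then (1 : ℝ) else 0) + 1)) := by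
    intro i
    rw [iidExp_insertNth i]
    simp only [Fin.sum_univ_succAbove _ i, Fin.insertNth_apply_same,
      Fin.insertNth_apply_succAbove]
    rw [Finset.sum_eq_single b]
    · simp only [if_true, add_comm (1 : ℝ)]
    · intro c _ hc
      simp [hc, iidExp]
    · simp
  simp only [h, Finset.sum_const, Finset.card_univ, Fintype.card_fin, nsmul_eq_mul] at hone
  exact_mod_cast hone

lemma sum_iidExp_sq_div_laplace_le {ρ : Bool → ℝ} (h0 : ∀ b, 0 ≤ ρ b) (h1 : ∑ b, ρ b = 1)
    (k : ℕ) :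
    ∑ b, iidExp ρ k (fun v => ρ b ^ 2 / laplace v b) ≤ 1 + 1 / (k + 1) := by
  have hk : (0 : ℝ) < k + 1 := by positivity
  have h : ∀ b, iidExp ρ k (fun v => ρ b ^ 2 / laplace v b) ≤ ρ b * (1 + 1 / (k + 1)) := by
    intro b
    have e : (fun v : Fin k → Bool => ρ b ^ 2 / laplace v b) = fun v =>
        (ρ b ^ 2 * (k + 2)) * (1 / ((∑ s, if v s = b then (1 : ℝ) else 0) + 1)) := by
      funext v
      rw [laplace, div_div_eq_mul_div, mul_one_div]
    rw [e, iidExp_const_mul]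
    have h2 := iidExp_inv_count_le h0 h1 k b
    rw [mul_comm, ← le_div_iff₀ hk] at h2
    have h3 := mul_le_mul_of_nonneg_left h2 (mul_nonneg (h0 b) (by positivity : (0 : ℝ) ≤ k + 2))
    refine (le_of_eq ?_).trans (h3.trans_eq ?_)
    · ring
    · field_simp
      ring
  refine (Finset.sum_le_sum fun b _ => h b).trans_eq ?_
  rw [← Finset.sum_mul, h1, one_mul]

/-- The product distribution whose coordinates are estimated from the samples `W`. -/
noncomputable def learnedProd {k : ℕ} (W : Fin k → Fin n → Bool) : (Fin n → Bool) → ℝ :=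
  prodDist fun i => laplace fun s => W s i

lemma learnedProd_pos {k : ℕ} (W : Fin k → Fin n → Bool) (x : Fin n → Bool) :
    0 < learnedProd W x := by
  unfold learnedProd prodDist
  exact Finset.prod_pos fun i _ => laplace_pos (fun s => W s i) (x i)

lemma iidExp_sq_div_learnedProd {ρ : Fin n → Bool → ℝ} (k : ℕ) :
    iidExp (prodDist ρ) k (fun W => ∑ x, prodDist ρ x ^ 2 / learnedProd W x) =
      ∏ i, ∑ b, iidExp (ρ i) k (fun v => ρ i b ^ 2 / laplace v b) := by
  rw [iidExp_sum, ← sum_prod_apply]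
  refine Finset.sum_congr rfl fun x _ => ?_
  simp only [iidExp]
  rw [Finset.prod_univ_sum, Fintype.piFinset_univ,
    ← (Equiv.piComm fun (_ : Fin k) (_ : Fin n) => Bool).sum_comp]
  refine Finset.sum_congr rfl fun W _ => ?_
  simp only [prodDist, learnedProd, Equiv.piComm_apply, Finset.prod_mul_distrib,
    Finset.prod_div_distrib, Finset.prod_pow]
  rw [Finset.prod_comm]
  rfl

lemma iidExp_chiSq_learnedProd_le {P : (Fin n → Bool) → ℝ} (hP : IsDist P) (hprod : IsProduct P)
    (k : ℕ) :
    iidExp P k (fun W => chiSq P (learnedProd W)) ≤ (1 + 1 / (k + 1)) ^ n - 1 := by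
  have e : P = prodDist (marginal P) := funext hprod
  have h : iidExp P k (fun W => ∑ x, P x ^ 2 / learnedProd W x) ≤ (1 + 1 / (k + 1)) ^ n := by
    rw [e, iidExp_sq_div_learnedProd]
    refine (Finset.prod_le_prod (fun i _ => Finset.sum_nonneg fun b _ =>
      Finset.sum_nonneg fun v _ => ?_) fun i _ => sum_iidExp_sq_div_laplace_le
        (marginal_nonneg hP i) (sum_marginal hP i) k).trans_eq (by simp)
    exact mul_nonneg (Finset.prod_nonneg fun s _ => marginal_nonneg hP i _)
      (div_nonneg (sq_nonneg _) (laplace_pos _ _).le)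
  simp only [chiSq, sub_eq_add_neg, iidExp_add, iidExp_const hP.2]
  linarith

end Product

section Mixture

variable {n : ℕ}

/-- Mixture of `Q` with the uniform distribution, the latter having weight `η`. -/
noncomputable def uniformMix (η : ℝ) (Q : (Fin n → Bool) → ℝ) (x : Fin n → Bool) : ℝ :=
  (1 - η) * Q x + η / 2 ^ n

lemma sum_uniformMix {η : ℝ} {Q : (Fin n → Bool) → ℝ} (hQ : IsDist Q) :
    ∑ x, uniformMix η Q x = 1 := by
  simp only [uniformMix, Finset.sum_add_distrib, ← Finset.mul_sum, hQ.2, Finset.sum_const,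
    Finset.card_univ, Fintype.card_fun, Fintype.card_bool, Fintype.card_fin, nsmul_eq_mul]
  push_cast
  field_simp
  ring

lemma uniformMix_ge {η : ℝ} (h1 : η ≤ 1) {Q : (Fin n → Bool) → ℝ} (hQ : IsDist Q)
    (x : Fin n → Bool) : η / 2 ^ n ≤ uniformMix η Q x := by
  have := mul_nonneg (sub_nonneg.2 h1) (hQ.1 x)
  unfold uniformMix
  linarith

lemma chiSq_uniformMix_le {η : ℝ} (h0 : 0 ≤ η) (h1 : η < 1) (P : (Fin n → Bool) → ℝ)
    {Q : (Fin n → Bool) → ℝ} (hQ : ∀ x, 0 < Q x) :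
    (1 - η) * chiSq P (uniformMix η Q) ≤ chiSq P Q + η := by
  have h : (1 - η) * ∑ x, P x ^ 2 / uniformMix η Q x ≤ ∑ x, P x ^ 2 / Q x := by
    rw [Finset.mul_sum]
    refine Finset.sum_le_sum fun x _ => ?_
    have hx := hQ x
    have h2 : (1 - η) * Q x ≤ uniformMix η Q x := by
      have : 0 ≤ η / 2 ^ n := by positivity
      unfold uniformMix
      linarith
    have h3 : 0 < (1 - η) * Q x := mul_pos (by linarith) hx
    have h4 := div_le_div_of_nonneg_left (sq_nonneg (P x)) h3 h2
    have h5 := mul_le_mul_of_nonneg_left h4 (by linarith : 0 ≤ 1 - η)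
    refine h5.trans_eq ?_
    have : 1 - η ≠ 0 := by linarith
    field_simp
  unfold chiSq
  linarith

lemma sq_sqrt_sub_sqrt_le_abs {a b : ℝ} (ha : 0 ≤ a) (hb : 0 ≤ b) :
    (Real.sqrt a - Real.sqrt b) ^ 2 ≤ |a - b| := by
  have h : a - b = (Real.sqrt a - Real.sqrt b) * (Real.sqrt a + Real.sqrt b) := by
    nlinarith [Real.sq_sqrt ha, Real.sq_sqrt hb]
  have h0 := Real.sqrt_nonneg a
  have h0' := Real.sqrt_nonneg b
  rw [h, abs_mul, ← sq_abs, sq, abs_of_nonneg (add_nonneg h0 h0')]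
  refine mul_le_mul_of_nonneg_left ?_ (abs_nonneg _)
  rw [abs_le]
  constructor <;> linarith

lemma sq_sqrt_sub_sqrt_le_div {a b : ℝ} (ha : 0 ≤ a) (hb : 0 < b) :
    (Real.sqrt a - Real.sqrt b) ^ 2 ≤ (a - b) ^ 2 / b := by
  have h : a - b = (Real.sqrt a - Real.sqrt b) * (Real.sqrt a + Real.sqrt b) := by
    nlinarith [Real.sq_sqrt ha, Real.sq_sqrt hb.le]
  rw [le_div_iff₀ hb, h, mul_pow]
  refine mul_le_mul_of_nonneg_left ?_ (sq_nonneg _)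
  nlinarith [Real.sq_sqrt hb.le, Real.sqrt_nonneg a, Real.sqrt_nonneg b]

lemma two_mul_hellinger_sq (P Q : (Fin n → Bool) → ℝ) :
    2 * hellinger P Q ^ 2 = ∑ x, (Real.sqrt (P x) - Real.sqrt (Q x)) ^ 2 := by
  rw [hellinger, mul_pow, Real.sq_sqrt (Finset.sum_nonneg fun _ _ => sq_nonneg _), div_pow,
    Real.sq_sqrt (by norm_num)]
  ring

lemma hellinger_sq_le_chiSq_uniformMix {η : ℝ} (h0 : 0 < η) (h1 : η ≤ 1)
    {P Q : (Fin n → Bool) → ℝ} (hP : IsDist P) (hQ : IsDist Q) :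
    hellinger P Q ^ 2 ≤ chiSq P (uniformMix η Q) + 2 * η := by
  set R := uniformMix η Q with hR
  have hR0 : ∀ x, 0 < R x := fun x =>
    lt_of_lt_of_le (by positivity) (uniformMix_ge h1 hQ x)
  have hpt : ∀ x, (Real.sqrt (P x) - Real.sqrt (Q x)) ^ 2 ≤
      2 * ((P x - R x) ^ 2 / R x) + 2 * (η * Q x + η / 2 ^ n) := by
    intro x
    have a1 := sq_sqrt_sub_sqrt_le_div (hP.1 x) (hR0 x)
    have a2 := sq_sqrt_sub_sqrt_le_abs (hR0 x).le (hQ.1 x)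
    have a3 : |R x - Q x| ≤ η * Q x + η / 2 ^ n := by
      have e : R x - Q x = η / 2 ^ n - η * Q x := by rw [hR, uniformMix]; ring
      have b1 : 0 ≤ η / 2 ^ n := by positivity
      have b2 := mul_nonneg h0.le (hQ.1 x)
      rw [e, abs_le]
      constructor <;> linarith
    nlinarith [sq_nonneg (Real.sqrt (P x) - Real.sqrt (R x) - (Real.sqrt (R x) - Real.sqrt (Q x)))]
  have hsum := Finset.sum_le_sum fun x (_ : x ∈ Finset.univ) => hpt x
  rw [← two_mul_hellinger_sq, Finset.sum_add_distrib, ← Finset.mul_sum, ← Finset.mul_sum,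
    ← chiSq_eq hP.2 hR0 (sum_uniformMix hQ), Finset.sum_add_distrib, ← Finset.mul_sum, hQ.2] at hsum
  have hu : ∑ _x : Fin n → Bool, η / 2 ^ n = η := by
    simp only [Finset.sum_const, Finset.card_univ, Fintype.card_fun, Fintype.card_bool,
      Fintype.card_fin, nsmul_eq_mul]
    push_cast
    field_simp
  rw [hu] at hsum
  linarith

end Mixture

section Tester

variable {n m : ℕ}

lemma natCast_le_two_mul_of_sq_eq {r : ℝ} (hr : 1 ≤ r) (hr2 : r ^ 2 = 2 ^ n) :
    (n : ℝ) ≤ 2 * r := by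
  have h : n ^ 2 ≤ 4 * 2 ^ n := by
    rcases lt_or_ge n 4 with h | h
    · interval_cases n <;> norm_num
    · clear hr2
      induction n, h using Nat.le_induction with
      | base => norm_num
      | succ k hk ih => rw [pow_succ 2 k]; nlinarith
  have h' : (n : ℝ) ^ 2 ≤ 4 * 2 ^ n := by exact_mod_cast h
  rw [← hr2] at h'
  exact le_of_sq_le_sq (by linarith) (by linarith)

/-- The reference distribution learned from `W`, smoothed to have full support. -/
noncomputable def reference (ε : ℝ) (W : Fin m → Fin n → Bool) : (Fin n → Bool) → ℝ :=
  uniformMix (ε ^ 2 / 16) (learnedProd W)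

/-- Rejection rule of the independence tester: `W` is used to learn a product distribution,
`a` and `b` to compare the unknown distribution with it. -/
def Rejects (ε : ℝ) (W a b : Fin m → Fin n → Bool) : Prop :=
  m ^ 2 * ε ^ 2 / 2 < collisionStat (reference ε W) a b

lemma isDist_learnedProd (W : Fin m → Fin n → Bool) : IsDist (learnedProd W) :=
  isDist_prodDist (fun _ _ => (laplace_pos _ _).le) fun _ => sum_laplace _

lemma isProduct_learnedProd (W : Fin m → Fin n → Bool) : IsProduct (learnedProd W) :=
  isProduct_prodDist fun _ => sum_laplace _

variable {P : (Fin n → Bool) → ℝ} {ε r : ℝ}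

lemma iidExp_indicator_reference_le (hP : IsDist P) (hε : 0 < ε) (hε1 : ε ≤ 1) (hr : 1 ≤ r)
    (hr2 : r ^ 2 = 2 ^ n) (hm : 1200 * r ≤ m * ε ^ 2) (W : Fin m → Fin n → Bool)
    (A : (Fin m → Fin n → Bool) → (Fin m → Fin n → Bool) → Prop) [∀ a b, Decidable (A a b)]
    (hA : ∀ a b, A a b → m ^ 2 * max (chiSq P (reference ε W)) (ε ^ 2) / 4 ≤
      |collisionStat (reference ε W) a b - m ^ 2 * chiSq P (reference ε W)|) :
    iidExp P m (fun a => iidExp P m (fun b => if A a b then 1 else 0)) ≤ 1 / 6 := by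
  have he : 0 < ε ^ 2 := by positivity
  have he1 : ε ^ 2 ≤ 1 := pow_le_one₀ hε.le hε1
  have hge : ∀ x, ε ^ 2 / 16 / 2 ^ n ≤ reference ε W x :=
    uniformMix_ge (by linarith) (isDist_learnedProd W)
  refine iidExp_indicator_le hP.1 hP.2 (fun x => lt_of_lt_of_le (by positivity) (hge x))
    (sum_uniformMix (isDist_learnedProd W)) hε hr (by simp [hr2]) (fun x => ?_) hm A hA
  have h := hge x
  rw [div_div, div_le_iff₀ (by positivity), ← hr2] at h
  linarith

lemma iidExp_not_rejects_le (hP : IsDist P) (hε : 0 < ε) (hε1 : ε ≤ 1) (hr : 1 ≤ r)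
    (hr2 : r ^ 2 = 2 ^ n) (hm : 1200 * r ≤ m * ε ^ 2) (W : Fin m → Fin n → Bool)
    [∀ a b, Decidable (Rejects ε W a b)] (hD : 3 / 4 * ε ^ 2 ≤ chiSq P (reference ε W)) :
    iidExp P m (fun a => iidExp P m (fun b => if ¬ Rejects ε W a b then 1 else 0)) ≤ 1 / 6 := by
  refine iidExp_indicator_reference_le hP hε hε1 hr hr2 hm W _ fun a b hab => ?_
  rw [Rejects, not_lt] at hab
  refine le_trans ?_ (neg_le_abs _)
  have h : max (chiSq P (reference ε W)) (ε ^ 2) ≤ 4 * chiSq P (reference ε W) - 2 * ε ^ 2 :=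
    max_le (by nlinarith) (by linarith)
  have := mul_le_mul_of_nonneg_left h (sq_nonneg (m : ℝ))
  linarith

lemma iidExp_rejects_le (hP : IsDist P) (hε : 0 < ε) (hε1 : ε ≤ 1) (hr : 1 ≤ r)
    (hr2 : r ^ 2 = 2 ^ n) (hm : 1200 * r ≤ m * ε ^ 2) (W : Fin m → Fin n → Bool)
    [∀ a b, Decidable (Rejects ε W a b)] (hD : chiSq P (reference ε W) ≤ ε ^ 2 / 4) :
    iidExp P m (fun a => iidExp P m (fun b => if Rejects ε W a b then 1 else 0)) ≤ 1 / 6 := by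
  refine iidExp_indicator_reference_le hP hε hε1 hr hr2 hm W _ fun a b hab => ?_
  rw [Rejects] at hab
  refine le_trans ?_ (le_abs_self _)
  have he : 0 < ε ^ 2 := by positivity
  rw [max_eq_right (by linarith)]
  have := mul_le_mul_of_nonneg_left hD (sq_nonneg (m : ℝ))
  linarith

lemma chiSq_reference_ge (hP : IsDist P) (hε : 0 < ε) (hε1 : ε ≤ 1)
    (hfar : ∀ Q : (Fin n → Bool) → ℝ, IsDist Q → IsProduct Q → ε ≤ hellinger P Q)
    (W : Fin m → Fin n → Bool) : 3 / 4 * ε ^ 2 ≤ chiSq P (reference ε W) := by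
  have h := hfar _ (isDist_learnedProd W) (isProduct_learnedProd W)
  have h2 := pow_le_pow_left₀ hε.le h 2
  have he : 0 < ε ^ 2 := by positivity
  have he1 : ε ^ 2 ≤ 1 := pow_le_one₀ hε.le hε1
  have h3 := hellinger_sq_le_chiSq_uniformMix (η := ε ^ 2 / 16) (by linarith) (by linarith) hP
    (isDist_learnedProd W)
  rw [reference]
  linarith

lemma one_add_inv_pow_le (hε : 0 < ε) (hε1 : ε ≤ 1) (hr : 1 ≤ r)
    (hr2 : r ^ 2 = 2 ^ n) (hm : 1200 * r ≤ m * ε ^ 2) :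
    (1 + 1 / ((m : ℝ) + 1)) ^ n - 1 ≤ ε ^ 2 / 96 := by
  have hm0 : (0 : ℝ) < m + 1 := by positivity
  have he : 0 < ε ^ 2 := by positivity
  have he1 : ε ^ 2 ≤ 1 := pow_le_one₀ hε.le hε1
  have hx : (n : ℝ) / (m + 1) ≤ ε ^ 2 / 600 := by
    rw [div_le_iff₀ hm0]
    have := natCast_le_two_mul_of_sq_eq hr hr2
    nlinarith
  have hx0 : 0 ≤ (n : ℝ) / (m + 1) := by positivity
  have h1 : (1 + 1 / ((m : ℝ) + 1)) ^ n ≤ Real.exp (n / (m + 1)) := by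
    have : 1 + 1 / ((m : ℝ) + 1) ≤ Real.exp (1 / (m + 1)) := by
      linarith [Real.add_one_le_exp (1 / ((m : ℝ) + 1))]
    refine (pow_le_pow_left₀ (by positivity) this n).trans_eq ?_
    rw [← Real.exp_nat_mul, mul_one_div]
  have h2 := Real.abs_exp_sub_one_le (x := (n : ℝ) / (m + 1))
    (by rw [abs_of_nonneg hx0]; linarith)
  rw [abs_of_nonneg hx0] at h2
  linarith [le_abs_self (Real.exp ((n : ℝ) / (m + 1)) - 1)]

lemma iidExp_rejects_le_of_isProduct (hP : IsDist P) (hprod : IsProduct P) (hε : 0 < ε)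
    (hε1 : ε ≤ 1) (hr : 1 ≤ r) (hr2 : r ^ 2 = 2 ^ n) (hm : 1200 * r ≤ m * ε ^ 2)
    [∀ W a b : Fin m → Fin n → Bool, Decidable (Rejects ε W a b)] :
    iidExp P m (fun W => iidExp P m (fun a => iidExp P m (fun b =>
      if Rejects ε W a b then 1 else 0))) ≤ 1 / 3 := by
  have he : 0 < ε ^ 2 := by positivity
  have he1 : ε ^ 2 ≤ 1 := pow_le_one₀ hε.le hε1
  have hpt : ∀ W : Fin m → Fin n → Bool,
      iidExp P m (fun a => iidExp P m (fun b => if Rejects ε W a b then 1 else 0)) ≤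
        1 / 6 + 16 / ε ^ 2 * chiSq P (learnedProd W) := by
    intro W
    have hQ := learnedProd_pos W
    have h0 : 0 ≤ chiSq P (learnedProd W) := by
      rw [chiSq_eq hP.2 hQ (isDist_learnedProd W).2]
      exact Finset.sum_nonneg fun y _ => div_nonneg (sq_nonneg _) (hQ y).le
    have h0' : 0 ≤ 16 / ε ^ 2 * chiSq P (learnedProd W) := by positivity
    rcases le_or_gt (chiSq P (learnedProd W)) (ε ^ 2 / 16) with h | h
    · refine (iidExp_rejects_le hP hε hε1 hr hr2 hm W ?_).trans (by linarith)
      have h2 := chiSq_uniformMix_le (η := ε ^ 2 / 16) (by linarith) (by linarith) P hQ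
      rw [reference]
      nlinarith
    · have h1 : iidExp P m (fun a => iidExp P m (fun b => if Rejects ε W a b then 1 else 0)) ≤
          1 := by
        refine (iidExp_mono (G := fun _ => 1) hP.1 fun a => ?_).trans_eq (iidExp_const hP.2 1)
        refine (iidExp_mono (G := fun _ => 1) hP.1 fun b => ?_).trans_eq (iidExp_const hP.2 1)
        split_ifs <;> norm_num
      have h2 : 1 ≤ 16 / ε ^ 2 * chiSq P (learnedProd W) := by
        rw [div_mul_eq_mul_div, le_div_iff₀ he]
        linarith
      linarith
  refine (iidExp_mono hP.1 hpt).trans ?_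
  rw [iidExp_add, iidExp_const hP.2, iidExp_const_mul]
  have h := (iidExp_chiSq_learnedProd_le hP hprod m).trans (one_add_inv_pow_le hε hε1 hr hr2 hm)
  have h2 := mul_le_mul_of_nonneg_left h (by positivity : 0 ≤ 16 / ε ^ 2)
  have e : 16 / ε ^ 2 * (ε ^ 2 / 96) = 1 / 6 := by
    field_simp
    norm_num
  linarith

lemma acceptProb_eq_iidExp (T : (Fin m → Fin n → Bool) → Bool) :
    acceptProb P T = iidExp P m (fun s => if T s then 1 else 0) := by
  simp only [acceptProb, iidExp, mul_ite, mul_one, mul_zero]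

lemma acceptProb_eq_one_sub (hP : IsDist P) (T : (Fin m → Fin n → Bool) → Bool) :
    acceptProb P T = 1 - acceptProb P (fun s => !T s) := by
  rw [eq_sub_iff_add_eq, acceptProb_eq_iidExp, acceptProb_eq_iidExp, ← iidExp_add]
  refine Eq.trans ?_ (iidExp_const (p := P) (m := m) hP.2 1)
  congr 1
  funext s
  cases T s <;> simp

lemma exists_independence_tester {M : ℕ} (hε : 0 < ε) (hε1 : ε ≤ 1) (hr : 1 ≤ r)
    (hr2 : r ^ 2 = 2 ^ n) (hm : 1200 * r ≤ m * ε ^ 2) (hM : 3 * m ≤ M) :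
    ∃ T : (Fin M → Fin n → Bool) → Bool, ∀ P : (Fin n → Bool) → ℝ, IsDist P →
      (IsProduct P → 2 / 3 ≤ acceptProb P T) ∧
      ((∀ Q : (Fin n → Bool) → ℝ, IsDist Q → IsProduct Q → ε ≤ hellinger P Q) →
        2 / 3 ≤ acceptProb P (fun s => !T s)) := by
  classical
  obtain ⟨l, rfl⟩ : ∃ l, M = m + (m + (m + l)) := ⟨M - 3 * m, by omega⟩
  set T : (Fin (m + (m + (m + l))) → Fin n → Bool) → Bool := fun s =>
    decide (¬ Rejects ε (fun i => s (Fin.castAdd _ i)) (fun i => s (Fin.natAdd m (Fin.castAdd _ i)))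
      (fun i => s (Fin.natAdd m (Fin.natAdd m (Fin.castAdd _ i))))) with hT
  refine ⟨T, fun P hP => ⟨fun hprod => ?_, fun hfar => ?_⟩⟩
  · have h : acceptProb P (fun s => !T s) = iidExp P m (fun W => iidExp P m (fun a =>
        iidExp P m (fun b => if Rejects ε W a b then 1 else 0))) := by
      rw [acceptProb_eq_iidExp]
      simp only [iidExp_append, hT, Fin.append_left, Fin.append_right, iidExp_const hP.2,
        decide_not, Bool.not_not, decide_eq_true_eq]
    rw [acceptProb_eq_one_sub hP, h]
    linarith [iidExp_rejects_le_of_isProduct hP hprod hε hε1 hr hr2 hm]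
  · have h : acceptProb P T = iidExp P m (fun W => iidExp P m (fun a =>
        iidExp P m (fun b => if ¬ Rejects ε W a b then 1 else 0))) := by
      rw [acceptProb_eq_iidExp]
      simp only [iidExp_append, hT, Fin.append_left, Fin.append_right, iidExp_const hP.2,
        decide_eq_true_eq]
    have h2 : acceptProb P T ≤ 1 / 6 := by
      rw [h]
      exact (iidExp_mono hP.1 fun W => iidExp_not_rejects_le hP hε hε1 hr hr2 hm W
        (chiSq_reference_ge hP hε hε1 hfar W)).trans_eq (iidExp_const hP.2 _)
    linarith [acceptProb_eq_one_sub hP T]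

end Tester

/-- Hellinger independence testing for general distributions over `{0,1}^n`:
an `O(2^{n/2}/ε²)`-sample tester that accepts product distributions and rejects
distributions at Hellinger distance at least `ε` from every product distribution,
each with probability at least `2/3`. -/
theorem hellinger_independence_tester :
    ∃ C : ℝ, 0 < C ∧
      ∀ n : ℕ, 1 ≤ n → ∀ ε : ℝ, 0 < ε → ε ≤ 1 →
        ∃ T : (Fin ⌈C * (2 : ℝ) ^ ((n : ℝ) / 2) / ε ^ 2⌉₊ → Fin n → Bool) → Bool,
          ∀ P : (Fin n → Bool) → ℝ, IsDist P →
            (IsProduct P → 2 / 3 ≤ acceptProb P T) ∧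
            ((∀ Q : (Fin n → Bool) → ℝ, IsDist Q → IsProduct Q → ε ≤ hellinger P Q) →
              2 / 3 ≤ acceptProb P (fun s => !T s)) := by
  refine ⟨4000, by norm_num, fun n _ ε hε hε1 => ?_⟩
  set r : ℝ := (2 : ℝ) ^ ((n : ℝ) / 2) with hr
  have hr1 : 1 ≤ r := Real.one_le_rpow (by norm_num) (by positivity)
  have hr2 : r ^ 2 = 2 ^ n := by
    rw [hr, ← Real.rpow_natCast, ← Real.rpow_mul (by norm_num), ← Real.rpow_natCast]
    congr 1
    push_cast
    ring
  have he : 0 < ε ^ 2 := by positivity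
  have he1 : ε ^ 2 ≤ 1 := pow_le_one₀ hε.le hε1
  set M := ⌈4000 * r / ε ^ 2⌉₊ with hM
  have hMle : 4000 * r ≤ M * ε ^ 2 := by
    rw [← div_le_iff₀ he]
    exact Nat.le_ceil _
  obtain ⟨m, hm3, hm⟩ : ∃ m : ℕ, 3 * m ≤ M ∧ 1200 * r ≤ m * ε ^ 2 := by
    refine ⟨M / 3, Nat.mul_div_le M 3, ?_⟩
    have h : (M : ℝ) ≤ 3 * (M / 3 : ℕ) + 2 := by
      have : M ≤ 3 * (M / 3) + 2 := by omega
      exact_mod_cast this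
    nlinarith
  exact exists_independence_tester hε hε1 hr1 hr2 hm hm3
end

section
/- There exist constants C₁, C₂ > 0 such that the following holds. Let ε ∈ (0,1] and let n ≥ C₁ be an integer, and let a, b be nonnegative integers with a + b = n and b ≥ n/4. Set δ = ε/√n. Then ((1−δ)^n / 2^n) · ∑_{k₁=0}^{a} ∑_{k₂=0}^{b} C(a,k₁)·C(b,k₂) · | ((1+δ)/(1−δ))^{k₁+k₂} − ((1+δ)/(1−δ))^{k₁+b−k₂} | ≥ C₂·ε, where C(a,k) denotes the binomial coefficient. -/
open Finset

/-- For `p + q = 1`, the `m`-th moment of a sum of `n` independent signs, each equal to `1` with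
weight `p` and to `-1` with weight `q`. -/
noncomputable def signSumMoment (p q : ℝ) (m n : ℕ) : ℝ :=
  ∑ ij ∈ antidiagonal n, (n.choose ij.1 : ℝ) * (p ^ ij.1 * q ^ ij.2 * ((ij.1 : ℝ) - ij.2) ^ m)

theorem signSumMoment_succ (p q : ℝ) (m n : ℕ) :
    signSumMoment p q m (n + 1) =
      ∑ ij ∈ antidiagonal n, (n.choose ij.1 : ℝ) * (p ^ ij.1 * q ^ ij.2 *
        (p * ((ij.1 : ℝ) - ij.2 + 1) ^ m + q * ((ij.1 : ℝ) - ij.2 - 1) ^ m)) := by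
  unfold signSumMoment
  rw [sum_antidiagonal_choose_succ_mul
    (fun i j => p ^ i * q ^ j * ((i : ℝ) - j) ^ m), ← sum_add_distrib]
  refine sum_congr rfl fun ij hij => ?_
  rw [Nat.choose_symm_of_eq_add (mem_antidiagonal.1 hij).symm]
  push_cast
  ring

theorem signSumMoment_zero_right (p q : ℝ) (m : ℕ) : signSumMoment p q m 0 = 0 ^ m := by
  simp [signSumMoment]

theorem signSumMoment_zero {p q : ℝ} (h : p + q = 1) (n : ℕ) : signSumMoment p q 0 n = 1 := by
  induction n with
  | zero => simp [signSumMoment_zero_right]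
  | succ n ih =>
    rw [signSumMoment_succ, ← ih]
    simp [signSumMoment, h]

theorem signSumMoment_one {p q : ℝ} (h : p + q = 1) (n : ℕ) :
    signSumMoment p q 1 n = n * (p - q) := by
  induction n with
  | zero => simp [signSumMoment_zero_right]
  | succ n ih =>
    have hrec : signSumMoment p q 1 (n + 1) =
        signSumMoment p q 1 n + (p - q) * signSumMoment p q 0 n := by
      rw [signSumMoment_succ]
      simp only [signSumMoment, mul_sum, ← sum_add_distrib]
      refine sum_congr rfl fun ij _ => ?_
      obtain rfl := eq_sub_iff_add_eq'.2 h
      ring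
    rw [hrec, ih, signSumMoment_zero h]
    push_cast
    ring

theorem signSumMoment_two {p q : ℝ} (h : p + q = 1) (n : ℕ) :
    signSumMoment p q 2 n = n + n * (n - 1) * (p - q) ^ 2 := by
  induction n with
  | zero => simp [signSumMoment_zero_right]
  | succ n ih =>
    have hrec : signSumMoment p q 2 (n + 1) =
        signSumMoment p q 2 n + 2 * (p - q) * signSumMoment p q 1 n + signSumMoment p q 0 n := by
      rw [signSumMoment_succ]
      simp only [signSumMoment, mul_sum, ← sum_add_distrib]
      refine sum_congr rfl fun ij _ => ?_
      obtain rfl := eq_sub_iff_add_eq'.2 h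
      ring
    rw [hrec, ih, signSumMoment_one h, signSumMoment_zero h]
    push_cast
    ring

theorem signSumMoment_three {p q : ℝ} (h : p + q = 1) (n : ℕ) :
    signSumMoment p q 3 n =
      (3 * n ^ 2 - 2 * n) * (p - q) + n * (n - 1) * (n - 2) * (p - q) ^ 3 := by
  induction n with
  | zero => simp [signSumMoment_zero_right]
  | succ n ih =>
    have hrec : signSumMoment p q 3 (n + 1) =
        signSumMoment p q 3 n + 3 * (p - q) * signSumMoment p q 2 n +
          3 * signSumMoment p q 1 n + (p - q) * signSumMoment p q 0 n := by
      rw [signSumMoment_succ]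
      simp only [signSumMoment, mul_sum, ← sum_add_distrib]
      refine sum_congr rfl fun ij _ => ?_
      obtain rfl := eq_sub_iff_add_eq'.2 h
      ring
    rw [hrec, ih, signSumMoment_two h, signSumMoment_one h, signSumMoment_zero h]
    push_cast
    ring

theorem pow_mul_pow_swap_le {p q : ℝ} (hq : 0 ≤ q) (hqp : q ≤ p) {i j : ℕ} (hij : j ≤ i) :
    q ^ i * p ^ j ≤ p ^ i * q ^ j := by
  obtain ⟨k, rfl⟩ := Nat.exists_eq_add_of_le hij
  have hp := hq.trans hqp
  calc q ^ (j + k) * p ^ j = (p ^ j * q ^ j) * q ^ k := by ring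
    _ ≤ (p ^ j * q ^ j) * p ^ k := by gcongr
    _ = p ^ (j + k) * q ^ j := by ring

/-- The odd polynomial `3 y - y ^ 3` is at most `2` for `y ≥ 0`, so it bounds twice the sign. -/
theorem sub_mul_cubic_le_two_mul_abs {p q s : ℝ} (hq : 0 ≤ q) (hqp : q ≤ p) (hs : 0 ≤ s)
    (i j : ℕ) :
    (p ^ i * q ^ j - q ^ i * p ^ j) * (3 * (((i : ℝ) - j) * s) - (((i : ℝ) - j) * s) ^ 3) ≤
      2 * |p ^ i * q ^ j - q ^ i * p ^ j| := by
  have cubic_le : ∀ y : ℝ, 0 ≤ y → 3 * y - y ^ 3 ≤ 2 := fun y hy => by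
    nlinarith [mul_nonneg (sq_nonneg (y - 1)) (by linarith : 0 ≤ y + 2)]
  rcases le_total j i with hij | hij
  · have hd := sub_nonneg.2 (pow_mul_pow_swap_le hq hqp hij)
    have hy : 0 ≤ ((i : ℝ) - j) * s := mul_nonneg (sub_nonneg.2 (by exact_mod_cast hij)) hs
    rw [abs_of_nonneg hd]
    nlinarith [mul_le_mul_of_nonneg_left (cubic_le _ hy) hd]
  · have hd : 0 ≤ q ^ i * p ^ j - p ^ i * q ^ j := by
      linarith [pow_mul_pow_swap_le hq hqp hij]
    have hy : 0 ≤ ((j : ℝ) - i) * s := mul_nonneg (sub_nonneg.2 (by exact_mod_cast hij)) hs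
    rw [abs_sub_comm, abs_of_nonneg hd]
    linear_combination mul_le_mul_of_nonneg_left (cubic_le _ hy) hd

/-- The `ℓ¹` distance between the binomial laws with parameters `(n, (1 + δ) / 2)` and
`(n, (1 - δ) / 2)` is at least `√n δ` as long as `n δ ^ 2 ≤ 1`. -/
theorem sqrt_mul_le_sum_choose_mul_abs {δ : ℝ} (hδ : 0 ≤ δ) (hδ1 : δ ≤ 1) {n : ℕ} (hn : 1 ≤ n)
    (hnδ : n * δ ^ 2 ≤ 1) :
    √n * δ ≤ ∑ ij ∈ antidiagonal n, (n.choose ij.1 : ℝ) *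
      |((1 + δ) / 2) ^ ij.1 * ((1 - δ) / 2) ^ ij.2 -
        ((1 - δ) / 2) ^ ij.1 * ((1 + δ) / 2) ^ ij.2| := by
  set p := (1 + δ) / 2 with hp
  set q := (1 - δ) / 2 with hq
  have hn' : (1 : ℝ) ≤ n := by exact_mod_cast hn
  have ht : 0 < √(n : ℝ) := Real.sqrt_pos.2 (by linarith)
  have ht2 : √(n : ℝ) ^ 2 = n := Real.sq_sqrt (by linarith)
  set t := √(n : ℝ)
  set s := 1 / (2 * t) with hs
  have hsum : 3 * s * (signSumMoment p q 1 n - signSumMoment q p 1 n) -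
      s ^ 3 * (signSumMoment p q 3 n - signSumMoment q p 3 n) ≤
      2 * ∑ ij ∈ antidiagonal n, (n.choose ij.1 : ℝ) *
        |p ^ ij.1 * q ^ ij.2 - q ^ ij.1 * p ^ ij.2| := by
    simp only [signSumMoment, ← sum_sub_distrib, mul_sum]
    refine sum_le_sum fun ij _ => ?_
    have h := mul_le_mul_of_nonneg_left
      (sub_mul_cubic_le_two_mul_abs (p := p) (q := q) (s := s) (by linarith) (by linarith)
        (by positivity) ij.1 ij.2) (Nat.cast_nonneg (α := ℝ) (n.choose ij.1))
    linear_combination h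
  rw [signSumMoment_one (by ring), signSumMoment_one (by ring), signSumMoment_three (by ring),
    signSumMoment_three (by ring), show p - q = δ by ring, show q - p = -δ by ring] at hsum
  have hthird : (3 * (n : ℝ) ^ 2 - 2 * n) * δ + n * (n - 1) * (n - 2) * δ ^ 3 ≤
      4 * n ^ 2 * δ := by
    have h1 : (n : ℝ) * (n - 1) * (n - 2) * δ ^ 3 ≤ n ^ 3 * δ ^ 3 := by
      gcongr
      nlinarith
    have h2 : (n : ℝ) ^ 2 * δ * (n * δ ^ 2) ≤ n ^ 2 * δ * 1 := by gcongr
    have h3 : 0 ≤ (n : ℝ) * δ := by positivity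
    nlinarith
  have hmul := mul_le_mul_of_nonneg_left hthird (by positivity : 0 ≤ s ^ 3)
  have hval : 3 * s * (n * δ) - s ^ 3 * (4 * n ^ 2 * δ) = t * δ := by
    rw [← ht2, hs]
    field_simp
    ring
  linarith

/-- The weights of the first binomial factor out and sum to one. -/
theorem sum_choose_mul_abs_eq {δ : ℝ} (hδ1 : δ < 1) (hδ : -1 ≤ δ) (a b : ℕ) :
    ((1 - δ) ^ (a + b) / 2 ^ (a + b)) *
      ∑ k₁ ∈ range (a + 1), ∑ k₂ ∈ range (b + 1), (a.choose k₁ : ℝ) * (b.choose k₂ : ℝ) *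
        |((1 + δ) / (1 - δ)) ^ (k₁ + k₂) - ((1 + δ) / (1 - δ)) ^ (k₁ + b - k₂)| =
    ∑ ij ∈ antidiagonal b, (b.choose ij.1 : ℝ) *
      |((1 + δ) / 2) ^ ij.1 * ((1 - δ) / 2) ^ ij.2 -
        ((1 - δ) / 2) ^ ij.1 * ((1 + δ) / 2) ^ ij.2| := by
  have hu : 0 < 1 - δ := by linarith
  set q := (1 - δ) / 2 with hq
  set z := (1 + δ) / (1 - δ) with hz
  have hq0 : 0 < q := by positivity
  have hz0 : 0 ≤ z := div_nonneg (by linarith) hu.le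
  have hp : (1 + δ) / 2 = z * q := by rw [hz, hq]; field_simp
  have hqz : q * (z + 1) = 1 := by rw [hz, hq]; field_simp; ring
  have hfactor : ∑ k₁ ∈ range (a + 1), ∑ k₂ ∈ range (b + 1),
      (a.choose k₁ : ℝ) * (b.choose k₂ : ℝ) * |z ^ (k₁ + k₂) - z ^ (k₁ + b - k₂)| =
      (z + 1) ^ a * ∑ k ∈ range (b + 1), (b.choose k : ℝ) * |z ^ k - z ^ (b - k)| := by
    rw [add_pow, sum_mul_sum]
    refine sum_congr rfl fun k₁ _ => sum_congr rfl fun k₂ hk₂ => ?_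
    rw [Nat.add_sub_assoc (mem_range_succ_iff.1 hk₂), pow_add, pow_add, ← mul_sub, abs_mul,
      abs_of_nonneg (pow_nonneg hz0 k₁), one_pow]
    ring
  rw [hfactor, ← div_pow, ← hq, pow_add, hp, mul_mul_mul_comm, ← mul_pow, hqz, one_pow, one_mul,
    Nat.sum_antidiagonal_eq_sum_range_succ_mk, mul_sum]
  refine sum_congr rfl fun k hk => ?_
  have hkb : q ^ b = q ^ k * q ^ (b - k) := by
    rw [← pow_add, Nat.add_sub_cancel' (mem_range_succ_iff.1 hk)]
  rw [mul_left_comm, ← abs_of_pos (pow_pos hq0 b), ← abs_mul, hkb]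
  congr 2
  rw [mul_pow, mul_pow]
  ring

/-- Analytic lower bound on a weighted sum of binomial coefficients
(Lemma on the distance between two conditional tree distributions):
for `δ = ε/√n`, `a + b = n` and `b ≥ n/4`,
`((1−δ)ⁿ/2ⁿ) · ∑_{k₁,k₂} C(a,k₁)C(b,k₂)·|z^{k₁+k₂} − z^{k₁+b−k₂}| ≥ C₂ ε`
where `z = (1+δ)/(1−δ)`. -/
theorem distance_lb_two_binomials :
    ∃ C₁ C₂ : ℝ, 0 < C₁ ∧ 0 < C₂ ∧
      ∀ (ε : ℝ), 0 < ε → ε ≤ 1 →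
      ∀ (n a b : ℕ), C₁ ≤ (n : ℝ) → a + b = n → (n : ℝ) / 4 ≤ (b : ℝ) →
        C₂ * ε ≤
          ((1 - ε / Real.sqrt n) ^ n / 2 ^ n) *
            ∑ k₁ ∈ Finset.range (a + 1), ∑ k₂ ∈ Finset.range (b + 1),
              (a.choose k₁ : ℝ) * (b.choose k₂ : ℝ) *
                |((1 + ε / Real.sqrt n) / (1 - ε / Real.sqrt n)) ^ (k₁ + k₂) -
                  ((1 + ε / Real.sqrt n) / (1 - ε / Real.sqrt n)) ^ (k₁ + b - k₂)| := by
  refine ⟨2, 1 / 2, by norm_num, by norm_num, fun ε hε hε1 n a b hn hab hb => ?_⟩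
  have hn0 : (0 : ℝ) < n := by linarith
  have hsq : √(n : ℝ) ^ 2 = n := Real.sq_sqrt hn0.le
  have ht : 0 < √(n : ℝ) := Real.sqrt_pos.2 hn0
  have ht1 : 1 < √(n : ℝ) := by nlinarith
  have hδ : 0 < ε / √(n : ℝ) := by positivity
  have hδ1 : ε / √(n : ℝ) < 1 := (div_lt_one ht).2 (by linarith)
  have hb0 : (0 : ℝ) < b := by linarith
  have hbn : (b : ℝ) ≤ n := by exact_mod_cast (by omega : b ≤ n)
  have hbδ : b * (ε / √(n : ℝ)) ^ 2 ≤ 1 := by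
    rw [div_pow, hsq, ← mul_div_assoc, div_le_one hn0]
    exact (mul_le_of_le_one_right hb0.le (pow_le_one₀ hε.le hε1)).trans hbn
  have hsqrt : √(n : ℝ) / 2 ≤ √(b : ℝ) := Real.le_sqrt_of_sq_le (by rw [div_pow, hsq]; linarith)
  rw [← hab, sum_choose_mul_abs_eq (by rwa [hab]) (by rw [hab]; linarith), hab]
  calc 1 / 2 * ε = √(n : ℝ) / 2 * (ε / √(n : ℝ)) := by field_simp
    _ ≤ √(b : ℝ) * (ε / √(n : ℝ)) := by gcongr
    _ ≤ _ := sqrt_mul_le_sum_choose_mul_abs hδ.le hδ1.le (by exact_mod_cast hb0) hbδ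
end

section
/- Let X ∼ Bin(m, p). Then for every real t with 0 < t·m ≤ 1/16, E[e^{t·X²}] ≤ exp(16·t·m²·p² + 2·t·m·p). -/
open Finset

/-- Conditioning on the last trial: an expectation under `Bin(n + 1, p)` in terms of `Bin(n, p)`. -/
theorem binomial_sum_succ (n : ℕ) (p : ℝ) (f : ℕ → ℝ) :
    ∑ k ∈ Finset.range (n + 2), ((n + 1).choose k : ℝ) * p ^ k * (1 - p) ^ (n + 1 - k) * f k
      = ∑ k ∈ Finset.range (n + 1),
          (n.choose k : ℝ) * p ^ k * (1 - p) ^ (n - k) * ((1 - p) * f k + p * f (k + 1)) := by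
  have h_fail : ∑ k ∈ Finset.range (n + 1), (n.choose k : ℝ) * p ^ k * (1 - p) ^ (n - k + 1) * f k
      = ∑ k ∈ Finset.range (n + 1),
          (n.choose (k + 1) : ℝ) * p ^ (k + 1) * (1 - p) ^ (n - k) * f (k + 1)
        + (1 - p) ^ (n + 1) * f 0 := by
    rw [Finset.sum_range_succ', Finset.sum_range_succ _ n]
    simp only [Nat.choose_succ_self, Nat.cast_zero, zero_mul, add_zero, Nat.choose_zero_right,
      Nat.cast_one, pow_zero, one_mul, Nat.sub_zero]
    congr 1
    refine Finset.sum_congr rfl fun k hk => ?_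
    have hk' : n - (k + 1) + 1 = n - k := by have := Finset.mem_range.mp hk; omega
    rw [hk']
  have h_split : ∑ k ∈ Finset.range (n + 1),
          (n.choose k : ℝ) * p ^ k * (1 - p) ^ (n - k) * ((1 - p) * f k + p * f (k + 1))
      = ∑ k ∈ Finset.range (n + 1), (n.choose k : ℝ) * p ^ k * (1 - p) ^ (n - k + 1) * f k
        + ∑ k ∈ Finset.range (n + 1),
          (n.choose k : ℝ) * p ^ (k + 1) * (1 - p) ^ (n - k) * f (k + 1) := by
    rw [← Finset.sum_add_distrib]
    exact Finset.sum_congr rfl fun k _ => by ring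
  rw [h_split, h_fail, Finset.sum_range_succ', add_right_comm, ← Finset.sum_add_distrib]
  congr 1
  · refine Finset.sum_congr rfl fun k _ => ?_
    rw [Nat.choose_succ_succ, Nat.add_sub_add_right]
    push_cast
    ring
  · simp

theorem exp_sub_one_le_two_mul {y : ℝ} (hy0 : 0 ≤ y) (hy1 : y ≤ 1) : Real.exp y - 1 ≤ 2 * y := by
  have h := Real.abs_exp_sub_one_le (x := y) (by rwa [abs_of_nonneg hy0])
  rw [abs_of_nonneg hy0] at h
  exact (le_abs_self _).trans h

/-- MGF bound for a linear tilt of the square of a binomial. -/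
theorem binomial_square_add_linear_mgf_bound (p t : ℝ) (hp0 : 0 ≤ p) (hp1 : p ≤ 1) (ht : 0 ≤ t)
    (n : ℕ) (b : ℝ) (hb : 0 ≤ b) (h : 2 * t * n + b + 4 * p * t * n ≤ 1) :
    ∑ k ∈ Finset.range (n + 1),
        (n.choose k : ℝ) * p ^ k * (1 - p) ^ (n - k) * Real.exp (t * (k : ℝ) ^ 2 + b * k)
      ≤ Real.exp (2 * p * (t + b) * n + 4 * p ^ 2 * t * (n : ℝ) ^ 2) := by
  induction n generalizing b with
  | zero => simp
  | succ n ih =>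
    have hpt : 0 ≤ p * t := mul_nonneg hp0 ht
    push_cast at h ⊢
    rw [binomial_sum_succ n p fun k => Real.exp (t * (k : ℝ) ^ 2 + b * k)]
    have step : ∀ k ∈ Finset.range (n + 1),
        (n.choose k : ℝ) * p ^ k * (1 - p) ^ (n - k) *
          ((1 - p) * Real.exp (t * (k : ℝ) ^ 2 + b * k)
            + p * Real.exp (t * ((k + 1 : ℕ) : ℝ) ^ 2 + b * (k + 1 : ℕ)))
        ≤ Real.exp (2 * p * (t + b)) * ((n.choose k : ℝ) * p ^ k * (1 - p) ^ (n - k) *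
            Real.exp (t * (k : ℝ) ^ 2 + (b + 4 * p * t) * k)) := by
      intro k hk
      have hkn : (k : ℝ) ≤ n := by exact_mod_cast Nat.lt_succ_iff.mp (Finset.mem_range.mp hk)
      have htk : t * k ≤ t * n := mul_le_mul_of_nonneg_left hkn ht
      have hw : 0 ≤ (n.choose k : ℝ) * p ^ k * (1 - p) ^ (n - k) := by
        have := sub_nonneg.mpr hp1
        positivity
      have hy0 : 0 ≤ 2 * t * k + t + b := by positivity
      have hy1 : 2 * t * k + t + b ≤ 1 := by
        have : 0 ≤ p * t * n := by positivity
        nlinarith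
      have hfac : 1 + p * (Real.exp (2 * t * k + t + b) - 1)
          ≤ Real.exp (2 * p * (2 * t * k + t + b)) := by
        have h1 := mul_le_mul_of_nonneg_left (exp_sub_one_le_two_mul hy0 hy1) hp0
        have h2 := Real.add_one_le_exp (2 * p * (2 * t * k + t + b))
        linarith
      rw [mul_left_comm]
      refine mul_le_mul_of_nonneg_left ?_ hw
      calc _ = Real.exp (t * (k : ℝ) ^ 2 + b * k)
              * (1 + p * (Real.exp (2 * t * k + t + b) - 1)) := by
            have : t * ((k + 1 : ℕ) : ℝ) ^ 2 + b * (k + 1 : ℕ)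
                = (t * (k : ℝ) ^ 2 + b * k) + (2 * t * k + t + b) := by push_cast; ring
            rw [this, Real.exp_add _ (2 * t * k + t + b)]
            ring
        _ ≤ Real.exp (t * (k : ℝ) ^ 2 + b * k) * Real.exp (2 * p * (2 * t * k + t + b)) :=
            mul_le_mul_of_nonneg_left hfac (Real.exp_pos _).le
        _ = _ := by
            rw [← Real.exp_add, ← Real.exp_add]
            congr 1
            ring
    refine (Finset.sum_le_sum step).trans ?_
    rw [← Finset.mul_sum]
    have hind := ih (b + 4 * p * t) (by nlinarith) (by nlinarith)
    refine (mul_le_mul_of_nonneg_left hind (Real.exp_pos _).le).trans ?_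
    rw [← Real.exp_add, Real.exp_le_exp]
    have : 0 ≤ p ^ 2 * t := by positivity
    nlinarith

/-- MGF bound for the square of a binomial: if `X ∼ Bin(m, p)` and `0 < t·m ≤ 1/16`,
then `E[e^{t X²}] ≤ exp(16·t·m²·p² + 2·t·m·p)`. -/
theorem binomial_square_mgf_bound
    (m : ℕ) (p t : ℝ) (hp0 : 0 ≤ p) (hp1 : p ≤ 1)
    (ht0 : 0 < t * m) (ht1 : t * m ≤ 1 / 16) :
    ∑ k ∈ Finset.range (m + 1),
        (m.choose k : ℝ) * p ^ k * (1 - p) ^ (m - k) * Real.exp (t * (k : ℝ) ^ 2)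
      ≤ Real.exp (16 * t * (m : ℝ) ^ 2 * p ^ 2 + 2 * t * m * p) := by
  have hm : (0 : ℝ) ≤ m := m.cast_nonneg
  have ht : 0 < t := pos_of_mul_pos_left ht0 hm
  have hptm : p * (t * m) ≤ t * m := mul_le_of_le_one_left ht0.le hp1
  have h := binomial_square_add_linear_mgf_bound p t hp0 hp1 ht.le m 0 le_rfl (by linarith)
  simp only [zero_mul, add_zero] at h
  refine h.trans (Real.exp_le_exp.mpr ?_)
  have : 0 ≤ p ^ 2 * t * (m : ℝ) ^ 2 := by positivity
  linarith
end

section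
/- Fix c > 0 and positive integers m, Δ, D with m/Δ ≤ c·√D and D > max(16·c⁴, e^{100}). Fix an integer k > 0 and a tuple of nonnegative integers (a₁, …, a_D) summing to m such that L := ∑_{i=1}^k a_i > k·Δ. Let (α₁, …, α_D) follow the multinomial distribution with parameters m and (1/D, …, 1/D). Then e^{4L} · Pr[ (α₁, …, α_D) = (a₁, …, a_D) ] ≤ m · exp(−(1/5)·L·log D). -/
open Finset

/-- A single term of the multinomial expansion of `(∑ i, w i) ^ ∑ i, a i` is at most the whole sum,
for nonnegative weights `w`. -/
theorem multinomial_mul_prod_pow_le {ι : Type*} [Fintype ι] (w : ι → ℝ) (hw : ∀ i, 0 ≤ w i)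
    (a : ι → ℕ) :
    (((∑ i, a i).factorial : ℝ) / ∏ i, ((a i).factorial : ℝ)) * ∏ i, w i ^ a i
      ≤ (∑ i, w i) ^ ∑ i, a i := by
  classical
  have hmul : (((∑ i, a i).factorial : ℝ) / ∏ i, ((a i).factorial : ℝ))
      = (Nat.multinomial univ a : ℝ) := by
    rw [div_eq_iff (prod_ne_zero_iff.mpr fun i _ => by positivity), mul_comm]
    exact_mod_cast (Nat.multinomial_spec univ a).symm
  rw [hmul, sum_pow_eq_sum_piAntidiag]
  refine single_le_sum (f := fun b : ι → ℕ => (Nat.multinomial univ b : ℝ) * ∏ i, w i ^ b i)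
    (fun b _ => mul_nonneg (by positivity) (prod_nonneg fun i _ => pow_nonneg (hw i) _)) ?_
  simp

/-- Chernoff bound for the uniform multinomial distribution on `D` cells: the probability of a
point with `∑ i, a i = m` and `∑ i ∈ s, a i = L`, times `x ^ L`, is at most
`exp (m * (#s * x / D))` for every `x ≥ 0`. -/
theorem uniform_multinomial_mul_pow_le {D : ℕ} (hD : 0 < D) (a : Fin D → ℕ) (s : Finset (Fin D))
    {x : ℝ} (hx : 0 ≤ x) :
    (((∑ i, a i).factorial : ℝ) / ∏ i, ((a i).factorial : ℝ)) * (1 / (D : ℝ)) ^ (∑ i, a i)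
        * x ^ (∑ i ∈ s, a i)
      ≤ Real.exp ((∑ i, a i : ℕ) * (#s * x / D)) := by
  have hD' : (0 : ℝ) < D := by exact_mod_cast hD
  have h := multinomial_mul_prod_pow_le (fun i => 1 / (D : ℝ) * if i ∈ s then x else 1)
    (fun i => by split_ifs <;> positivity) a
  have hprod : ∏ i, (1 / (D : ℝ) * if i ∈ s then x else 1) ^ a i
      = (1 / (D : ℝ)) ^ (∑ i, a i) * x ^ (∑ i ∈ s, a i) := by
    simp_rw [mul_pow, prod_mul_distrib, prod_pow_eq_pow_sum, ite_pow, one_pow]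
    rw [prod_ite_mem, univ_inter, prod_pow_eq_pow_sum]
  have hw : ∑ i, (1 / (D : ℝ) * if i ∈ s then x else 1) ≤ Real.exp (#s * x / D) := by
    calc ∑ i, (1 / (D : ℝ) * if i ∈ s then x else 1)
        ≤ ∑ i, (1 / (D : ℝ) * ((if i ∈ s then x else 0) + 1)) := by
          refine sum_le_sum fun i _ => mul_le_mul_of_nonneg_left ?_ (by positivity)
          split_ifs <;> linarith
      _ = #s * x / D + 1 := by
          rw [← mul_sum, sum_add_distrib, sum_ite_mem]
          simp
          field_simp
      _ ≤ _ := Real.add_one_le_exp _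
  rw [hprod, ← mul_assoc] at h
  refine h.trans ?_
  rw [Real.exp_nat_mul]
  exact pow_le_pow_left₀ (sum_nonneg fun i _ => by split_ifs <;> positivity) hw _

/-- Pointwise bound on a multinomial probability: if `m/Δ ≤ c·√D`,
`D > max(16c⁴, e^{100})`, `k > 0`, and `(a₁,…,a_D)` sums to `m` with
`L := ∑_{i<k} aᵢ > k·Δ`, then
`e^{4L} · Pr[(α₁,…,α_D) = (a₁,…,a_D)] ≤ m · exp(−(1/5)·L·log D)`,
where the multinomial probability is `(m!/(a₁!⋯a_D!))·D^{−m}`. -/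
theorem multinomial_point_probability_bound
    (c : ℝ) (hc : 0 < c)
    (m Δ D : ℕ) (hm : 0 < m) (hΔ : 0 < Δ) (hD0 : 0 < D)
    (hratio : (m : ℝ) / (Δ : ℝ) ≤ c * Real.sqrt D)
    (hD : max (16 * c ^ 4) (Real.exp 100) < (D : ℝ))
    (k : ℕ) (hk : 0 < k) (hkD : k ≤ D)
    (a : Fin D → ℕ) (hsum : ∑ i, a i = m)
    (hL : k * Δ < ∑ i ∈ Finset.univ.filter (fun i : Fin D => (i : ℕ) < k), a i) :
    Real.exp (4 * ((∑ i ∈ Finset.univ.filter (fun i : Fin D => (i : ℕ) < k), a i : ℕ) : ℝ)) *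
        (((m.factorial : ℝ) / ∏ i, ((a i).factorial : ℝ)) * (1 / (D : ℝ)) ^ m)
      ≤ (m : ℝ) *
          Real.exp (-(1 / 5) *
            ((∑ i ∈ Finset.univ.filter (fun i : Fin D => (i : ℕ) < k), a i : ℕ) : ℝ) *
            Real.log D) := by
  have hD' : (0 : ℝ) < D := by exact_mod_cast hD0
  have hΔ' : (0 : ℝ) < Δ := by exact_mod_cast hΔ
  have hcard : #(univ.filter (fun i : Fin D => (i : ℕ) < k)) = k := by
    rw [Fin.card_filter_val_lt, min_eq_right hkD]
  have hsq : 0 < Real.sqrt D := Real.sqrt_pos.mpr hD'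
  have hP := uniform_multinomial_mul_pow_le hD0 a (univ.filter (fun i : Fin D => (i : ℕ) < k))
    (x := Real.sqrt D / c) (by positivity)
  rw [hcard, hsum] at hP
  generalize ∑ i ∈ univ.filter (fun i : Fin D => (i : ℕ) < k), a i = L at hL hP ⊢
  generalize ((m.factorial : ℝ) / ∏ i, ((a i).factorial : ℝ)) * (1 / (D : ℝ)) ^ m = P at hP ⊢
  have hL' : (k : ℝ) * Δ ≤ L := by exact_mod_cast hL.le
  have hexponent : (m : ℝ) * (k * (Real.sqrt D / c) / D) ≤ L := by
    have hmΔ : (m : ℝ) ≤ c * Real.sqrt D * Δ := (div_le_iff₀ hΔ').mp hratio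
    calc (m : ℝ) * (k * (Real.sqrt D / c) / D)
        ≤ c * Real.sqrt D * Δ * (k * (Real.sqrt D / c) / D) := by gcongr
      _ = k * Δ * (Real.sqrt D ^ 2 / D) := by field_simp
      _ = k * Δ := by rw [Real.sq_sqrt hD'.le, div_self hD'.ne', mul_one]
      _ ≤ L := hL'
  have hlog : 100 < Real.log D :=
    (Real.lt_log_iff_exp_lt hD').mpr ((le_max_right _ _).trans_lt hD)
  have hlogc : 4 * Real.log c ≤ Real.log D := by
    have hc4 : c ^ 4 ≤ D := by
      have := (le_max_left _ _).trans_lt hD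
      have : 0 < c ^ 4 := by positivity
      linarith
    simpa using Real.log_le_log (by positivity) hc4
  have hx : (Real.sqrt D / c) ^ L = Real.exp (L * (Real.log D / 2 - Real.log c)) := by
    rw [Real.exp_nat_mul, ← Real.log_sqrt hD'.le, ← Real.log_div hsq.ne' hc.ne',
      Real.exp_log (by positivity)]
  have hPL : P ≤ Real.exp (L - L * (Real.log D / 2 - Real.log c)) := by
    rw [Real.exp_sub, le_div_iff₀ (Real.exp_pos _), ← hx]
    exact hP.trans (Real.exp_le_exp.mpr hexponent)
  calc Real.exp (4 * (L : ℝ)) * P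
      ≤ Real.exp (4 * (L : ℝ)) * Real.exp (L - L * (Real.log D / 2 - Real.log c)) := by gcongr
    _ ≤ 1 * Real.exp (-(1 / 5) * L * Real.log D) := by
        rw [← Real.exp_add, one_mul, Real.exp_le_exp]
        nlinarith [mul_nonneg (Nat.cast_nonneg (α := ℝ) L)
          (show 0 ≤ Real.log D * (3 / 10) - Real.log c - 5 by linarith)]
    _ ≤ m * Real.exp (-(1 / 5) * L * Real.log D) := by
        gcongr
        exact_mod_cast hm
end

section
/- For every c > 0 there exists D₀ > 0 (depending only on c) such that the following holds. Let D ≥ D₀ and Δ ≥ 40·D be integers, and let m be a positive integer with m ≤ c·Δ·√D. Let (α₁, …, α_D) follow the multinomial distribution with parameters m and (1/D, …, 1/D), and let ν(α) = |{i : α_i > Δ}|. Then for every integer k with 1 ≤ k ≤ c·√D and every real t ≤ 4: E[ ∏_{i : α_i > Δ} e^{t·α_i} · 1[ν(α) = k] ] ≤ exp( −(1/80)·Δ·log D ). -/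
open Finset

/-- The number of draws (among `m` i.i.d. uniform draws `τ : Fin m → Fin D`) landing
on `i`; `(cnt τ ·)` is distributed as a multinomial with parameters `m` and `(1/D,…,1/D)`. -/
def cnt {m D : ℕ} (τ : Fin m → Fin D) (i : Fin D) : ℕ :=
  (Finset.univ.filter (fun k => τ k = i)).card

theorem prod_pow_cnt {m D : ℕ} (τ : Fin m → Fin D) (S : Finset (Fin D)) (w : ℝ) :
    ∏ i ∈ S, w ^ cnt τ i = ∏ j, if τ j ∈ S then w else 1 := by
  have h (i : Fin D) : w ^ cnt τ i = ∏ j, if τ j = i then w else 1 := by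
    rw [Finset.prod_ite, Finset.prod_const, Finset.prod_const_one, mul_one, cnt]
  simp_rw [h]
  rw [Finset.prod_comm]
  refine Finset.prod_congr rfl fun j _ => ?_
  rw [Finset.prod_ite_eq]

/-- The joint generating function of the counts on `S`, evaluated on the diagonal. -/
theorem sum_prod_pow_cnt (m D : ℕ) (S : Finset (Fin D)) (w : ℝ) :
    ∑ τ : Fin m → Fin D, ∏ i ∈ S, w ^ cnt τ i = ((D : ℝ) + (S.card : ℝ) * (w - 1)) ^ m := by
  simp_rw [prod_pow_cnt]
  have h : ∑ i : Fin D, (if i ∈ S then w else 1) = (D : ℝ) + (S.card : ℝ) * (w - 1) := by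
    have h' (i : Fin D) : (if i ∈ S then w else 1) = 1 + if i ∈ S then w - 1 else 0 := by
      split_ifs <;> ring
    simp_rw [h', Finset.sum_add_distrib]
    simp [mul_sub]
  rw [← h]
  exact (Fintype.sum_pow (fun i : Fin D => if i ∈ S then w else 1) m).symm

theorem sum_prod_pow_cnt_div_le {m D : ℕ} (hD : 0 < D) (S : Finset (Fin D)) {w : ℝ}
    (hw : 1 ≤ w) :
    (∑ τ : Fin m → Fin D, ∏ i ∈ S, w ^ cnt τ i) / (D : ℝ) ^ m
      ≤ Real.exp ((m : ℝ) * ((S.card : ℝ) * w / D)) := by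
  have hD' : (0 : ℝ) < D := by exact_mod_cast hD
  have hS : (0 : ℝ) ≤ S.card := Nat.cast_nonneg _
  rw [sum_prod_pow_cnt, ← div_pow, Real.exp_nat_mul]
  refine pow_le_pow_left₀ ?_ ?_ m
  · have := mul_nonneg hS (sub_nonneg.2 hw)
    positivity
  · refine le_trans ?_ (Real.add_one_le_exp _)
    rw [add_div, div_self hD'.ne', add_comm]
    gcongr
    linarith

/-- Exponential tilting: on `{n > Δ}` the weight `exp (t * n)` is dominated by `exp (μ * n)`
up to the factor gained at the threshold. -/
theorem exp_mul_le_of_lt {t a μ : ℝ} (ht : t ≤ a) (hμ : a ≤ μ) {Δ n : ℕ} (hn : Δ < n) :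
    Real.exp (t * n) ≤ Real.exp ((a - μ) * Δ) * Real.exp μ ^ n := by
  rw [← Real.exp_nat_mul, ← Real.exp_add, Real.exp_le_exp]
  have hn' : (Δ : ℝ) ≤ n := by exact_mod_cast hn.le
  nlinarith [mul_nonneg (sub_nonneg.2 ht) (Nat.cast_nonneg (α := ℝ) n),
    mul_nonneg (sub_nonneg.2 hμ) (sub_nonneg.2 hn')]

theorem truncated_prod_le_sum_powersetCard {m D : ℕ} (τ : Fin m → Fin D) (Δ k : ℕ)
    {t a μ : ℝ} (ht : t ≤ a) (hμ : a ≤ μ) :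
    (if (Finset.univ.filter (fun i : Fin D => Δ < cnt τ i)).card = k then
        ∏ i ∈ Finset.univ.filter (fun i : Fin D => Δ < cnt τ i), Real.exp (t * (cnt τ i : ℝ))
      else 0)
      ≤ ∑ S ∈ (Finset.univ : Finset (Fin D)).powersetCard k,
          Real.exp ((a - μ) * Δ) ^ k * ∏ i ∈ S, Real.exp μ ^ cnt τ i := by
  split_ifs with h
  · set T := Finset.univ.filter (fun i : Fin D => Δ < cnt τ i)
    calc ∏ i ∈ T, Real.exp (t * (cnt τ i : ℝ))
        ≤ ∏ i ∈ T, (Real.exp ((a - μ) * Δ) * Real.exp μ ^ cnt τ i) :=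
          Finset.prod_le_prod (fun _ _ => (Real.exp_pos _).le) fun i hi =>
            exp_mul_le_of_lt ht hμ (Finset.mem_filter.1 hi).2
      _ = Real.exp ((a - μ) * Δ) ^ k * ∏ i ∈ T, Real.exp μ ^ cnt τ i := by
          rw [Finset.prod_mul_distrib, Finset.prod_const, h]
      _ ≤ _ := Finset.single_le_sum
          (f := fun S => Real.exp ((a - μ) * Δ) ^ k * ∏ i ∈ S, Real.exp μ ^ cnt τ i)
          (fun _ _ => by positivity)
          (Finset.mem_powersetCard.2 ⟨Finset.subset_univ _, h⟩)
  · exact Finset.sum_nonneg fun _ _ => by positivity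

theorem truncated_mgf_le {m D : ℕ} (hD : 0 < D) (Δ k : ℕ) {t a μ : ℝ} (ht : t ≤ a)
    (hμ : a ≤ μ) (hμ0 : 0 ≤ μ) :
    (∑ τ : Fin m → Fin D,
        if (Finset.univ.filter (fun i : Fin D => Δ < cnt τ i)).card = k then
          ∏ i ∈ Finset.univ.filter (fun i : Fin D => Δ < cnt τ i),
            Real.exp (t * (cnt τ i : ℝ))
        else 0) / (D : ℝ) ^ m
      ≤ Real.exp (k * (Real.log D + (a - μ) * Δ + m * (Real.exp μ / D))) := by
  have hD' : (0 : ℝ) < D := by exact_mod_cast hD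
  calc _ ≤ (∑ τ : Fin m → Fin D, ∑ S ∈ (Finset.univ : Finset (Fin D)).powersetCard k,
          Real.exp ((a - μ) * Δ) ^ k * ∏ i ∈ S, Real.exp μ ^ cnt τ i) / (D : ℝ) ^ m := by
        gcongr with τ
        exact truncated_prod_le_sum_powersetCard τ Δ k ht hμ
    _ = ∑ S ∈ (Finset.univ : Finset (Fin D)).powersetCard k, Real.exp ((a - μ) * Δ) ^ k *
          ((∑ τ : Fin m → Fin D, ∏ i ∈ S, Real.exp μ ^ cnt τ i) / (D : ℝ) ^ m) := by
        rw [Finset.sum_comm, Finset.sum_div]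
        refine Finset.sum_congr rfl fun S _ => ?_
        rw [← Finset.mul_sum, mul_div_assoc]
    _ ≤ ∑ S ∈ (Finset.univ : Finset (Fin D)).powersetCard k, Real.exp ((a - μ) * Δ) ^ k *
          Real.exp (m * (k * Real.exp μ / D)) := by
        refine Finset.sum_le_sum fun S hS => ?_
        rw [← (Finset.mem_powersetCard.1 hS).2]
        gcongr
        exact sum_prod_pow_cnt_div_le hD S (Real.one_le_exp hμ0)
    _ = (D.choose k : ℝ) * (Real.exp ((a - μ) * Δ) ^ k *
          Real.exp (m * (k * Real.exp μ / D))) := by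
        simp
    _ ≤ (D : ℝ) ^ k * (Real.exp ((a - μ) * Δ) ^ k *
          Real.exp (m * (k * Real.exp μ / D))) := by
        gcongr
        exact_mod_cast Nat.choose_le_pow D k
    _ = _ := by
        nth_rewrite 1 [← Real.exp_log hD']
        rw [← Real.exp_nat_mul, ← Real.exp_nat_mul, ← Real.exp_add, ← Real.exp_add]
        congr 1
        ring

/-- Truncated multinomial MGF bound with a prescribed number `k` of large coordinates:
for `D ≥ D₀`, `Δ ≥ 40D`, `m ≤ c·Δ·√D`, `1 ≤ k ≤ c·√D` and `t ≤ 4`,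
`E[∏_{i : αᵢ > Δ} e^{t·αᵢ} · 1[ν(α) = k]] ≤ exp(−(1/80)·Δ·log D)`,
where `ν(α) = |{i : αᵢ > Δ}|`. -/
theorem truncated_multinomial_mgf_fixed_count
    (c : ℝ) (hc : 0 < c) :
    ∃ D₀ : ℝ, 0 < D₀ ∧
      ∀ D Δ m : ℕ, D₀ ≤ (D : ℝ) → 40 * D ≤ Δ → 0 < m →
        (m : ℝ) ≤ c * (Δ : ℝ) * Real.sqrt D →
        ∀ k : ℕ, 1 ≤ k → (k : ℝ) ≤ c * Real.sqrt D →
        ∀ t : ℝ, t ≤ 4 →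
          (∑ τ : Fin m → Fin D,
              if (Finset.univ.filter (fun i : Fin D => Δ < cnt τ i)).card = k then
                ∏ i ∈ Finset.univ.filter (fun i : Fin D => Δ < cnt τ i),
                  Real.exp (t * (cnt τ i : ℝ))
              else 0) / (D : ℝ) ^ m
            ≤ Real.exp (-(1 / 80) * (Δ : ℝ) * Real.log D) := by
  refine ⟨Real.exp (10 + 4 * c), Real.exp_pos _, ?_⟩
  intro D Δ m hD hΔ _ hm k hk _ t ht
  have hD' : (0 : ℝ) < D := (Real.exp_pos _).trans_le hD
  have hlog : 10 + 4 * c ≤ Real.log D := (Real.le_log_iff_exp_le hD').2 hD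
  have hexp : Real.exp (Real.log D / 2) = √D := by
    rw [Real.exp_half, Real.exp_log hD']
  refine (truncated_mgf_le (by exact_mod_cast hD') Δ k ht (μ := Real.log D / 2)
    (by linarith) (by linarith)).trans (Real.exp_le_exp.2 ?_)
  have hmgf : (m : ℝ) * (Real.exp (Real.log D / 2) / D) ≤ c * Δ := by
    rw [hexp, ← mul_div_assoc, div_le_iff₀ hD']
    calc (m : ℝ) * √D ≤ c * Δ * √D * √D := by gcongr
      _ = c * Δ * D := by rw [mul_assoc, Real.mul_self_sqrt hD'.le]
  have hk' : (1 : ℝ) ≤ k := by exact_mod_cast hk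
  have hΔ' : (40 : ℝ) ≤ Δ := by
    have h1 : 1 ≤ D := by exact_mod_cast hD'
    exact_mod_cast (by lia : 40 ≤ Δ)
  set L := Real.log D
  have hL : 0 ≤ L := by linarith
  have hmain : L + (4 - L / 2) * Δ + m * (Real.exp (L / 2) / D) ≤ -(1 / 80) * Δ * L := by
    nlinarith [mul_nonneg hL (sub_nonneg.2 hΔ'),
      mul_nonneg (sub_nonneg.2 hlog) (by linarith : (0 : ℝ) ≤ Δ),
      mul_nonneg hc.le (by linarith : (0 : ℝ) ≤ Δ)]
  have hneg : -(1 / 80) * (Δ : ℝ) * L ≤ 0 := by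
    nlinarith [mul_nonneg hL (by linarith : (0 : ℝ) ≤ Δ)]
  nlinarith
end

section
/- For every c > 0 there exists D₀ > 0 (depending only on c) such that the following holds. Let D ≥ D₀ and Δ ≥ 40·D be integers, and let m be a positive integer with m ≤ c·Δ·√D. Let (α₁, …, α_D) follow the multinomial distribution with parameters m and (1/D, …, 1/D). Then for every real t ≤ 4: E[ ∏_{i=1}^D e^{t·α_i·1[α_i > Δ]} ] ≤ 1 + c·√D·exp( −(1/80)·Δ·log D ). -/
open Finset

/-- The sum of the counts over `S` is the number of draws landing in `S`, so the exponential of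
`l` times this sum factors over the draws. -/
lemma prod_exp_cnt {m D : ℕ} (τ : Fin m → Fin D) (l : ℝ) (S : Finset (Fin D)) :
    ∏ i ∈ S, Real.exp (l * (cnt τ i : ℝ)) = ∏ k, (if τ k ∈ S then Real.exp l else 1) := by
  have h (i : Fin D) :
      Real.exp (l * (cnt τ i : ℝ)) = ∏ k, (if τ k = i then Real.exp l else 1) := by
    rw [Finset.prod_ite, Finset.prod_const, Finset.prod_const_one, mul_one, ← Real.exp_nat_mul,
      mul_comm, cnt]
  simp_rw [h]
  rw [Finset.prod_comm]
  refine Finset.prod_congr rfl fun k _ => ?_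
  rw [Finset.prod_ite_eq]

/-- The joint moment generating function of the counts in `S`, times `D ^ m`. -/
lemma sum_prod_exp_cnt {m D : ℕ} (l : ℝ) (S : Finset (Fin D)) :
    ∑ τ : Fin m → Fin D, ∏ i ∈ S, Real.exp (l * (cnt τ i : ℝ)) =
      ((D : ℝ) + S.card * (Real.exp l - 1)) ^ m := by
  simp_rw [prod_exp_cnt]
  rw [← Fintype.sum_pow (fun j : Fin D => if j ∈ S then Real.exp l else 1) m]
  congr 1
  have h (j : Fin D) : (if j ∈ S then Real.exp l else 1) =
      1 + if j ∈ S then Real.exp l - 1 else 0 := by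
    split_ifs <;> ring
  simp_rw [h, Finset.sum_add_distrib]
  simp [mul_sub]

/-- Bound on the expectation of `∏ i, (1 + q * exp (l * αᵢ))`. -/
lemma sum_prod_one_add_le {m D : ℕ} (hD : 0 < D) {l q : ℝ} (hl : 0 ≤ l) (hq : 0 ≤ q) :
    (∑ τ : Fin m → Fin D, ∏ i : Fin D, (1 + q * Real.exp (l * (cnt τ i : ℝ)))) / (D : ℝ) ^ m
      ≤ (1 + q * Real.exp (m * Real.exp l / D)) ^ D := by
  have hD' : (0 : ℝ) < D := by exact_mod_cast hD
  simp_rw [Finset.prod_one_add, Finset.prod_mul_distrib, Finset.prod_const]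
  rw [Finset.sum_comm]
  simp_rw [← Finset.mul_sum, sum_prod_exp_cnt]
  have hR : (1 + q * Real.exp (m * Real.exp l / D)) ^ D =
      ∑ S ∈ (Finset.univ : Finset (Fin D)).powerset,
        (q * Real.exp (m * Real.exp l / D)) ^ S.card := by
    have h := Finset.prod_one_add (Finset.univ : Finset (Fin D))
      (f := fun _ => q * Real.exp (m * Real.exp l / D))
    simpa using h
  rw [hR, Finset.sum_div]
  refine Finset.sum_le_sum fun S _ => ?_
  rw [mul_pow, mul_div_assoc, ← div_pow]
  refine mul_le_mul_of_nonneg_left ?_ (by positivity)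
  have he : 1 ≤ Real.exp l := Real.one_le_exp hl
  have h1 : ((D : ℝ) + S.card * (Real.exp l - 1)) / D ≤ Real.exp (S.card * Real.exp l / D) := by
    refine le_trans ?_ (Real.add_one_le_exp _)
    rw [div_add_one hD'.ne']
    refine div_le_div_of_nonneg_right ?_ hD'.le
    nlinarith [(Nat.cast_nonneg S.card : (0 : ℝ) ≤ S.card)]
  have h0 : 0 ≤ ((D : ℝ) + S.card * (Real.exp l - 1)) / D :=
    div_nonneg (add_nonneg hD'.le (mul_nonneg (Nat.cast_nonneg _) (by linarith))) hD'.le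
  refine (pow_le_pow_left₀ h0 h1 m).trans_eq ?_
  rw [← Real.exp_nat_mul, ← Real.exp_nat_mul]
  congr 1
  ring

/-- Pointwise bound of a truncated exponential by an exponential with a larger rate. -/
lemma exp_truncated_le {t l : ℝ} (ht : t ≤ 4) (hl : 4 ≤ l) (a Δ : ℕ) :
    Real.exp (t * (a : ℝ) * (if Δ < a then (1 : ℝ) else 0)) ≤
      1 + Real.exp (-((l - 4) * Δ)) * Real.exp (l * a) := by
  split_ifs with h
  · have h' : (Δ : ℝ) ≤ a := by exact_mod_cast h.le
    have ha : (0 : ℝ) ≤ a := Nat.cast_nonneg a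
    rw [← Real.exp_add]
    have : Real.exp (t * a * 1) ≤ Real.exp (-((l - 4) * Δ) + l * a) :=
      Real.exp_le_exp.mpr (by nlinarith)
    linarith
  · simp only [mul_zero, Real.exp_zero]
    have : 0 < Real.exp (-((l - 4) * (Δ : ℝ))) * Real.exp (l * a) := by positivity
    linarith

/-- Truncated multinomial MGF bound: for `D ≥ D₀`, `Δ ≥ 40D`, `m ≤ c·Δ·√D` and `t ≤ 4`,
`E[∏ᵢ e^{t·αᵢ·1[αᵢ > Δ]}] ≤ 1 + c·√D·exp(−(1/80)·Δ·log D)`. -/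
theorem truncated_multinomial_mgf
    (c : ℝ) (hc : 0 < c) :
    ∃ D₀ : ℝ, 0 < D₀ ∧
      ∀ D Δ m : ℕ, D₀ ≤ (D : ℝ) → 40 * D ≤ Δ → 0 < m →
        (m : ℝ) ≤ c * (Δ : ℝ) * Real.sqrt D →
        ∀ t : ℝ, t ≤ 4 →
          (∑ τ : Fin m → Fin D,
              ∏ i : Fin D,
                Real.exp (t * (cnt τ i : ℝ) * (if Δ < cnt τ i then (1 : ℝ) else 0))) /
              (D : ℝ) ^ m
            ≤ 1 + c * Real.sqrt D * Real.exp (-(1 / 80) * (Δ : ℝ) * Real.log D) := by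
  refine ⟨Real.exp (20 * (4 + c) + 2 / c), Real.exp_pos _, ?_⟩
  intro D Δ m hD hΔ _ hm t ht
  have hD' : (0 : ℝ) < D := (Real.exp_pos _).trans_le hD
  have hDpos : 0 < D := by exact_mod_cast hD'
  have hL : 20 * (4 + c) + 2 / c ≤ Real.log D := (Real.le_log_iff_exp_le hD').mpr hD
  set L := Real.log D with hLdef
  have hDexp : (D : ℝ) = Real.exp L := (Real.exp_log hD').symm
  have h2c : 0 < 2 / c := by positivity
  have hΔ' : (40 : ℝ) ≤ Δ := by
    have : 40 ≤ Δ := by omega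
    exact_mod_cast this
  have hsqrt : Real.sqrt D = Real.exp (L / 2) := by rw [hDexp, Real.exp_half]
  have hL0 : 0 < L := by linarith
  have hmgf : (m : ℝ) * Real.exp (L / 4) / D ≤ c * Δ := by
    rw [div_le_iff₀ hD']
    calc (m : ℝ) * Real.exp (L / 4) ≤ c * Δ * Real.sqrt D * Real.exp (L / 4) := by gcongr
      _ = c * Δ * Real.exp (L / 2 + L / 4) := by rw [hsqrt, Real.exp_add]; ring
      _ ≤ c * Δ * D := by
        rw [hDexp]
        gcongr
        linarith
  have hp : Real.exp (-((L / 4 - 4) * Δ)) * Real.exp (m * Real.exp (L / 4) / D) ≤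
      Real.exp (-(1 / 5) * Δ * L) := by
    rw [← Real.exp_add, Real.exp_le_exp]
    nlinarith
  have hΔL : 40 * L ≤ Δ * L := by gcongr
  have hDp : D * Real.exp (-(1 / 5) * Δ * L) ≤
      c / 2 * Real.exp (-(1 / 80) * Δ * L) := by
    have hc2 : Real.exp (-L) ≤ c / 2 := by
      rw [Real.exp_neg, inv_le_comm₀ (Real.exp_pos _) (by positivity), inv_div]
      linarith [Real.add_one_le_exp L]
    calc D * Real.exp (-(1 / 5) * Δ * L) = Real.exp (L + -(1 / 5) * Δ * L) := by
          rw [Real.exp_add, ← hDexp]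
      _ ≤ Real.exp (-L + -(1 / 80) * Δ * L) := Real.exp_le_exp.mpr (by linarith)
      _ ≤ c / 2 * Real.exp (-(1 / 80) * Δ * L) := by rw [Real.exp_add]; gcongr
  have hDp1 : D * Real.exp (-(1 / 5) * Δ * L) ≤ 1 := by
    rw [hDexp, ← Real.exp_add, Real.exp_le_one_iff]
    linarith
  have hsqrt1 : 1 ≤ Real.sqrt D := by
    rw [hsqrt]
    exact Real.one_le_exp (by linarith)
  have hexp : Real.exp (D * Real.exp (-(1 / 5) * Δ * L)) ≤
      1 + 2 * (D * Real.exp (-(1 / 5) * Δ * L)) := by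
    have h0 : 0 ≤ D * Real.exp (-(1 / 5) * Δ * L) := by positivity
    have h := Real.abs_exp_sub_one_le (abs_le.mpr ⟨by linarith, hDp1⟩)
    rw [abs_of_nonneg h0] at h
    linarith [le_abs_self (Real.exp (D * Real.exp (-(1 / 5) * Δ * L)) - 1)]
  calc (∑ τ : Fin m → Fin D, ∏ i : Fin D,
          Real.exp (t * (cnt τ i : ℝ) * (if Δ < cnt τ i then (1 : ℝ) else 0))) / (D : ℝ) ^ m
      ≤ (∑ τ : Fin m → Fin D, ∏ i : Fin D,
          (1 + Real.exp (-((L / 4 - 4) * Δ)) * Real.exp (L / 4 * (cnt τ i : ℝ)))) /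
            (D : ℝ) ^ m := by
        gcongr with τ _ i _
        exact exp_truncated_le ht (by linarith) _ _
    _ ≤ (1 + Real.exp (-((L / 4 - 4) * Δ)) * Real.exp (m * Real.exp (L / 4) / D)) ^ D :=
        sum_prod_one_add_le hDpos (by linarith) (Real.exp_pos _).le
    _ ≤ (Real.exp (Real.exp (-(1 / 5) * Δ * L))) ^ D := by
        gcongr
        linarith [Real.add_one_le_exp (Real.exp (-(1 / 5) * Δ * L))]
    _ = Real.exp (D * Real.exp (-(1 / 5) * Δ * L)) := (Real.exp_nat_mul _ _).symm
    _ ≤ 1 + c * 1 * Real.exp (-(1 / 80) * Δ * L) := by linarith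
    _ ≤ 1 + c * Real.sqrt D * Real.exp (-(1 / 80) * Δ * L) := by gcongr
end
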